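/- Let n ≥ 1, let E = ℝⁿ × ℝⁿ carry the Euclidean norm and the standard symplectic form ω, and let R > 0. Let φ_k : B_R → E (k ∈ ℕ) and φ_∞ : B_R → E be maps of class C¹ on the open ball B_R such that: (i) each φ_k is symplectic, i.e. ω(Dφ_k(x)u, Dφ_k(x)v) = ω(u,v) for every x ∈ B_R and all u,v ∈ E; (ii) sup_{x∈B_R} ‖φ_k(x) − φ_∞(x)‖ → 0 as k → ∞; (iii) the differential Dφ_∞(x) : E → E is a linear isomorphism for every x ∈ B_R. Then φ_∞ is a symplectic map on B_R, i.e. ω(Dφ_∞(x)u, Dφ_∞(x)v) = ω(u,v) for all x ∈ B_R and u,v ∈ E. (Gromov–Eliashberg C⁰-rigidity theorem.) -/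

import Mathlib

open scoped RealInnerProductSpace

noncomputable section

/-- `E = ℝⁿ × ℝⁿ`. -/
abbrev Esp (n : ℕ) : Type := EuclideanSpace ℝ (Fin n) × EuclideanSpace ℝ (Fin n)

/-- The Euclidean norm on `E = ℝⁿ × ℝⁿ`. -/
def eucNorm {n : ℕ} (p : Esp n) : ℝ := Real.sqrt (‖p.1‖ ^ 2 + ‖p.2‖ ^ 2)

/-- The open Euclidean ball of radius `R` centered at `0` in `E`. -/
def eucBall (n : ℕ) (R : ℝ) : Set (Esp n) := {p | eucNorm p < R}

/-- The standard symplectic form `ω((x,ξ),(y,η)) = ⟪ξ,y⟫ − ⟪η,x⟫` on `E = ℝⁿ × ℝⁿ`. -/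
def symplForm {n : ℕ} (u v : Esp n) : ℝ := ⟪u.2, v.1⟫ - ⟪v.2, u.1⟫

open Set Filter Topology MeasureTheory Metric

section DegreeLinking

/-- Interpolation of the determinant along a line of endomorphisms. -/
theorem exists_det_one_add_eq_sum {E : Type*} [NormedAddCommGroup E] [NormedSpace ℝ E]
    [FiniteDimensional ℝ E] (s : Finset ℝ) (hs : Module.finrank ℝ E < s.card) :
    ∃ l : ℝ → ℝ, ∀ M : E →L[ℝ] E,
      (1 + M).det = ∑ t ∈ s, l t * (1 + t • M).det := by
  classical
  refine ⟨fun t => (Lagrange.basis s id t).eval 1, fun M => ?_⟩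
  set b := Module.finBasis ℝ E
  set A := LinearMap.toMatrix b b (M : E →ₗ[ℝ] E) with hA
  set p : Polynomial ℝ := Matrix.det ((Polynomial.X : Polynomial ℝ) • A.map Polynomial.C
    + (1 : Matrix _ _ ℝ).map Polynomial.C) with hp
  have heval : ∀ t : ℝ, p.eval t = (1 + t • M).det := by
    intro t
    rw [hp, ContinuousLinearMap.det, ← LinearMap.det_toMatrix b, ← Polynomial.coe_evalRingHom,
      RingHom.map_det]
    congr 1
    ext i j
    simp [hA, LinearMap.toMatrix_apply, Matrix.one_apply, Matrix.map_apply, Finsupp.single_apply]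
    split_ifs <;> simp_all <;> ring
  have hdeg : p.degree < s.card := by
    refine lt_of_le_of_lt (Polynomial.degree_le_natDegree) ?_
    have h1 := Polynomial.natDegree_det_X_add_C_le A (1 : Matrix _ _ ℝ)
    rw [Fintype.card_fin] at h1
    exact_mod_cast lt_of_le_of_lt h1 hs
  have hI := Lagrange.eq_interpolate (s := s) (v := (id : ℝ → ℝ)) (Function.injective_id.injOn) hdeg
  have h1 := heval 1
  rw [one_smul] at h1
  rw [← h1, hI, Lagrange.interpolate_apply, Polynomial.eval_finsetSum]
  refine Finset.sum_congr rfl fun t _ => ?_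
  rw [Polynomial.eval_mul, Polynomial.eval_C, id, heval t, mul_comm]

/-- There is no `C¹` retraction of the closed unit ball onto the unit sphere. -/
theorem not_exists_retraction {E : Type*} [NormedAddCommGroup E] [InnerProductSpace ℝ E]
    [FiniteDimensional ℝ E] (r : E → E) (hr : ContDiff ℝ 1 r)
    (hn : ∀ x, ‖r x‖ = 1) (hfix : ∀ x, ‖x‖ = 1 → r x = x) : False := by
  borelize E
  set μ : Measure E := Measure.addHaar
  set c : E → E := fun x => r x - x with hc
  have hcC : ContDiff ℝ 1 c := hr.sub contDiff_id
  set D : E → E →L[ℝ] E := fun x => fderiv ℝ c x with hD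
  have hDc : Continuous D := hcC.continuous_fderiv one_ne_zero
  have hDat : ∀ x, HasStrictFDerivAt c (D x) x := fun x =>
    hcC.contDiffAt.hasStrictFDerivAt one_ne_zero
  obtain ⟨K, hK⟩ := (isCompact_closedBall (0 : E) 1).exists_bound_of_continuousOn hDc.continuousOn
  have hK0 : 0 ≤ K := (norm_nonneg _).trans (hK 0 (by simp))
  have hlip : ∀ x ∈ closedBall (0 : E) 1, ∀ y ∈ closedBall (0 : E) 1, ‖c y - c x‖ ≤ K * ‖y - x‖ :=
    fun x hx y hy => (convex_closedBall (0 : E) 1).norm_image_sub_le_of_norm_fderiv_le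
      (fun z _ => (hDat z).differentiableAt) hK hx hy
  obtain ⟨δ, hδ, hdet⟩ : ∃ δ > 0, ∀ L : E →L[ℝ] E, ‖L‖ < δ → 0 < (1 + L).det := by
    have h1 : ContinuousAt (fun L : E →L[ℝ] E => (1 + L).det) 0 :=
      (ContinuousLinearMap.continuous_det.comp (continuous_const.add continuous_id)).continuousAt
    have h2 : ∀ᶠ L in 𝓝 (0 : E →L[ℝ] E), 0 < (1 + L).det := by
      apply h1.eventually_const_lt
      simp [ContinuousLinearMap.det]
    obtain ⟨δ, hδ, h⟩ := Metric.eventually_nhds_iff.1 h2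
    exact ⟨δ, hδ, fun L hL => h (by simpa using hL)⟩
  set η : ℝ := min (1 / 2) (min (δ / (K + 1)) (1 / (K + 1))) with hη
  have hη0 : 0 < η := by positivity
  have hvol : ∀ t, 0 < t → t < η →
      ∫ x in ball (0 : E) 1, (1 + t • D x).det ∂μ = μ.real (ball 0 1) := by
    intro t ht htη
    have ht1 : t < 1 := by
      have : η ≤ 1 / 2 := min_le_left _ _
      linarith
    have htK : t * (K + 1) < 1 := by
      have : η ≤ 1 / (K + 1) := (min_le_right _ _).trans (min_le_right _ _)
      rw [← lt_div_iff₀ (by positivity)]; linarith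
    have htδ : t * (K + 1) < δ := by
      have : η ≤ δ / (K + 1) := (min_le_right _ _).trans (min_le_left _ _)
      rw [← lt_div_iff₀ (by positivity)]; linarith
    set f : E → E := fun x => x + t • c x with hf
    have hpos : ∀ x ∈ closedBall (0 : E) 1, 0 < (1 + t • D x).det := by
      intro x hx
      apply hdet
      rw [norm_smul, Real.norm_of_nonneg ht.le]
      nlinarith [hK x hx]
    have hf' : ∀ x, HasStrictFDerivAt f (1 + t • D x) x := fun x =>
      (hasStrictFDerivAt_id x).add ((hDat x).const_smul t)
    have hinj : InjOn f (closedBall 0 1) := by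
      intro x hx y hy hxy
      have h1 : y - x = - (t • (c y - c x)) := by
        have : x + t • c x = y + t • c y := hxy
        rw [smul_sub, neg_sub, sub_eq_sub_iff_add_eq_add, add_comm y, add_comm _ x, this, add_comm]
      have h2 : ‖y - x‖ ≤ t * (K * ‖y - x‖) := by
        conv_lhs => rw [h1]
        rw [norm_neg, norm_smul, Real.norm_of_nonneg ht.le]
        exact mul_le_mul_of_nonneg_left (hlip x hx y hy) ht.le
      have h3 : ‖y - x‖ = 0 := by nlinarith [norm_nonneg (y - x)]
      rw [norm_eq_zero, sub_eq_zero] at h3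
      exact h3.symm
    have hmaps : ∀ x ∈ ball (0 : E) 1, f x ∈ ball (0 : E) 1 := by
      intro x hx
      rw [mem_ball_zero_iff] at hx ⊢
      have : f x = (1 - t) • x + t • r x := by simp only [hf, hc]; module
      rw [this]
      refine (norm_add_le _ _).trans_lt ?_
      rw [norm_smul, norm_smul, hn, Real.norm_of_nonneg ht.le, Real.norm_of_nonneg (by linarith)]
      nlinarith
    have himg : f '' ball 0 1 = ball 0 1 := by
      apply Subset.antisymm (by rintro _ ⟨x, hx, rfl⟩; exact hmaps x hx)
      apply (convex_ball (0 : E) 1).isPreconnected.subset_of_closure_inter_subset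
      · rw [isOpen_iff_mem_nhds]
        rintro _ ⟨x, hx, rfl⟩
        have hu : IsUnit (1 + t • D x).det := (hpos x (ball_subset_closedBall hx)).ne'.isUnit
        have hr : (1 + t • D x).range = ⊤ := by
          have h := (LinearMap.equivOfDetNeZero _ hu.ne_zero).range
          exact h
        rw [← (hf' x).map_nhds_eq_of_surj hr]
        exact image_mem_map (isOpen_ball.mem_nhds hx)
      · exact ⟨f 0, hmaps 0 (by simp), mem_image_of_mem _ (by simp)⟩
      · rintro y ⟨hy1, hy2⟩
        have hcl : IsClosed (f '' closedBall 0 1) :=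
          ((isCompact_closedBall (0 : E) 1).image
            (continuous_iff_continuousAt.2 fun x => (hf' x).continuousAt)).isClosed
        have := closure_minimal (image_mono ball_subset_closedBall) hcl hy1
        obtain ⟨x, hx, rfl⟩ := this
        rcases (mem_closedBall_zero_iff.1 hx).lt_or_eq with h | h
        · exact mem_image_of_mem _ (mem_ball_zero_iff.2 h)
        · exfalso
          have : f x = x := by simp [hf, hc, hfix x h]
          rw [this, mem_ball_zero_iff] at hy2
          linarith
    have := integral_image_eq_integral_abs_det_fderiv_smul μ
      (measurableSet_ball (x := (0 : E)) (ε := 1))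
      (fun x _ => (hf' x).hasFDerivAt.hasFDerivWithinAt) (hinj.mono ball_subset_closedBall)
      (fun _ => (1 : ℝ))
    rw [himg] at this
    simp only [integral_const, smul_eq_mul, mul_one, measureReal_restrict_apply_univ] at this
    rw [this]
    refine setIntegral_congr_fun measurableSet_ball fun x hx => ?_
    exact (abs_of_pos (hpos x (ball_subset_closedBall hx))).symm
  have hrange : (Ioo 0 η).Infinite := Ioo_infinite hη0
  obtain ⟨s, hsub, hcard⟩ := hrange.exists_subset_card_eq (Module.finrank ℝ E + 1)
  obtain ⟨l, hl⟩ := exists_det_one_add_eq_sum (E := E) s (by omega)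
  have hsum1 : ∑ t ∈ s, l t = 1 := by
    have := hl 0
    simpa [ContinuousLinearMap.det] using this.symm
  have hint : ∀ t : ℝ, IntegrableOn (fun x => (1 + t • D x).det) (ball 0 1) μ := by
    intro t
    refine IntegrableOn.mono_set (Continuous.continuousOn ?_ |>.integrableOn_compact
      (isCompact_closedBall (0 : E) 1)) ball_subset_closedBall
    exact ContinuousLinearMap.continuous_det.comp (continuous_const.add (hDc.const_smul t))
  have htot : ∫ x in ball (0 : E) 1, (1 + D x).det ∂μ = μ.real (ball 0 1) := by
    simp only [fun x => hl (D x)]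
    rw [integral_finsetSum _ fun t _ => (hint t).const_mul _]
    simp_rw [integral_const_mul]
    rw [Finset.sum_congr rfl fun t ht => by rw [hvol t (hsub ht).1 (hsub ht).2],
      ← Finset.sum_mul, hsum1, one_mul]
  have hzero : ∀ x, (1 + D x).det = 0 := by
    intro x
    have h1 : HasFDerivAt r (1 + D x) x := by
      have := (hasFDerivAt_id x).add (hDat x).hasFDerivAt
      refine this.congr_of_eventuallyEq (Eventually.of_forall fun y => ?_)
      simp [hc]
    have h2 : HasFDerivAt (fun y => ‖r y‖ ^ 2) _ x := h1.norm_sq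
    have h3 : (fun y => ‖r y‖ ^ 2) = fun _ => (1 : ℝ) := by ext y; simp [hn]
    rw [h3] at h2
    have h4 := h2.unique (hasFDerivAt_const (1 : ℝ) x)
    by_contra hne
    have hs := (LinearMap.equivOfDetNeZero ((1 + D x : E →L[ℝ] E) : E →ₗ[ℝ] E) hne).surjective
    obtain ⟨v, hv⟩ := hs (r x)
    have h5 := DFunLike.congr_fun h4 v
    have hv' : (1 + D x) v = r x := hv
    rw [smul_apply, ContinuousLinearMap.comp_apply, hv'] at h5
    simp [hn] at h5
  have hb : 0 < μ.real (ball (0 : E) 1) := by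
    rw [measureReal_def]
    exact ENNReal.toReal_pos (measure_ball_pos μ 0 one_pos).ne' measure_ball_lt_top.ne
  simp [hzero] at htot
  linarith

/-- A continuous self-map of a finite-dimensional space which is the identity off a bounded set
has a zero. -/
theorem exists_zero_of_eq_id_off_ball {E : Type*} [NormedAddCommGroup E] [InnerProductSpace ℝ E]
    [FiniteDimensional ℝ E] (g : E → E) (hg : Continuous g) (R : ℝ)
    (hfix : ∀ x, R ≤ ‖x‖ → g x = x) : ∃ x, g x = 0 := by
  by_contra! hne
  set ρ : ℝ := |R| + 1 with hρ
  have hρ0 : 0 < ρ := by positivity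
  have hRρ : R < ρ := lt_of_le_of_lt (le_abs_self R) (by linarith)
  have hS : IsClosed {x : E | ρ ≤ ‖x‖} := isClosed_le continuous_const continuous_norm
  have hU : {x : E | R < ‖x‖} ∈ 𝓝ˢ {x : E | ρ ≤ ‖x‖} :=
    (isOpen_lt continuous_const continuous_norm).mem_nhdsSet.2 fun x hx => lt_of_lt_of_le hRρ hx
  obtain ⟨k, hk, hdist, heq, -⟩ := hg.exists_contDiff_approx_and_eqOn (ε := fun x => ‖g x‖) 1
    hg.norm (fun x => norm_pos_iff.2 (hne x)) hS hU
    (contDiffOn_id.congr fun x hx => hfix x (le_of_lt hx))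
  have hk0 : ∀ x, k x ≠ 0 := by
    intro x h0
    have := hdist x
    rw [h0, dist_zero_left] at this
    exact lt_irrefl _ this
  refine not_exists_retraction (fun x => ‖k (ρ • x)‖⁻¹ • k (ρ • x)) ?_ ?_ ?_
  · have h1 : ContDiff ℝ 1 fun x => k (ρ • x) := hk.comp (contDiff_const_smul ρ)
    exact ((h1.norm ℝ fun x => hk0 _).inv fun x => norm_ne_zero_iff.2 (hk0 _)).smul h1
  · intro x
    rw [norm_smul, norm_inv, norm_norm, inv_mul_cancel₀ (norm_ne_zero_iff.2 (hk0 _))]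
  · intro x hx
    have hn : ‖ρ • x‖ = ρ := by rw [norm_smul, hx, mul_one, Real.norm_of_nonneg hρ0.le]
    have : k (ρ • x) = ρ • x := by
      rw [heq (show ρ ≤ ‖ρ • x‖ from hn.ge), hfix _ (by rw [hn]; exact hRρ.le)]
    simp only [this, hn]
    rw [inv_smul_smul₀ hρ0.ne']

end DegreeLinking

section Minimax

/-- A linking (intersection) statement: a continuous deformation fixing the relative boundary of a
half-ball in `W ⊕ ℝ₊ e` still meets the linking sphere `{P x = 0, N x = α}`. -/
theorem exists_mem_linking {X : Type*} [NormedAddCommGroup X] [InnerProductSpace ℝ X]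
    [FiniteDimensional ℝ X] (W : Submodule ℝ X) (P : X →L[ℝ] W) (hP : ∀ w : W, P w = w)
    (e : X) (hPe : P e = 0)
    (N : X → ℝ) (hN : Continuous N) (hNe : ∀ (w : W) (s : ℝ), 0 ≤ s → N (w + s • e) = s)
    (h : X → X) (hh : Continuous h) (τ α : ℝ) (hα : 0 < α)
    (hW : ∀ w : W, h w = w)
    (hfar : ∀ (w : W) (s : ℝ), 0 ≤ s → τ ^ 2 ≤ ‖w‖ ^ 2 + s ^ 2 → h (w + s • e) = w + s • e) :
    ∃ (w : W) (s : ℝ), 0 ≤ s ∧ P (h (w + s • e)) = 0 ∧ N (h (w + s • e)) = α := by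
  set q : W → ℝ → X := fun w s => h (w + (max s 0) • e) with hq
  set G : WithLp 2 (W × ℝ) → WithLp 2 (W × ℝ) := fun z =>
    WithLp.toLp 2 (P (q z.fst (z.snd + α)), N (q z.fst (z.snd + α)) - max (-(z.snd + α)) 0 - α)
    with hG
  have hqc : Continuous fun z : WithLp 2 (W × ℝ) => q z.fst (z.snd + α) := by
    simp only [hq]; fun_prop
  have hGc : Continuous G := by
    simp only [hG]
    refine (WithLp.prod_continuous_toLp 2 W ℝ).comp (Continuous.prodMk (P.continuous.comp hqc) ?_)
    have := hN.comp hqc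
    simp only [Function.comp_def] at this
    fun_prop
  have hpart : ∀ (w : W) (s : ℝ), q w s = w + (max s 0) • e →
      P (q w s) = w ∧ N (q w s) - max (-s) 0 - α = s - α := by
    intro w s hws
    rw [hws]
    refine ⟨by simp [hP, hPe], ?_⟩
    rw [hNe _ _ (le_max_right _ _)]
    rcases le_total 0 s with h0 | h0
    · rw [max_eq_left h0, max_eq_right (by linarith)]; ring
    · rw [max_eq_right h0, max_eq_left (by linarith)]; ring
  have hneg : ∀ (w : W) (s : ℝ), s ≤ 0 → q w s = w + (max s 0) • e := by
    intro w s hs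
    simp only [hq, max_eq_right hs, zero_smul, add_zero, hW]
  obtain ⟨z, hz⟩ := exists_zero_of_eq_id_off_ball G hGc (|τ| + α) (by
    intro z hz
    have hz2 : ‖z‖ ^ 2 = ‖z.fst‖ ^ 2 + ‖z.snd‖ ^ 2 := WithLp.prod_norm_sq_eq_of_L2 z
    have hq' : q z.fst (z.snd + α) = z.fst + (max (z.snd + α) 0) • e := by
      rcases le_total (z.snd + α) 0 with h0 | h0
      · exact hneg _ _ h0
      · simp only [hq, max_eq_left h0]
        apply hfar _ _ h0
        have h3 : ‖z‖ ≤ √(‖z.fst‖ ^ 2 + (z.snd + α) ^ 2) + α := by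
          have e1 : z = WithLp.toLp 2 (z.fst, z.snd + α) - WithLp.toLp 2 ((0 : W), α) := by
            apply WithLp.ofLp_injective
            apply Prod.ext <;> simp
          have e2 : ‖(WithLp.toLp 2 (z.fst, z.snd + α) : WithLp 2 (W × ℝ))‖
              = √(‖z.fst‖ ^ 2 + (z.snd + α) ^ 2) := by
            rw [WithLp.prod_norm_eq_of_L2]; simp
          have e3 : ‖(WithLp.toLp 2 ((0 : W), α) : WithLp 2 (W × ℝ))‖ = α := by
            rw [WithLp.prod_norm_eq_of_L2]
            simp [Real.sqrt_sq_eq_abs, abs_of_pos hα]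
          calc ‖z‖ = ‖(WithLp.toLp 2 (z.fst, z.snd + α) : WithLp 2 (W × ℝ))
                - WithLp.toLp 2 ((0 : W), α)‖ := by rw [← e1]
            _ ≤ _ := (norm_sub_le _ _).trans (by rw [e2, e3])
        have h4 : |τ| ≤ √(‖z.fst‖ ^ 2 + (z.snd + α) ^ 2) := by linarith
        rw [← sq_abs τ]
        calc |τ| ^ 2 ≤ (√(‖z.fst‖ ^ 2 + (z.snd + α) ^ 2)) ^ 2 := by gcongr
          _ = _ := Real.sq_sqrt (by positivity)
    obtain ⟨h1, h2⟩ := hpart _ _ hq'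
    have : G z = WithLp.toLp 2 (z.fst, z.snd) := by
      simp only [hG, h1, h2]; simp
    rw [this]; rfl)
  have h1 : P (q z.fst (z.snd + α)) = 0 := congrArg (fun y => WithLp.fst y) hz
  have h2 : N (q z.fst (z.snd + α)) - max (-(z.snd + α)) 0 - α = 0 :=
    congrArg (fun y => WithLp.snd y) hz
  rcases le_or_gt 0 (z.snd + α) with h0 | h0
  · refine ⟨z.fst, z.snd + α, h0, ?_, ?_⟩
    · simpa only [hq, max_eq_left h0] using h1
    · rw [max_eq_right (by linarith : -(z.snd + α) ≤ 0)] at h2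
      simp only [hq, max_eq_left h0] at h2
      linarith
  · exfalso
    have := (hpart _ _ (hneg z.fst _ h0.le)).2
    rw [h2] at this
    linarith

/-- A finite-dimensional linking minimax principle, producing almost critical points. -/
theorem exists_almost_critical {X : Type*} [NormedAddCommGroup X] [InnerProductSpace ℝ X]
    [FiniteDimensional ℝ X] (W : Submodule ℝ X) (P : X →L[ℝ] W) (hP : ∀ w : W, P w = w)
    (e : X) (hPe : P e = 0)
    (N : X → ℝ) (hN : Continuous N) (hNe : ∀ (w : W) (s : ℝ), 0 ≤ s → N (w + s • e) = s)
    (f : X → ℝ) (g : X → X) (hf : Continuous f) (hg : Continuous g)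
    (hfg : ∀ ε > 0, ∃ σ > 0, ∀ x y, ‖y - x‖ ≤ σ → f y - f x - ⟪g x, y - x⟫ ≤ ε * ‖y - x‖)
    (τ α β C : ℝ) (hα : 0 < α) (hβ : 0 < β)
    (hW : ∀ w : W, f w ≤ 0)
    (hfar : ∀ (w : W) (s : ℝ), 0 ≤ s → τ ^ 2 ≤ ‖w‖ ^ 2 + s ^ 2 → f (w + s • e) ≤ 0)
    (hC : ∀ (w : W) (s : ℝ), 0 ≤ s → f (w + s • e) ≤ C)
    (hlink : ∀ x, P x = 0 → N x = α → β ≤ f x) (δ : ℝ) (hδ : 0 < δ) :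
    ∃ x, ‖g x‖ ≤ δ ∧ β / 2 ≤ f x := by
  by_contra! hno
  obtain ⟨σ, hσ, hdiff⟩ := hfg (δ / 4) (by positivity)
  set χ : ℝ → ℝ := fun v => max 0 (min 1 (2 * v / β)) with hχ
  set m : ℝ → ℝ := fun r => max 0 (min 1 (2 * r / δ - 1)) with hm
  have hχ0 : ∀ v, 0 ≤ χ v := fun v => le_max_left _ _
  have hm0 : ∀ v, 0 ≤ m v := fun v => le_max_left _ _
  have hχ1 : ∀ v, χ v ≤ 1 := fun v => max_le zero_le_one (min_le_left _ _)
  have hm1 : ∀ v, m v ≤ 1 := fun v => max_le zero_le_one (min_le_left _ _)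
  set V : X → X := fun x => (σ * χ (f x) * (m ‖g x‖ / max ‖g x‖ (δ / 4))) • g x with hV
  set T : X → X := fun x => x - V x with hT
  have hVc : Continuous V := by
    simp only [hV, hχ, hm]
    refine Continuous.smul (Continuous.mul (by fun_prop) (Continuous.div₀ (by fun_prop)
      (by fun_prop) fun x => ?_)) hg
    exact (lt_of_lt_of_le (by positivity) (le_max_right _ _)).ne'
  have hTc : Continuous T := continuous_id.sub hVc
  have hdecr : ∀ x, f (T x) ≤ f x - σ * χ (f x) * m ‖g x‖ * (δ / 4) := by
    intro x
    by_cases h0 : ‖g x‖ ≤ δ / 2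
    · have : m ‖g x‖ = 0 := by
        apply max_eq_left
        apply (min_le_right _ _).trans
        have : 2 * ‖g x‖ / δ ≤ 1 := by rw [div_le_one hδ]; linarith
        linarith
      simp [hT, hV, this]
    · push Not at h0
      have hmax : max ‖g x‖ (δ / 4) = ‖g x‖ := max_eq_left (by linarith)
      have hgpos : 0 < ‖g x‖ := by linarith
      set k := σ * χ (f x) * m ‖g x‖ with hk
      have hk0 : 0 ≤ k := by have := hχ0 (f x); have := hm0 ‖g x‖; positivity
      have hVx : V x = (k / ‖g x‖) • g x := by
        simp only [hV, hmax, hk]; congr 1; ring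
      have hVn : ‖V x‖ = k := by
        rw [hVx, norm_smul, norm_div, norm_norm, Real.norm_of_nonneg hk0]
        field_simp
      have hkσ : k ≤ σ := by
        have : χ (f x) * m ‖g x‖ ≤ 1 := mul_le_one₀ (hχ1 _) (hm0 _) (hm1 _)
        rw [hk, mul_assoc]; nlinarith
      have hsub : T x - x = - V x := by simp [hT]
      have h1 := hdiff x (T x) (by rw [hsub, norm_neg, hVn]; exact hkσ)
      rw [hsub, norm_neg, hVn, inner_neg_right, hVx, real_inner_smul_right,
        real_inner_self_eq_norm_sq] at h1
      have h2 : k / ‖g x‖ * ‖g x‖ ^ 2 = k * ‖g x‖ := by field_simp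
      rw [h2] at h1
      nlinarith
  have hle : ∀ x, f (T x) ≤ f x := fun x => (hdecr x).trans (by
    have := hχ0 (f x); have := hm0 ‖g x‖
    have : 0 ≤ σ * χ (f x) * m ‖g x‖ * (δ / 4) := by positivity
    linarith)
  have hstep : ∀ x, β / 2 ≤ f x → f (T x) ≤ f x - σ * (δ / 4) := by
    intro x hx
    have h1 : χ (f x) = 1 := by
      have : 1 ≤ 2 * f x / β := by rw [le_div_iff₀ hβ]; linarith
      simp only [hχ, min_eq_left this]; exact max_eq_right zero_le_one
    have h2 : m ‖g x‖ = 1 := by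
      have hg' : δ < ‖g x‖ := by
        by_contra! hcon
        exact absurd (hno x hcon) (not_lt.2 hx)
      have : 2 ≤ 2 * ‖g x‖ / δ := by rw [le_div_iff₀ hδ]; linarith
      have : 1 ≤ 2 * ‖g x‖ / δ - 1 := by linarith
      simp only [hm, min_eq_left this]; exact max_eq_right zero_le_one
    have := hdecr x
    rw [h1, h2] at this
    linarith
  have hTid : ∀ x, f x ≤ 0 → T x = x := by
    intro x hx
    have : χ (f x) = 0 := by
      apply max_eq_left
      apply (min_le_right _ _).trans
      apply div_nonpos_of_nonpos_of_nonneg _ hβ.le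
      linarith
    simp [hT, hV, this]
  have hiter : ∀ n x, f (T^[n] x) ≤ max (f x - n * (σ * (δ / 4))) (β / 2) := by
    intro n x
    induction n with
    | zero => simp
    | succ n ih =>
      rw [Function.iterate_succ_apply']
      rcases le_or_gt (β / 2) (f (T^[n] x)) with hc | hc
      · have h1 := hstep _ hc
        rcases le_max_iff.1 ih with h2 | h2
        · apply le_max_of_le_left
          push_cast
          linarith
        · apply le_max_of_le_right
          have : 0 ≤ σ * (δ / 4) := by positivity
          linarith
      · exact le_max_of_le_right ((hle _).trans hc.le)
  obtain ⟨n, hn⟩ := exists_nat_gt (C / (σ * (δ / 4)))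
  have hn' : C - n * (σ * (δ / 4)) < 0 := by
    rw [div_lt_iff₀ (by positivity)] at hn; linarith
  obtain ⟨w, s, hs, h1, h2⟩ := exists_mem_linking W P hP e hPe N hN hNe (T^[n]) (hTc.iterate n) τ α
    hα (fun w => Function.iterate_fixed (hTid _ (hW w)) n)
    (fun w s hs hws => Function.iterate_fixed (hTid _ (hfar w s hs hws)) n)
  have h3 := hlink _ h1 h2
  have h4 := hiter n (w + s • e)
  have h5 := hC w s hs
  rcases le_max_iff.1 h4 with h6 | h6 <;> linarith

end Minimax

section TrigonometricPolynomials

/-- The character `t ↦ exp (2 π i k t)` of the circle `ℝ/ℤ`. -/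
def ez (k : ℤ) (t : ℝ) : ℂ := Complex.exp (2 * Real.pi * Complex.I * k * t)

theorem norm_ez (k : ℤ) (t : ℝ) : ‖ez k t‖ = 1 := by
  rw [ez, show (2 * Real.pi * Complex.I * k * t : ℂ) = ((2 * Real.pi * k * t : ℝ) : ℂ)
      * Complex.I by
    push_cast; ring]
  exact Complex.norm_exp_ofReal_mul_I _

theorem continuous_ez (k : ℤ) : Continuous (ez k) := by unfold ez; fun_prop

theorem ez_add (j k : ℤ) (t : ℝ) : ez (j + k) t = ez j t * ez k t := by
  simp only [ez, ← Complex.exp_add]; push_cast; ring_nf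

theorem ez_zero (t : ℝ) : ez 0 t = 1 := by simp [ez]

theorem conj_ez (k : ℤ) (t : ℝ) : (starRingEnd ℂ) (ez k t) = ez (-k) t := by
  rw [ez, ← Complex.exp_conj, ez]; congr 1; simp [Complex.conj_ofNat]

theorem ez_int (k l : ℤ) : ez k l = 1 := by
  rw [ez, Complex.exp_eq_one_iff]; exact ⟨k * l, by push_cast; ring⟩

theorem hasDerivAt_ez (k : ℤ) (t : ℝ) :
    HasDerivAt (ez k) (2 * Real.pi * Complex.I * k * ez k t) t := by
  have h := ((Complex.ofRealCLM.hasDerivAt (x := t)).const_mul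
    (2 * Real.pi * Complex.I * k : ℂ)).cexp
  refine (h.congr_deriv ?_ : HasDerivAt (ez k) _ t)
  rw [ez, Complex.ofRealCLM_apply, Complex.ofRealCLM_apply, Complex.ofReal_one]; ring

theorem integral_ez (k : ℤ) : ∫ t in (0:ℝ)..1, ez k t = if k = 0 then 1 else 0 := by
  split_ifs with h
  · subst h; simp [ez_zero]
  · have hk : (2 * Real.pi * Complex.I * k : ℂ) ≠ 0 := by
      simp [Real.pi_ne_zero, h]
    have h2 := intervalIntegral.integral_eq_sub_of_hasDerivAt (a := 0) (b := 1)
      (fun t _ => hasDerivAt_ez k t)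
      ((continuous_const.mul (continuous_ez k)).intervalIntegrable _ _)
    rw [intervalIntegral.integral_const_mul] at h2
    have h3 : ez k 1 = 1 := by exact_mod_cast ez_int k 1
    have h4 : ez k 0 = 1 := by exact_mod_cast ez_int k 0
    rw [h3, h4, sub_self] at h2
    exact (mul_eq_zero.1 h2).resolve_left hk

/-- The real inner product space underlying a complex one. -/
instance (priority := 100) realInnerProductSpaceOfComplex (G : Type*) [NormedAddCommGroup G]
    [InnerProductSpace ℂ G] : InnerProductSpace ℝ G := InnerProductSpace.complexToReal

variable {G : Type*} [NormedAddCommGroup G] [InnerProductSpace ℂ G]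

/-- The trigonometric polynomial with frequencies `m i` and coefficients `c i`. -/
def trig {ι : Type*} [Fintype ι] (m : ι → ℤ) (c : ι → G) (t : ℝ) : G := ∑ i, ez (m i) t • c i

theorem continuous_trig {ι : Type*} [Fintype ι] (m : ι → ℤ) (c : ι → G) :
    Continuous (trig m c) := by
  unfold trig
  exact continuous_finsetSum _ fun i _ => (continuous_ez _).smul continuous_const

theorem trig_sub {ι : Type*} [Fintype ι] (m : ι → ℤ) (c d : ι → G) (t : ℝ) :
    trig m (fun i => c i - d i) t = trig m c t - trig m d t := by
  simp [trig, smul_sub]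

theorem norm_trig_le {ι : Type*} [Fintype ι] (m : ι → ℤ) (c : ι → G) (t : ℝ) :
    ‖trig m c t‖ ≤ ∑ i, ‖c i‖ := by
  refine (norm_sum_le _ _).trans (Finset.sum_le_sum fun i _ => ?_)
  rw [norm_smul, norm_ez, one_mul]

theorem map_trig {ι : Type*} [Fintype ι] (m : ι → ℤ) (c : ι → G) (Q : G →ₗ[ℂ] G) (t : ℝ) :
    Q (trig m c t) = trig m (fun i => Q (c i)) t := by
  simp [trig, map_sum]

/-- Fourier coefficients on `[0,1]`. -/
def fcoeff (u : ℝ → G) (k : ℤ) : G := ∫ t in (0:ℝ)..1, ez (-k) t • u t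

theorem integral_inner_trig {ι : Type*} [Fintype ι] [CompleteSpace G] (m : ι → ℤ) (u : ℝ → G)
    (hu : Continuous u) (d : ι → G) :
    ∫ t in (0:ℝ)..1, inner ℂ (u t) (trig m d t) = ∑ i, inner ℂ (fcoeff u (m i)) (d i) := by
  simp only [trig, inner_sum]
  rw [intervalIntegral.integral_finsetSum]
  · refine Finset.sum_congr rfl fun i _ => ?_
    have h : ∀ t, inner ℂ (u t) (ez (m i) t • d i)
        = (starRingEnd ℂ) (inner ℂ (d i) (ez (-m i) t • u t)) := by
      intro t
      rw [inner_conj_symm, inner_smul_left, inner_smul_right, conj_ez, neg_neg]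
    simp only [h]
    rw [fcoeff, ← inner_conj_symm]
    have h2 : ∫ t in (0:ℝ)..1, inner ℂ (d i) (ez (-m i) t • u t)
        = inner ℂ (d i) (∫ t in (0:ℝ)..1, ez (-m i) t • u t) :=
      ((innerSL ℂ (d i)).intervalIntegral_comp_comm
        ((((continuous_ez _).smul hu).intervalIntegrable _ _)))
    rw [← h2]
    simp only [intervalIntegral.integral_of_le zero_le_one]
    exact integral_conj
  · intro i _
    exact (Continuous.inner hu ((continuous_ez _).smul continuous_const)).intervalIntegrable _ _

theorem fcoeff_trig {ι : Type*} [Fintype ι] (m : ι → ℤ) (hm : Function.Injective m)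
    [CompleteSpace G] (c : ι → G) (i : ι) : fcoeff (trig m c) (m i) = c i := by
  classical
  simp only [fcoeff, trig, Finset.smul_sum, smul_smul, ← ez_add]
  rw [intervalIntegral.integral_finsetSum]
  · simp only [intervalIntegral.integral_smul_const, integral_ez]
    rw [Finset.sum_eq_single i]
    · simp
    · intro j _ hj
      have : -m i + m j ≠ 0 := fun h => hj (hm (by omega))
      simp [this]
    · simp
  · intro j _
    exact ((continuous_ez _).smul continuous_const).intervalIntegrable _ _

theorem integral_re_eq {u : ℝ → ℂ} (hu : Continuous u) :
    ∫ t in (0:ℝ)..1, (u t).re = (∫ t in (0:ℝ)..1, u t).re :=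
  Complex.reCLM.intervalIntegral_comp_comm (hu.intervalIntegrable _ _)

theorem real_inner_eq_re (x y : G) : ⟪x, y⟫ = (inner ℂ x y).re := rfl

theorem integral_real_inner_trig {ι : Type*} [Fintype ι] [CompleteSpace G] (m : ι → ℤ) (u : ℝ → G)
    (hu : Continuous u) (d : ι → G) :
    ∫ t in (0:ℝ)..1, ⟪u t, trig m d t⟫ = ∑ i, ⟪fcoeff u (m i), d i⟫ := by
  simp only [real_inner_eq_re]
  rw [integral_re_eq (hu.inner (continuous_trig m d)), integral_inner_trig m u hu, Complex.re_sum]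

theorem integral_norm_sq_trig {ι : Type*} [Fintype ι] [CompleteSpace G] (m : ι → ℤ)
    (hm : Function.Injective m) (c : ι → G) :
    ∫ t in (0:ℝ)..1, ‖trig m c t‖ ^ 2 = ∑ i, ‖c i‖ ^ 2 := by
  simp only [← real_inner_self_eq_norm_sq]
  rw [integral_real_inner_trig m _ (continuous_trig m c)]
  simp only [fcoeff_trig m hm]

/-- Bessel's inequality. -/
theorem sum_norm_sq_fcoeff_le {ι : Type*} [Fintype ι] [CompleteSpace G] (m : ι → ℤ)
    (hm : Function.Injective m) (u : ℝ → G) (hu : Continuous u) :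
    ∑ i, ‖fcoeff u (m i)‖ ^ 2 ≤ ∫ t in (0:ℝ)..1, ‖u t‖ ^ 2 := by
  have h1 := integral_real_inner_trig m u hu (fun i => fcoeff u (m i))
  simp only [real_inner_self_eq_norm_sq] at h1
  have h2 := integral_norm_sq_trig m hm (fun i => fcoeff u (m i))
  have ht := continuous_trig m (fun i => fcoeff u (m i))
  have h3 : ∫ t in (0:ℝ)..1, ⟪u t, trig m (fun i => fcoeff u (m i)) t⟫ ≤
      ∫ t in (0:ℝ)..1, (1/2 * ‖u t‖ ^ 2 + 1/2 * ‖trig m (fun i => fcoeff u (m i)) t‖ ^ 2) := by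
    apply intervalIntegral.integral_mono_on zero_le_one
    · exact (hu.inner ht).intervalIntegrable _ _
    · exact Continuous.intervalIntegrable (by fun_prop) _ _
    · intro t _
      have := real_inner_le_norm (u t) (trig m (fun i => fcoeff u (m i)) t)
      nlinarith [sq_nonneg (‖u t‖ - ‖trig m (fun i => fcoeff u (m i)) t‖)]
  rw [intervalIntegral.integral_add (Continuous.intervalIntegrable (by fun_prop) _ _)
    (Continuous.intervalIntegrable (by fun_prop) _ _), intervalIntegral.integral_const_mul,
    intervalIntegral.integral_const_mul, h1, h2] at h3
  linarith

theorem card_add_eq_le {ι : Type*} [Fintype ι] [DecidableEq ι] (m : ι → ℤ)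
    (hm : Function.Injective m)
    (hpos : ∀ i, 1 ≤ m i) (s : ℤ) (hs : 1 ≤ s) :
    ((Finset.univ.filter fun p : ι × ι => m p.1 + m p.2 = s).card : ℝ) ≤ s - 1 := by
  have h1 : (Finset.univ.filter fun p : ι × ι => m p.1 + m p.2 = s).card
      ≤ (Finset.Icc (1:ℤ) (s - 1)).card := by
    apply Finset.card_le_card_of_injOn (fun p => m p.1)
    · intro p hp
      simp only [Finset.coe_filter, Finset.mem_univ, true_and, mem_ofPred_eq] at hp
      simp only [Finset.coe_Icc, Set.mem_Icc]
      have := hpos p.1; have := hpos p.2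
      omega
    · intro p hp q hq h
      simp only [Finset.coe_filter, Finset.mem_univ, true_and, mem_ofPred_eq] at hp hq h
      have h2 : m p.2 = m q.2 := by omega
      exact Prod.ext (hm h) (hm h2)
  rw [Int.card_Icc] at h1
  have h3 : (((s - 1 + 1 - 1).toNat : ℤ) : ℝ) = s - 1 := by
    rw [Int.toNat_of_nonneg (by omega)]; push_cast; ring
  calc _ ≤ ((s - 1 + 1 - 1).toNat : ℝ) := by exact_mod_cast h1
    _ = _ := by exact_mod_cast h3

/-- An elementary case of the embedding `H^{1/2} ⊂ L⁴`, for one-sided trigonometric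
polynomials. -/
theorem integral_norm_pow_four_trig_le {ι : Type*} [Fintype ι] [CompleteSpace G] (m : ι → ℤ)
    (hm : Function.Injective m) (hpos : ∀ i, 1 ≤ m i) (c : ι → G) :
    ∫ t in (0:ℝ)..1, ‖trig m c t‖ ^ 4 ≤ (∑ i, m i * ‖c i‖ ^ 2) ^ 2 := by
  classical
  set a : ι → ℝ := fun i => ‖c i‖ with ha
  have h1 : ∀ t, ((‖trig m c t‖ ^ 4 : ℝ) : ℂ) = ∑ p : ι × ι, ∑ r : ι × ι,
      ez ((m r.1 + m r.2) - (m p.1 + m p.2)) t •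
        (inner ℂ (c p.1) (c r.1) * inner ℂ (c p.2) (c r.2)) := by
    intro t
    have h2 : ((‖trig m c t‖ ^ 2 : ℝ) : ℂ) = ∑ i, ∑ j, ez (m j - m i) t • inner ℂ (c i) (c j) := by
      push_cast
      have := inner_self_eq_norm_sq_to_K (𝕜 := ℂ) (trig m c t)
      rw [show ((‖trig m c t‖ : ℂ) ^ 2) = inner ℂ (trig m c t) (trig m c t) from this.symm]
      simp only [trig, sum_inner, inner_sum, inner_smul_left, inner_smul_right,
        conj_ez, smul_eq_mul,
        Finset.mul_sum]
      rw [Finset.sum_comm]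
      refine Finset.sum_congr rfl fun i _ => Finset.sum_congr rfl fun j _ => ?_
      rw [sub_eq_add_neg, ez_add]; ring
    rw [show (‖trig m c t‖ ^ 4 : ℝ) = (‖trig m c t‖ ^ 2) * (‖trig m c t‖ ^ 2) by ring,
      Complex.ofReal_mul, h2]
    rw [Finset.sum_mul_sum, Fintype.sum_prod_type]
    refine Finset.sum_congr rfl fun i _ => Finset.sum_congr rfl fun k _ => ?_
    rw [Finset.sum_mul_sum, Fintype.sum_prod_type]
    refine Finset.sum_congr rfl fun j _ => Finset.sum_congr rfl fun l _ => ?_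
    simp only [smul_eq_mul]
    rw [show m j + m l - (m i + m k) = (m j - m i) + (m l - m k) by ring, ez_add]; ring
  have h2 : ((∫ t in (0:ℝ)..1, ‖trig m c t‖ ^ 4 : ℝ) : ℂ) = ∑ p : ι × ι, ∑ r : ι × ι,
      if m r.1 + m r.2 = m p.1 + m p.2 then
        (inner ℂ (c p.1) (c r.1) * inner ℂ (c p.2) (c r.2) : ℂ) else 0 := by
    rw [← intervalIntegral.integral_ofReal]
    simp only [h1]
    rw [intervalIntegral.integral_finsetSum]
    · refine Finset.sum_congr rfl fun p _ => ?_
      rw [intervalIntegral.integral_finsetSum]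
      · refine Finset.sum_congr rfl fun r _ => ?_
        rw [intervalIntegral.integral_smul_const, integral_ez]
        simp only [sub_eq_zero]
        split_ifs <;> simp
      · intro r _
        exact ((continuous_ez _).smul continuous_const).intervalIntegrable _ _
    · intro p _
      exact (continuous_finsetSum _ fun r _ =>
        (continuous_ez _).smul continuous_const).intervalIntegrable _ _
  have h3 : ∫ t in (0:ℝ)..1, ‖trig m c t‖ ^ 4 ≤ ∑ p : ι × ι, ∑ r : ι × ι,
      if m r.1 + m r.2 = m p.1 + m p.2 then
        ((a p.1 * a p.2) ^ 2 / 2 + (a r.1 * a r.2) ^ 2 / 2) else 0 := by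
    have h4 : 0 ≤ ∫ t in (0:ℝ)..1, ‖trig m c t‖ ^ 4 :=
      intervalIntegral.integral_nonneg zero_le_one fun t _ => by positivity
    have h5 : ∫ t in (0:ℝ)..1, ‖trig m c t‖ ^ 4
        = ‖((∫ t in (0:ℝ)..1, ‖trig m c t‖ ^ 4 : ℝ) : ℂ)‖ := by
      rw [Complex.norm_real, Real.norm_of_nonneg h4]
    rw [h5, h2]
    refine (norm_sum_le _ _).trans (Finset.sum_le_sum fun p _ =>
      (norm_sum_le _ _).trans (Finset.sum_le_sum fun r _ => ?_))
    split_ifs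
    · rw [norm_mul]
      have e1 := norm_inner_le_norm (𝕜 := ℂ) (c p.1) (c r.1)
      have e2 := norm_inner_le_norm (𝕜 := ℂ) (c p.2) (c r.2)
      calc _ ≤ (a p.1 * a r.1) * (a p.2 * a r.2) := by
            apply mul_le_mul e1 e2 (norm_nonneg _); positivity
        _ ≤ _ := by nlinarith [sq_nonneg (a p.1 * a p.2 - a r.1 * a r.2)]
    · simp
  have h6 : (∑ p : ι × ι, ∑ r : ι × ι,
      if m r.1 + m r.2 = m p.1 + m p.2 then
        ((a p.1 * a p.2) ^ 2 / 2 + (a r.1 * a r.2) ^ 2 / 2) else 0)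
      = ∑ p : ι × ι, ∑ r : ι × ι,
      if m r.1 + m r.2 = m p.1 + m p.2 then (a p.1 * a p.2) ^ 2 else 0 := by
    have e1 : (∑ p : ι × ι, ∑ r : ι × ι,
      if m r.1 + m r.2 = m p.1 + m p.2 then (a r.1 * a r.2) ^ 2 / 2 else 0)
      = ∑ p : ι × ι, ∑ r : ι × ι,
      if m r.1 + m r.2 = m p.1 + m p.2 then (a p.1 * a p.2) ^ 2 / 2 else 0 := by
      rw [Finset.sum_comm]
      simp only [eq_comm]
    have e2 : (∑ p : ι × ι, ∑ r : ι × ι,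
      if m r.1 + m r.2 = m p.1 + m p.2 then
        ((a p.1 * a p.2) ^ 2 / 2 + (a r.1 * a r.2) ^ 2 / 2) else 0)
      = (∑ p : ι × ι, ∑ r : ι × ι,
      if m r.1 + m r.2 = m p.1 + m p.2 then (a p.1 * a p.2) ^ 2 / 2 else 0)
      + (∑ p : ι × ι, ∑ r : ι × ι,
      if m r.1 + m r.2 = m p.1 + m p.2 then (a r.1 * a r.2) ^ 2 / 2 else 0) := by
      simp only [← Finset.sum_add_distrib]
      refine Finset.sum_congr rfl fun p _ => Finset.sum_congr rfl fun r _ => ?_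
      split_ifs <;> simp
    rw [e2, e1]
    simp only [← Finset.sum_add_distrib]
    refine Finset.sum_congr rfl fun p _ => Finset.sum_congr rfl fun r _ => ?_
    split_ifs <;> simp
  rw [h6] at h3
  refine h3.trans ?_
  rw [sq, Finset.sum_mul_sum, Fintype.sum_prod_type]
  refine Finset.sum_le_sum fun i _ => Finset.sum_le_sum fun j _ => ?_
  rw [← Finset.sum_filter, Finset.sum_const, nsmul_eq_mul]
  have h7 := card_add_eq_le m hm hpos (m i + m j) (by have := hpos i; have := hpos j; omega)
  have hi : (1:ℝ) ≤ m i := by exact_mod_cast hpos i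
  have hj : (1:ℝ) ≤ m j := by exact_mod_cast hpos j
  push_cast at h7
  calc _ ≤ ((m i + m j - 1 : ℝ)) * (a i * a j) ^ 2 := by gcongr
    _ ≤ (m i * m j : ℝ) * (a i * a j) ^ 2 := by
      gcongr; nlinarith
    _ = _ := by ring

end TrigonometricPolynomials

section QuadraticForm

variable {G : Type*} [NormedAddCommGroup G] [InnerProductSpace ℂ G]

/-- The complex linear operator equal to `1` on `ℂ e` and to `ν` on its orthogonal complement. -/
def diagOp (e : G) (ν : ℝ) : G →L[ℂ] G :=
  (ν : ℂ) • ContinuousLinearMap.id ℂ G + ((1 - ν : ℝ) : ℂ) • (innerSL ℂ e).smulRight e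

/-- The quadratic form of `diagOp e ν`. -/
def diagForm (e : G) (ν : ℝ) (z : G) : ℝ := ν * ‖z‖ ^ 2 + (1 - ν) * ‖inner ℂ e z‖ ^ 2

theorem diagOp_apply (e : G) (ν : ℝ) (z : G) :
    diagOp e ν z = ν • z + (1 - ν) • (inner ℂ e z • e) := by
  simp [diagOp, ← Complex.coe_smul]

theorem real_inner_smul_inner (e z w : G) :
    ⟪inner ℂ e z • e, w⟫ = (inner ℂ e z).re * (inner ℂ e w).re
      + (inner ℂ e z).im * (inner ℂ e w).im := by
  rw [real_inner_eq_re, inner_smul_left, Complex.mul_re, Complex.conj_re, Complex.conj_im]; ring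

theorem diagForm_eq (e : G) (ν : ℝ) (z : G) : diagForm e ν z = ⟪diagOp e ν z, z⟫ := by
  rw [diagOp_apply, inner_add_left, real_inner_smul_left, real_inner_smul_left,
    real_inner_smul_inner, real_inner_self_eq_norm_sq, diagForm, Complex.sq_norm,
    Complex.normSq_apply]

theorem real_inner_diagOp_comm (e : G) (ν : ℝ) (z w : G) :
    ⟪diagOp e ν z, w⟫ = ⟪diagOp e ν w, z⟫ := by
  simp only [diagOp_apply, inner_add_left, real_inner_smul_left,
    real_inner_smul_inner]
  rw [real_inner_comm]; ring

theorem diagForm_sub (e : G) (ν : ℝ) (x y : G) :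
    diagForm e ν y - diagForm e ν x - 2 * ⟪diagOp e ν x, y - x⟫ = diagForm e ν (y - x) := by
  simp only [diagForm_eq, map_sub, inner_sub_left, inner_sub_right]
  rw [real_inner_diagOp_comm e ν x y]; ring

theorem le_diagForm {e : G} {ν : ℝ} (hν : ν ≤ 1) (z : G) : ν * ‖z‖ ^ 2 ≤ diagForm e ν z := by
  have : 0 ≤ (1 - ν) * ‖inner ℂ e z‖ ^ 2 := mul_nonneg (by linarith) (by positivity)
  rw [diagForm]; linarith

theorem diagForm_le {e : G} (he : ‖e‖ = 1) {ν : ℝ} (hν : ν ≤ 1) (z : G) :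
    diagForm e ν z ≤ ‖z‖ ^ 2 := by
  have h1 : ‖inner ℂ e z‖ ≤ ‖z‖ := by simpa [he] using norm_inner_le_norm (𝕜 := ℂ) e z
  have : (1 - ν) * ‖inner ℂ e z‖ ^ 2 ≤ (1 - ν) * ‖z‖ ^ 2 := by gcongr
  rw [diagForm]; linarith

theorem continuous_diagForm (e : G) (ν : ℝ) : Continuous (diagForm e ν) := by
  unfold diagForm; fun_prop

theorem diagForm_smul_self {e : G} (he : ‖e‖ = 1) (ν s : ℝ) : diagForm e ν (s • e) = s ^ 2 := by
  have : inner ℂ e (s • e) = (s : ℂ) := by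
    rw [← Complex.coe_smul, inner_smul_right, inner_self_eq_norm_sq_to_K, he]; simp
  rw [diagForm, this, norm_smul, he]; simp; ring

theorem norm_sq_smul_sub_diagOp {e : G} (he : ‖e‖ = 1) (ν α β : ℝ) (z : G) :
    ‖α • z - β • diagOp e ν z‖ ^ 2 = (α - β * ν) ^ 2 * (‖z‖ ^ 2 - ‖inner ℂ e z‖ ^ 2)
      + (α - β) ^ 2 * ‖inner ℂ e z‖ ^ 2 := by
  have h1 : α • z - β • diagOp e ν z = (α - β * ν) • z - (β * (1 - ν)) • (inner ℂ e z • e) := by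
    rw [diagOp_apply]; module
  have h2 : ⟪inner ℂ e z • e, z⟫ = ‖inner ℂ e z‖ ^ 2 := by
    rw [real_inner_smul_inner, Complex.sq_norm, Complex.normSq_apply]
  have h3 : ‖inner ℂ e z • e‖ = ‖inner ℂ e z‖ := by rw [norm_smul, he, mul_one]
  rw [h1, norm_sub_sq_real, norm_smul, norm_smul, real_inner_smul_left, real_inner_smul_right,
    real_inner_comm, h2, h3, mul_pow, mul_pow, Real.norm_eq_abs, Real.norm_eq_abs, sq_abs, sq_abs]
  ring

theorem le_norm_smul_sub_diagOp {e : G} (he : ‖e‖ = 1) {ν α β c : ℝ} (hc : 0 ≤ c)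
    (h1 : c ≤ |α - β * ν|) (h2 : c ≤ |α - β|) (z : G) :
    c * ‖z‖ ≤ ‖α • z - β • diagOp e ν z‖ := by
  apply abs_le_of_sq_le_sq' _ (norm_nonneg _) |>.2
  have h3 : ‖inner ℂ e z‖ ≤ ‖z‖ := by simpa [he] using norm_inner_le_norm (𝕜 := ℂ) e z
  have h4 : ‖inner ℂ e z‖ ^ 2 ≤ ‖z‖ ^ 2 := by gcongr
  rw [norm_sq_smul_sub_diagOp he, ← sq_abs (α - β * ν), ← sq_abs (α - β)]
  calc (c * ‖z‖) ^ 2 = c ^ 2 * (‖z‖ ^ 2 - ‖inner ℂ e z‖ ^ 2) + c ^ 2 * ‖inner ℂ e z‖ ^ 2 := by ring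
    _ ≤ _ := by
      have := sub_nonneg.2 h4
      gcongr

end QuadraticForm

section Galerkin

variable {G : Type*} [NormedAddCommGroup G] [InnerProductSpace ℂ G]

/-- The action functional of the Hamiltonian `κ q + b + h` on trigonometric polynomials. -/
def galAction (e : G) (ν κ b : ℝ) (h : G → ℝ) {S : Finset ℤ} (x : S → G) : ℝ :=
  ∑ k : S, (Real.pi * (k : ℤ) * ‖x k‖ ^ 2 - κ * diagForm e ν (x k)) - b
    - ∫ t in (0:ℝ)..1, h (trig (Subtype.val : S → ℤ) x t)

/-- The gradient of `galAction`. -/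
def galGrad (e : G) (ν κ : ℝ) (gh : G → G) {S : Finset ℤ} (x : S → G) (k : S) : G :=
  (2 * Real.pi * (k : ℤ)) • x k - (2 * κ) • diagOp e ν (x k)
    - fcoeff (fun t => gh (trig (Subtype.val : S → ℤ) x t)) k

theorem integral_diagForm_trig [CompleteSpace G] (e : G) (ν : ℝ) {S : Finset ℤ} (x : S → G) :
    ∫ t in (0:ℝ)..1, diagForm e ν (trig (Subtype.val : S → ℤ) x t)
      = ∑ k, diagForm e ν (x k) := by
  simp only [diagForm_eq]
  have h1 : ∀ t, diagOp e ν (trig (Subtype.val : S → ℤ) x t)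
      = trig (Subtype.val : S → ℤ) (fun k => diagOp e ν (x k)) t :=
    fun t => map_trig _ x (diagOp e ν : G →ₗ[ℂ] G) t
  simp only [h1]
  rw [integral_real_inner_trig _ _ (continuous_trig _ _)]
  simp only [fcoeff_trig _ Subtype.val_injective]

theorem galAction_eq [CompleteSpace G] (e : G) (ν κ b : ℝ) (h : G → ℝ) (hh : Continuous h)
    {S : Finset ℤ} (x : S → G) :
    galAction e ν κ b h x = ∑ k : S, Real.pi * (k : ℤ) * ‖x k‖ ^ 2
      - ∫ t in (0:ℝ)..1, (κ * diagForm e ν (trig (Subtype.val : S → ℤ) x t) + b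
        + h (trig (Subtype.val : S → ℤ) x t)) := by
  have hx := continuous_trig (Subtype.val : S → ℤ) x
  have hd := (continuous_diagForm e ν).comp hx
  have hhx := hh.comp hx
  rw [intervalIntegral.integral_add, intervalIntegral.integral_add,
    intervalIntegral.integral_const_mul, integral_diagForm_trig, galAction,
    Finset.sum_sub_distrib, Finset.mul_sum]
  · simp; ring
  · exact (continuous_const.mul hd).intervalIntegrable _ _
  · exact continuous_const.intervalIntegrable _ _
  · exact ((continuous_const.mul hd).add continuous_const).intervalIntegrable _ _
  · exact hhx.intervalIntegrable _ _

theorem abs_sub_sub_inner_le {h : G → ℝ} {gh : G → G}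
    (hh : ∀ z, HasFDerivAt h (innerSL ℝ (gh z)) z) {ε σ : ℝ}
    (hσ : ∀ x y, ‖y - x‖ ≤ σ → ‖gh y - gh x‖ ≤ ε) (x y : G) (hxy : ‖y - x‖ ≤ σ) :
    |h y - h x - ⟪gh x, y - x⟫| ≤ ε * ‖y - x‖ := by
  have h1 := (convex_segment x y).norm_image_sub_le_of_norm_hasFDerivWithin_le' (𝕜 := ℝ)
    (f := h) (f' := fun z => innerSL ℝ (gh z)) (φ := innerSL ℝ (gh x)) (C := ε)
    (fun z _ => (hh z).hasFDerivWithinAt) (fun z hz => by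
      rw [← map_sub, innerSL_apply_norm]
      apply hσ
      exact (norm_sub_le_of_mem_segment hz).trans hxy) (left_mem_segment ℝ x y)
    (right_mem_segment ℝ x y)
  simpa using h1

end Galerkin

section GalerkinCritical

variable {G : Type*} [NormedAddCommGroup G] [InnerProductSpace ℂ G]

theorem continuous_trig_prod {S : Finset ℤ} :
    Continuous fun p : PiLp 2 (fun _ : S => G) × ℝ =>
      trig (Subtype.val : S → ℤ) (p.1.ofLp) p.2 := by
  unfold trig
  refine continuous_finsetSum _ fun i _ => ?_
  exact ((continuous_ez _).comp continuous_snd).smul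
    ((PiLp.continuous_apply 2 _ i).comp continuous_fst)

theorem continuous_galAction (e : G) (ν κ b : ℝ) (h : G → ℝ) (hh : Continuous h)
    {S : Finset ℤ} : Continuous fun x : PiLp 2 (fun _ : S => G) => galAction e ν κ b h x.ofLp := by
  unfold galAction
  have hp : ∀ k : S, Continuous fun x : PiLp 2 (fun _ : S => G) => x.ofLp k :=
    fun k => PiLp.continuous_apply 2 _ k
  refine ((continuous_finsetSum _ fun k _ => ?_).sub continuous_const).sub ?_
  · exact (continuous_const.mul ((hp k).norm.pow 2)).sub
      (continuous_const.mul ((continuous_diagForm e ν).comp (hp k)))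
  · exact intervalIntegral.continuous_parametric_intervalIntegral_of_continuous'
      (f := fun (x : PiLp 2 (fun _ : S => G)) t => h (trig (Subtype.val : S → ℤ) x.ofLp t))
      (hh.comp continuous_trig_prod) 0 1

theorem continuous_galGrad (e : G) (ν κ : ℝ) (gh : G → G) (hgh : Continuous gh)
    {S : Finset ℤ} : Continuous fun x : PiLp 2 (fun _ : S => G) =>
      WithLp.toLp 2 (galGrad e ν κ gh x.ofLp) := by
  refine (PiLp.continuous_toLp 2 _).comp (continuous_pi fun k => ?_)
  have hp : Continuous fun x : PiLp 2 (fun _ : S => G) => x.ofLp k := PiLp.continuous_apply 2 _ k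
  unfold galGrad
  refine ((hp.const_smul _).sub (((diagOp e ν).continuous.comp hp).const_smul _)).sub ?_
  refine intervalIntegral.continuous_parametric_intervalIntegral_of_continuous'
    (f := fun (x : PiLp 2 (fun _ : S => G)) t =>
      ez (-k) t • gh (trig (Subtype.val : S → ℤ) x.ofLp t)) ?_ 0 1
  exact ((continuous_ez _).comp continuous_snd).smul (hgh.comp continuous_trig_prod)

theorem galAction_sub_le [FiniteDimensional ℂ G] (e : G) {ν κ : ℝ} (hν : 0 ≤ ν) (hν1 : ν ≤ 1)
    (hκ : 0 ≤ κ)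
    (b : ℝ) {h : G → ℝ} {gh : G → G}
    (hh : ∀ z, HasFDerivAt h (innerSL ℝ (gh z)) z) (hgu : UniformContinuous gh)
    {S : Finset ℤ} (ε : ℝ) (hε : 0 < ε) : ∃ σ > 0, ∀ x y : PiLp 2 (fun _ : S => G), ‖y - x‖ ≤ σ →
      galAction e ν κ b h y.ofLp - galAction e ν κ b h x.ofLp
        - ⟪(WithLp.toLp 2 (galGrad e ν κ gh x.ofLp) : PiLp 2 (fun _ : S => G)), y - x⟫
        ≤ ε * ‖y - x‖ := by
  have hcomp : CompleteSpace G := FiniteDimensional.complete ℂ G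
  set A : ℝ := S.card + 1 with hA
  have hA0 : 0 < A := by positivity
  obtain ⟨σ₀, hσ₀, hu⟩ := Metric.uniformContinuous_iff.1 hgu (ε / (2 * A)) (by positivity)
  set B : ℝ := Real.pi * ∑ k ∈ S, |(k:ℝ)| + 1 with hB
  have hB0 : 0 < B := by positivity
  refine ⟨min (σ₀ / (2 * A)) (ε / (2 * B)), by positivity, fun x y hxy => ?_⟩
  set d : PiLp 2 (fun _ : S => G) := y - x with hd
  have hdk : ∀ k : S, ‖d.ofLp k‖ ≤ ‖d‖ := fun k => PiLp.norm_apply_le d k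
  have htd : ∀ t, ‖trig (Subtype.val : S → ℤ) d.ofLp t‖ ≤ A * ‖d‖ := by
    intro t
    refine (norm_trig_le _ _ _).trans ?_
    calc ∑ k, ‖d.ofLp k‖ ≤ ∑ k : S, ‖d‖ := Finset.sum_le_sum fun k _ => hdk k
      _ = S.card * ‖d‖ := by simp
      _ ≤ A * ‖d‖ := by gcongr; rw [hA]; linarith
  have htsub : ∀ t, trig (Subtype.val : S → ℤ) y.ofLp t - trig (Subtype.val : S → ℤ) x.ofLp t
      = trig (Subtype.val : S → ℤ) d.ofLp t := fun t => (trig_sub _ _ _ _).symm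
  have hcx := continuous_trig (Subtype.val : S → ℤ) x.ofLp
  have hcy := continuous_trig (Subtype.val : S → ℤ) y.ofLp
  have hcd := continuous_trig (Subtype.val : S → ℤ) d.ofLp
  have hhc : Continuous h := continuous_iff_continuousAt.2 fun z => (hh z).continuousAt
  have hgx : Continuous fun t => gh (trig (Subtype.val : S → ℤ) x.ofLp t) :=
    hgu.continuous.comp hcx
  have hhx : Continuous fun t => h (trig (Subtype.val : S → ℤ) x.ofLp t) := hhc.comp hcx
  have hhy : Continuous fun t => h (trig (Subtype.val : S → ℤ) y.ofLp t) := hhc.comp hcy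
  -- the nonlinear part
  have h1 : ∫ t in (0:ℝ)..1, (-(ε / 2) * ‖d‖) ≤ ∫ t in (0:ℝ)..1,
      (h (trig (Subtype.val : S → ℤ) y.ofLp t) - h (trig (Subtype.val : S → ℤ) x.ofLp t)
        - ⟪gh (trig (Subtype.val : S → ℤ) x.ofLp t), trig (Subtype.val : S → ℤ) d.ofLp t⟫) := by
    apply intervalIntegral.integral_mono_on zero_le_one
    · exact continuous_const.intervalIntegrable _ _
    · exact ((hhy.sub hhx).sub (hgx.inner hcd)).intervalIntegrable _ _
    · intro t _
      rw [← htsub]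
      have h2 := abs_sub_sub_inner_le hh (ε := ε / (2 * A)) (σ := σ₀ / 2) (fun a c hac => by
        rw [← dist_eq_norm]
        refine (hu ?_).le
        rw [dist_eq_norm]; linarith) (trig (Subtype.val : S → ℤ) x.ofLp t)
        (trig (Subtype.val : S → ℤ) y.ofLp t) (by
          rw [htsub]
          refine (htd t).trans ?_
          calc A * ‖d‖ ≤ A * (σ₀ / (2 * A)) := by gcongr; exact hxy.trans (min_le_left _ _)
            _ = σ₀ / 2 := by field_simp)
      have h3 : ε / (2 * A) * ‖trig (Subtype.val : S → ℤ) y.ofLp t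
          - trig (Subtype.val : S → ℤ) x.ofLp t‖ ≤ ε / 2 * ‖d‖ := by
        rw [htsub]
        calc _ ≤ ε / (2 * A) * (A * ‖d‖) := by gcongr; exact htd t
          _ = _ := by field_simp
      have := (abs_le.1 h2).1
      linarith
  have hsub : Continuous fun t => h (trig (Subtype.val : S → ℤ) y.ofLp t)
    - h (trig (Subtype.val : S → ℤ) x.ofLp t) := hhy.sub hhx
  rw [intervalIntegral.integral_sub (hsub.intervalIntegrable _ _)
    ((hgx.inner hcd).intervalIntegrable _ _), intervalIntegral.integral_sub
    (hhy.intervalIntegrable _ _) (hhx.intervalIntegrable _ _)] at h1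
  have h4 := integral_real_inner_trig (Subtype.val : S → ℤ)
    (fun t => gh (trig (Subtype.val : S → ℤ) x.ofLp t)) hgx d.ofLp
  rw [h4] at h1
  simp only [intervalIntegral.integral_const, sub_zero, one_smul] at h1
  -- the quadratic part
  have h5 : ∑ k : S, (Real.pi * (k : ℤ) * ‖y.ofLp k‖ ^ 2 - κ * diagForm e ν (y.ofLp k))
      - ∑ k : S, (Real.pi * (k : ℤ) * ‖x.ofLp k‖ ^ 2 - κ * diagForm e ν (x.ofLp k))
      - ∑ k : S, ⟪(2 * Real.pi * (k : ℤ)) • x.ofLp k - (2 * κ) • diagOp e ν (x.ofLp k), d.ofLp k⟫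
      ≤ ε / 2 * ‖d‖ := by
    rw [← Finset.sum_sub_distrib, ← Finset.sum_sub_distrib]
    calc _ ≤ ∑ k : S, Real.pi * |((k : ℤ) : ℝ)| * ‖d‖ ^ 2 := by
          refine Finset.sum_le_sum fun k _ => ?_
          have e1 := diagForm_sub e ν (x.ofLp k) (y.ofLp k)
          have e2 : ‖y.ofLp k‖ ^ 2 - ‖x.ofLp k‖ ^ 2 - 2 * ⟪x.ofLp k, y.ofLp k - x.ofLp k⟫
              = ‖y.ofLp k - x.ofLp k‖ ^ 2 := by
            rw [norm_sub_sq_real, inner_sub_right, real_inner_self_eq_norm_sq,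
              real_inner_comm]; ring
          have e3 : d.ofLp k = y.ofLp k - x.ofLp k := rfl
          rw [inner_sub_left, real_inner_smul_left, real_inner_smul_left, e3]
          have e4 : 0 ≤ diagForm e ν (y.ofLp k - x.ofLp k) :=
            (by positivity : 0 ≤ ν * ‖y.ofLp k - x.ofLp k‖ ^ 2).trans (le_diagForm hν1 _)
          have e5 : Real.pi * (k:ℤ) * ‖y.ofLp k - x.ofLp k‖ ^ 2
              ≤ Real.pi * |((k : ℤ) : ℝ)| * ‖d‖ ^ 2 := by
            have := hdk k
            rw [e3] at this
            have hk := le_abs_self ((k : ℤ) : ℝ)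
            gcongr
          have e6 := congrArg (fun r => Real.pi * (k:ℤ) * r) e2
          have e7 := congrArg (fun r => κ * r) e1
          have e8 := mul_nonneg hκ e4
          dsimp only at e6 e7
          linarith
      _ = (Real.pi * ∑ k ∈ S, |(k:ℝ)|) * ‖d‖ ^ 2 := by
          rw [← Finset.sum_coe_sort S, Finset.mul_sum, Finset.sum_mul]
      _ ≤ B * ‖d‖ * ‖d‖ := by
          rw [sq, ← mul_assoc]; gcongr; rw [hB]; linarith
      _ ≤ B * (ε / (2 * B)) * ‖d‖ := by
          gcongr; exact hxy.trans (min_le_right _ _)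
      _ = _ := by field_simp
  have h6 : ⟪(WithLp.toLp 2 (galGrad e ν κ gh x.ofLp) : PiLp 2 (fun _ : S => G)), d⟫
      = ∑ k : S, ⟪(2 * Real.pi * (k : ℤ)) • x.ofLp k - (2 * κ) • diagOp e ν (x.ofLp k), d.ofLp k⟫
        - ∑ k : S, ⟪fcoeff (fun t => gh (trig (Subtype.val : S → ℤ) x.ofLp t)) k, d.ofLp k⟫ := by
    rw [PiLp.inner_apply, ← Finset.sum_sub_distrib]
    refine Finset.sum_congr rfl fun k _ => ?_
    rw [← inner_sub_left]; rfl
  rw [h6]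
  simp only [galAction]
  linarith

end GalerkinCritical

section GalerkinExistence

variable {G : Type*} [NormedAddCommGroup G] [InnerProductSpace ℂ G]

/-- The trigonometric polynomials with frequencies in `S` without positive frequencies. -/
def nonposFreq (G : Type*) [NormedAddCommGroup G] [InnerProductSpace ℂ G] (S : Finset ℤ) :
    Submodule ℝ (PiLp 2 (fun _ : S => G)) where
  carrier := {x | ∀ k : S, 0 < (k : ℤ) → x.ofLp k = 0}
  add_mem' := by
    intro a b ha hb k hk
    simp [ha k hk, hb k hk]
  zero_mem' := by intro k _; simp
  smul_mem' := by
    intro c x hx k hk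
    simp [hx k hk]

/-- The projection onto `nonposFreq G S`. -/
def nonposProj (G : Type*) [NormedAddCommGroup G] [InnerProductSpace ℂ G] (S : Finset ℤ) :
    PiLp 2 (fun _ : S => G) →ₗ[ℝ] nonposFreq G S where
  toFun x := ⟨WithLp.toLp 2 fun k => if 0 < (k : ℤ) then 0 else x.ofLp k, fun k hk => if_pos hk⟩
  map_add' x y := by
    ext k
    by_cases hk : 0 < (k : ℤ) <;> simp [hk]
  map_smul' c x := by
    ext k
    by_cases hk : 0 < (k : ℤ) <;> simp [hk]

theorem exists_galGrad_le [FiniteDimensional ℂ G] {e : G} (he : ‖e‖ = 1) {ν κ : ℝ} (hν : 0 < ν)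
    (hν1 : ν ≤ 1) (hκ : Real.pi < κ) (b : ℝ) {h : G → ℝ} {gh : G → G}
    (hh : ∀ z, HasFDerivAt h (innerSL ℝ (gh z)) z) (hgu : UniformContinuous gh)
    {Mh : ℝ} (hMh : ∀ z, |h z| ≤ Mh) (hpos : ∀ z, 0 ≤ κ * diagForm e ν z + b + h z)
    {C₄ : ℝ} (hC₄ : 0 < C₄) (hH4 : ∀ z, κ * diagForm e ν z + b + h z ≤ C₄ * ‖z‖ ^ 4)
    (S : Finset ℤ) (hS : (1:ℤ) ∈ S) (δ : ℝ) (hδ : 0 < δ) :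
    ∃ x : S → G, ∑ k, ‖galGrad e ν κ gh x k‖ ^ 2 ≤ δ ^ 2 ∧
      Real.pi ^ 2 / (8 * C₄) ≤ galAction e ν κ b h x := by
  have hcomp : CompleteSpace G := FiniteDimensional.complete ℂ G
  have hfd : FiniteDimensional ℝ G := FiniteDimensional.complexToReal G
  have hπ := Real.pi_pos
  have hκ0 : 0 < κ := hπ.trans hκ
  have hhc : Continuous h := continuous_iff_continuousAt.2 fun z => (hh z).continuousAt
  have hHc : Continuous fun z => κ * diagForm e ν z + b + h z :=
    ((continuous_const.mul (continuous_diagForm e ν)).add continuous_const).add hhc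
  set X := PiLp 2 (fun _ : S => G) with hX
  set P : X →L[ℝ] nonposFreq G S := LinearMap.toContinuousLinearMap (nonposProj G S) with hP
  have hPa : ∀ (x : X) (k : S), (P x : X).ofLp k = if 0 < (k : ℤ) then 0 else x.ofLp k :=
    fun x k => rfl
  set ev : X := WithLp.toLp 2 (fun k : S => if (k : ℤ) = 1 then e else 0) with hev
  have hevk : ∀ k : S, ev.ofLp k = if (k : ℤ) = 1 then e else 0 := fun k => rfl
  have hwk : ∀ (w : nonposFreq G S) (k : S), 0 < (k : ℤ) → (w : X).ofLp k = 0 := fun w => w.2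
  have hadd : ∀ (w : nonposFreq G S) (s : ℝ) (k : S), ((w : X) + s • ev).ofLp k
      = (w : X).ofLp k + s • ev.ofLp k := fun w s k => rfl
  set Nf : X → ℝ := fun x => √(∑ k : S, max ((k : ℤ) : ℝ) 0 * ‖x.ofLp k‖ ^ 2) with hNf
  have hap : ∀ k : S, Continuous fun x : X => x.ofLp k := fun k => PiLp.continuous_apply 2 _ k
  have hNfc : Continuous Nf := by
    refine Real.continuous_sqrt.comp (continuous_finsetSum _ fun k _ => ?_)
    exact continuous_const.mul ((hap k).norm.pow 2)
  have hnorm : ∀ x : X, ‖x‖ ^ 2 = ∑ k, ‖x.ofLp k‖ ^ 2 := fun x => PiLp.norm_sq_eq_of_L2 _ x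
  set one : S := ⟨1, hS⟩ with hone
  have hval : ∀ k : S, (k : ℤ) = 1 ↔ k = one := fun k => by
    rw [hone, Subtype.ext_iff]
  have hNe : ∀ (w : nonposFreq G S) (s : ℝ), 0 ≤ s → Nf (w + s • ev) = s := by
    intro w s hs
    have : ∑ k : S, max ((k : ℤ) : ℝ) 0 * ‖((w : X) + s • ev).ofLp k‖ ^ 2 = s ^ 2 := by
      rw [Finset.sum_eq_single one]
      · rw [hadd, hwk w one (by simp [hone]), hevk]
        simp [hone, norm_smul, he]
      · intro k _ hk
        have hk1 : (k : ℤ) ≠ 1 := fun h => hk ((hval k).1 h)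
        rw [hadd, hevk, if_neg hk1, smul_zero, add_zero]
        rcases lt_or_ge 0 (k : ℤ) with h0 | h0
        · rw [hwk w k h0]; simp
        · rw [max_eq_right (by exact_mod_cast h0)]; simp
      · simp
    simp only [hNf]
    rw [this, Real.sqrt_sq hs]
  -- upper bound on the half space
  have hup : ∀ (w : nonposFreq G S) (s : ℝ), galAction e ν κ b h ((w : X) + s • ev).ofLp
      ≤ -(κ * ν) * ‖w‖ ^ 2 - (κ - Real.pi) * s ^ 2 + (|b| + Mh) := by
    intro w s
    have h1 : -Mh ≤ ∫ t in (0:ℝ)..1, h (trig (Subtype.val : S → ℤ) ((w : X) + s • ev).ofLp t) := by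
      have := intervalIntegral.integral_mono_on (a := 0) (b := 1) (μ := volume)
        (f := fun _ => -Mh)
        (g := fun t => h (trig (Subtype.val : S → ℤ) ((w : X) + s • ev).ofLp t)) zero_le_one
        (continuous_const.intervalIntegrable _ _)
        ((hhc.comp (continuous_trig _ _)).intervalIntegrable _ _)
        (fun t _ => (abs_le.1 (hMh _)).1)
      simpa using this
    have h2 : ∑ k : S, (Real.pi * (k : ℤ) * ‖((w : X) + s • ev).ofLp k‖ ^ 2
        - κ * diagForm e ν (((w : X) + s • ev).ofLp k))
        ≤ ∑ k : S, (-(κ * ν) * ‖(w : X).ofLp k‖ ^ 2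
            - if k = one then (κ - Real.pi) * s ^ 2 else 0) := by
      refine Finset.sum_le_sum fun k _ => ?_
      by_cases hk : k = one
      · subst hk
        rw [hadd, hwk w one (by simp [hone]), hevk, if_pos rfl, zero_add, diagForm_smul_self he,
          norm_smul, he, if_pos rfl]
        simp [hone]; linarith
      · rw [hadd, hevk, if_neg (fun h => hk ((hval k).1 h)), smul_zero, add_zero, if_neg hk]
        rcases lt_or_ge 0 (k : ℤ) with h0 | h0
        · rw [hwk w k h0]; simp [diagForm]
        · have h3 := le_diagForm (e := e) hν1 ((w : X).ofLp k)
          have h4 : κ * (ν * ‖(w : X).ofLp k‖ ^ 2) ≤ κ * diagForm e ν ((w : X).ofLp k) := by gcongr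
          have h5 : Real.pi * (k : ℤ) * ‖(w : X).ofLp k‖ ^ 2 ≤ 0 := by
            have : ((k : ℤ) : ℝ) ≤ 0 := by exact_mod_cast h0
            exact mul_nonpos_of_nonpos_of_nonneg (mul_nonpos_of_nonneg_of_nonpos hπ.le this)
              (by positivity)
          linarith
    have h6 : ∑ k : S, (-(κ * ν) * ‖(w : X).ofLp k‖ ^ 2
        - if k = one then (κ - Real.pi) * s ^ 2 else 0)
        = -(κ * ν) * ‖w‖ ^ 2 - (κ - Real.pi) * s ^ 2 := by
      rw [Finset.sum_sub_distrib, ← Finset.mul_sum, ← hnorm, Finset.sum_ite_eq' Finset.univ,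
        if_pos (Finset.mem_univ _)]
      rfl
    rw [h6] at h2
    have := neg_abs_le b
    simp only [galAction]
    linarith
  have hMh0 : 0 ≤ Mh := (abs_nonneg _).trans (hMh 0)
  set c₁ : ℝ := min (κ * ν) (κ - Real.pi) with hc₁
  have hc₁0 : 0 < c₁ := lt_min (by positivity) (by linarith)
  set α : ℝ := √(Real.pi / (2 * C₄)) with hα
  have hα2 : α ^ 2 = Real.pi / (2 * C₄) := Real.sq_sqrt (by positivity)
  obtain ⟨x, hx1, hx2⟩ := exists_almost_critical (nonposFreq G S) P (by
      intro w
      ext k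
      rw [hPa]
      split_ifs with hk
      · rw [hwk w k hk]
      · rfl) ev (by
      ext k
      rw [hPa, hevk]
      split_ifs with h1 h2
      · rfl
      · omega
      · rfl) Nf hNfc hNe (fun x => galAction e ν κ b h x.ofLp)
    (fun x => WithLp.toLp 2 (galGrad e ν κ gh x.ofLp)) (continuous_galAction e ν κ b h hhc)
    (continuous_galGrad e ν κ gh hgu.continuous)
    (galAction_sub_le e hν.le hν1 hκ0.le b hh hgu)
    (√((|b| + Mh) / c₁)) α (Real.pi ^ 2 / (4 * C₄)) (|b| + Mh) (by positivity) (by positivity)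
    (by
      intro w
      show galAction e ν κ b h (w : X).ofLp ≤ 0
      rw [galAction_eq e ν κ b h hhc]
      have h1 : 0 ≤ ∫ t in (0:ℝ)..1, (κ * diagForm e ν (trig (Subtype.val : S → ℤ) (w : X).ofLp t)
        + b + h (trig (Subtype.val : S → ℤ) (w : X).ofLp t)) :=
        intervalIntegral.integral_nonneg zero_le_one fun t _ => hpos _
      have h2 : ∑ k : S, Real.pi * (k : ℤ) * ‖(w : X).ofLp k‖ ^ 2 ≤ 0 := by
        refine Finset.sum_nonpos fun k _ => ?_
        rcases lt_or_ge 0 (k : ℤ) with h0 | h0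
        · rw [hwk w k h0]; simp
        · have : ((k : ℤ) : ℝ) ≤ 0 := by exact_mod_cast h0
          exact mul_nonpos_of_nonpos_of_nonneg (mul_nonpos_of_nonneg_of_nonpos hπ.le this)
              (by positivity)
      linarith)
    (by
      intro w s hs hfar
      refine (hup w s).trans ?_
      rw [Real.sq_sqrt (by positivity), div_le_iff₀ hc₁0] at hfar
      have h1 : c₁ * ‖w‖ ^ 2 ≤ (κ * ν) * ‖w‖ ^ 2 := by gcongr; exact min_le_left _ _
      have h2 : c₁ * s ^ 2 ≤ (κ - Real.pi) * s ^ 2 := by gcongr; exact min_le_right _ _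
      linarith)
    (by
      intro w s hs
      refine (hup w s).trans ?_
      have h1 : 0 ≤ (κ * ν) * ‖w‖ ^ 2 := by positivity
      have h2 : 0 ≤ (κ - Real.pi) * s ^ 2 := mul_nonneg (by linarith) (by positivity)
      linarith)
    (by
      intro x hPx hNx
      have hxk : ∀ k : S, (k : ℤ) ≤ 0 → x.ofLp k = 0 := by
        intro k hk
        have := hPa x k
        rw [hPx, if_neg (by omega)] at this
        exact this.symm
      have hsum : ∑ k : S, max ((k : ℤ) : ℝ) 0 * ‖x.ofLp k‖ ^ 2 = α ^ 2 := by
        rw [← hNx]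
        exact (Real.sq_sqrt (Finset.sum_nonneg fun k _ => by positivity)).symm
      have hsum1 : ∑ k : S, Real.pi * ((k : ℤ) : ℝ) * ‖x.ofLp k‖ ^ 2 = Real.pi * α ^ 2 := by
        rw [← hsum, Finset.mul_sum]
        refine Finset.sum_congr rfl fun k _ => ?_
        rcases lt_or_ge 0 (k : ℤ) with h0 | h0
        · rw [max_eq_left (by exact_mod_cast h0.le)]; ring
        · rw [hxk k h0]; simp
      -- reduce to the positive frequencies
      set y : {k : S // 0 < (k : ℤ)} → G := fun k => x.ofLp k with hy
      have htr : ∀ t, trig (Subtype.val : S → ℤ) x.ofLp t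
          = trig (fun k : {k : S // 0 < (k : ℤ)} => ((k : S) : ℤ)) y t := by
        intro t
        simp only [trig, hy]
        refine (Finset.sum_filter_of_ne (p := fun k : S => 0 < (k:ℤ)) ?_).symm.trans
          (Finset.sum_subtype _ (fun k => by simp) _)
        intro k _ hne
        by_contra h0
        exact hne (by rw [hxk k (by omega), smul_zero])
      have hsum2 : ∑ k : {k : S // 0 < (k : ℤ)}, (((k : S) : ℤ) : ℝ) * ‖y k‖ ^ 2 = α ^ 2 := by
        rw [← hsum]
        symm
        rw [← Finset.sum_filter_of_ne (p := fun k : S => 0 < (k:ℤ)),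
          Finset.sum_subtype (p := fun k : S => 0 < (k:ℤ)) _ (fun k => by simp)]
        · refine Finset.sum_congr rfl fun k _ => ?_
          rw [max_eq_left (by exact_mod_cast k.2.le)]
        · intro k _ hne
          by_contra h0
          exact hne (by rw [hxk k (by omega)]; simp)
      have h4 := integral_norm_pow_four_trig_le
        (fun k : {k : S // 0 < (k : ℤ)} => ((k : S) : ℤ))
        (fun k l hkl => Subtype.ext (Subtype.ext hkl)) (fun k => k.2) y
      rw [hsum2] at h4
      simp only [← htr] at h4
      have h5 : ∫ t in (0:ℝ)..1, (κ * diagForm e ν (trig (Subtype.val : S → ℤ) x.ofLp t)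
          + b + h (trig (Subtype.val : S → ℤ) x.ofLp t))
          ≤ ∫ t in (0:ℝ)..1, C₄ * ‖trig (Subtype.val : S → ℤ) x.ofLp t‖ ^ 4 := by
        apply intervalIntegral.integral_mono_on zero_le_one
        · exact (hHc.comp (continuous_trig _ _)).intervalIntegrable _ _
        · exact (continuous_const.mul ((continuous_trig _ _).norm.pow 4)).intervalIntegrable _ _
        · exact fun t _ => hH4 _
      rw [intervalIntegral.integral_const_mul] at h5
      rw [galAction_eq e ν κ b h hhc, hsum1]
      have h6 : C₄ * ∫ t in (0:ℝ)..1, ‖trig (Subtype.val : S → ℤ) x.ofLp t‖ ^ 4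
          ≤ C₄ * (α ^ 2) ^ 2 := by gcongr
      have h7 : Real.pi * α ^ 2 - C₄ * (α ^ 2) ^ 2 = Real.pi ^ 2 / (4 * C₄) := by
        rw [hα2]; field_simp; ring
      linarith) δ hδ
  refine ⟨x.ofLp, ?_, ?_⟩
  · have h1 := hnorm (WithLp.toLp 2 (galGrad e ν κ gh x.ofLp))
    have h2 : ‖(WithLp.toLp 2 (galGrad e ν κ gh x.ofLp) : X)‖ ^ 2 ≤ δ ^ 2 := by gcongr
    exact h1.symm.trans_le h2
  · refine le_trans (le_of_eq ?_) hx2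
    ring

end GalerkinExistence

section GalerkinBounds

variable {G : Type*} [NormedAddCommGroup G] [InnerProductSpace ℂ G]

theorem hasDerivAt_trig {ι : Type*} [Fintype ι] (m : ι → ℤ) (c : ι → G) (t : ℝ) :
    HasDerivAt (trig m c) (trig m (fun i => (2 * Real.pi * Complex.I * m i : ℂ) • c i) t) t := by
  unfold trig
  refine HasDerivAt.fun_sum fun i _ => ?_
  refine ((hasDerivAt_ez (m i) t).smul_const (c i)).congr_deriv ?_
  rw [smul_smul, mul_comm]

theorem exists_spectral_gap {ν κ : ℝ} (hν : 0 < ν) (hν1 : ν < 1 / 2) (hκ : Real.pi < κ)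
    (hκ2 : κ < 2 * Real.pi) : ∃ c > 0, ∀ k : ℤ, c ≤ |2 * Real.pi * k - 2 * κ * ν| ∧
      c ≤ |2 * Real.pi * k - 2 * κ| := by
  have hπ := Real.pi_pos
  have h1 : 2 * κ * ν < 2 * Real.pi := by nlinarith
  refine ⟨min (min (2 * κ * ν) (2 * Real.pi - 2 * κ * ν))
    (min (2 * κ - 2 * Real.pi) (4 * Real.pi - 2 * κ)), ?_, fun k => ⟨?_, ?_⟩⟩
  · have : 0 < 2 * κ * ν := by nlinarith
    refine lt_min (lt_min this (by linarith)) (lt_min (by linarith) (by linarith))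
  · refine (min_le_left _ _).trans ?_
    rcases le_or_gt k 0 with hk | hk
    · have : (k : ℝ) ≤ 0 := by exact_mod_cast hk
      refine (min_le_left _ _).trans (le_trans ?_ (neg_le_abs _))
      nlinarith
    · have : (1 : ℝ) ≤ k := by exact_mod_cast hk
      refine (min_le_right _ _).trans (le_trans ?_ (le_abs_self _))
      nlinarith
  · refine (min_le_right _ _).trans ?_
    rcases le_or_gt k 1 with hk | hk
    · have : (k : ℝ) ≤ 1 := by exact_mod_cast hk
      refine (min_le_left _ _).trans (le_trans ?_ (neg_le_abs _))
      nlinarith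
    · have : (2 : ℝ) ≤ k := by exact_mod_cast hk
      refine (min_le_right _ _).trans (le_trans ?_ (le_abs_self _))
      nlinarith

theorem norm_add_sq_le_two {V : Type*} [SeminormedAddCommGroup V] (a b : V) :
    ‖a + b‖ ^ 2 ≤ 2 * ‖a‖ ^ 2 + 2 * ‖b‖ ^ 2 := by
  have := norm_add_le a b
  nlinarith [norm_nonneg (a + b), norm_nonneg a, norm_nonneg b, sq_nonneg (‖a‖ - ‖b‖)]

theorem sum_fcoeff_le_of_norm_le [CompleteSpace G] {S : Finset ℤ} {M : ℝ} {u : ℝ → G}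
    (hu : Continuous u) (hM : ∀ t, ‖u t‖ ≤ M) : ∑ k : S, ‖fcoeff u k‖ ^ 2 ≤ M ^ 2 := by
  refine (sum_norm_sq_fcoeff_le (Subtype.val : S → ℤ) Subtype.val_injective u hu).trans ?_
  have := intervalIntegral.integral_mono_on (a := 0) (b := 1) (μ := volume)
    (f := fun t => ‖u t‖ ^ 2) (g := fun _ => M ^ 2) zero_le_one
    ((hu.norm.pow 2).intervalIntegrable _ _) (continuous_const.intervalIntegrable _ _)
    (fun t _ => by have := hM t; gcongr)
  simpa using this

set_option maxHeartbeats 800000 in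
/-- A priori bounds for almost critical points, uniform in the set of frequencies. -/
theorem exists_galerkin_bounds [FiniteDimensional ℂ G] {e : G} (he : ‖e‖ = 1) {ν κ : ℝ} (hν : 0 < ν)
    (hν1 : ν < 1 / 2) (hκ : Real.pi < κ) (hκ2 : κ < 2 * Real.pi) {gh : G → G}
    (hgc : Continuous gh) {M : ℝ} (hM : ∀ z, ‖gh z‖ ≤ M) :
    ∃ B > 0, ∀ (S : Finset ℤ) (x : S → G), ∑ k, ‖galGrad e ν κ gh x k‖ ^ 2 ≤ 1 →
      (∀ k, ‖x k‖ ≤ B) ∧ ∑ k, ‖x k‖ ^ 2 ≤ B ^ 2 ∧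
      (∀ t ∈ Icc (0:ℝ) 1, ‖trig (Subtype.val : S → ℤ) x t‖ ≤ B) ∧
      ∀ η > 0, ∀ s t, 0 ≤ s → s ≤ t → t ≤ 1 →
        ‖trig (Subtype.val : S → ℤ) x t - trig (Subtype.val : S → ℤ) x s‖
          ≤ B * η + (t - s) / η := by
  have hcomp : CompleteSpace G := FiniteDimensional.complete ℂ G
  obtain ⟨c, hc, hgap⟩ := exists_spectral_gap hν hν1 hκ hκ2
  have hπ := Real.pi_pos
  set B₁ : ℝ := (2 + 2 * M ^ 2) / c ^ 2 with hB₁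
  have hB₁0 : 0 ≤ B₁ := by positivity
  set q : ℝ := ‖diagOp e ν‖ with hq
  set B₂ : ℝ := 2 * (2 + 2 * M ^ 2) + 2 * ((2 * κ) ^ 2 * q ^ 2 * B₁) with hB₂
  have hB₂0 : 0 ≤ B₂ := by positivity
  set D : ℝ := B₂ + 1 with hD
  refine ⟨B₁ + B₂ + 2 * D ^ 2 + 2 * B₁ + 1, by positivity, fun S x hx => ?_⟩
  set B := B₁ + B₂ + 2 * D ^ 2 + 2 * B₁ + 1 with hB
  have hB1 : 1 ≤ B := by rw [hB]; linarith [sq_nonneg D]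
  have hx0 := continuous_trig (Subtype.val : S → ℤ) x
  set gc : S → G := fun k => fcoeff (fun t => gh (trig (Subtype.val : S → ℤ) x t)) k with hgcoef
  have hgsum : ∑ k, ‖gc k‖ ^ 2 ≤ M ^ 2 := sum_fcoeff_le_of_norm_le (hgc.comp hx0) fun t => hM _
  have hrel : ∀ k : S, (2 * Real.pi * (k : ℤ)) • x k - (2 * κ) • diagOp e ν (x k)
      = galGrad e ν κ gh x k + gc k := by
    intro k; simp only [galGrad, hgcoef, sub_add_cancel]
  have hR : ∑ k, ‖galGrad e ν κ gh x k + gc k‖ ^ 2 ≤ 2 + 2 * M ^ 2 := by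
    calc _ ≤ ∑ k, (2 * ‖galGrad e ν κ gh x k‖ ^ 2 + 2 * ‖gc k‖ ^ 2) :=
          Finset.sum_le_sum fun k _ => norm_add_sq_le_two _ _
      _ = 2 * ∑ k, ‖galGrad e ν κ gh x k‖ ^ 2 + 2 * ∑ k, ‖gc k‖ ^ 2 := by
          rw [Finset.sum_add_distrib, Finset.mul_sum, Finset.mul_sum]
      _ ≤ _ := by linarith
  have hX1 : ∑ k, ‖x k‖ ^ 2 ≤ B₁ := by
    rw [hB₁, le_div_iff₀ (by positivity), Finset.sum_mul]
    refine le_trans (Finset.sum_le_sum fun k _ => ?_) hR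
    rw [← hrel]
    have := le_norm_smul_sub_diagOp he hc.le (hgap k).1 (hgap k).2 (x k)
    calc ‖x k‖ ^ 2 * c ^ 2 = (c * ‖x k‖) ^ 2 := by ring
      _ ≤ _ := by gcongr
  have hX2 : ∑ k : S, ‖(2 * Real.pi * Complex.I * (k : ℤ) : ℂ) • x k‖ ^ 2 ≤ B₂ := by
    calc _ ≤ ∑ k : S, (2 * ‖galGrad e ν κ gh x k + gc k‖ ^ 2
            + 2 * ((2 * κ) ^ 2 * q ^ 2 * ‖x k‖ ^ 2)) := by
          refine Finset.sum_le_sum fun k _ => ?_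
          have h1 : ‖(2 * Real.pi * Complex.I * (k : ℤ) : ℂ) • x k‖
              = ‖(2 * Real.pi * (k : ℤ)) • x k‖ := by
            rw [norm_smul, norm_smul]; simp
          have h2 : (2 * Real.pi * (k : ℤ)) • x k
              = (galGrad e ν κ gh x k + gc k) + (2 * κ) • diagOp e ν (x k) := by
            rw [← hrel]; abel
          rw [h1, h2]
          refine (norm_add_sq_le_two _ _).trans ?_
          have h3 : ‖(2 * κ) • diagOp e ν (x k)‖ ^ 2 ≤ (2 * κ) ^ 2 * q ^ 2 * ‖x k‖ ^ 2 := by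
            rw [norm_smul, mul_pow, Real.norm_eq_abs, sq_abs, mul_assoc]
            have h4 : ‖diagOp e ν (x k)‖ ^ 2 ≤ (q * ‖x k‖) ^ 2 := by
              gcongr; exact (diagOp e ν).le_opNorm (x k)
            rw [mul_pow] at h4
            gcongr
          linarith
      _ = 2 * ∑ k, ‖galGrad e ν κ gh x k + gc k‖ ^ 2
            + 2 * ((2 * κ) ^ 2 * q ^ 2 * ∑ k, ‖x k‖ ^ 2) := by
          rw [Finset.sum_add_distrib, Finset.mul_sum, Finset.mul_sum, Finset.mul_sum]
      _ ≤ _ := by rw [hB₂]; gcongr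
  have hd := fun t => hasDerivAt_trig (Subtype.val : S → ℤ) x t
  set x' : ℝ → G := trig (Subtype.val : S → ℤ)
    (fun k : S => (2 * Real.pi * Complex.I * (k : ℤ) : ℂ) • x k) with hx'
  have hx'c : Continuous x' := continuous_trig _ _
  have hx'2 : ∫ t in (0:ℝ)..1, ‖x' t‖ ^ 2 ≤ B₂ :=
    (integral_norm_sq_trig _ Subtype.val_injective _).trans_le hX2
  have hosc : ∀ η > 0, ∀ s t, 0 ≤ s → s ≤ t → t ≤ 1 →
        ‖trig (Subtype.val : S → ℤ) x t - trig (Subtype.val : S → ℤ) x s‖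
          ≤ B₂ * η + (t - s) / η := by
    intro η hη s t hs hst ht
    have h1 := intervalIntegral.integral_eq_sub_of_hasDerivAt (a := s) (b := t)
      (fun r _ => hd r) (hx'c.intervalIntegrable _ _)
    rw [← h1]
    calc ‖∫ r in s..t, x' r‖ ≤ ∫ r in s..t, ‖x' r‖ :=
          intervalIntegral.norm_integral_le_integral_norm hst
      _ ≤ ∫ r in s..t, (η * ‖x' r‖ ^ 2 + 1 / η) := by
          apply intervalIntegral.integral_mono_on hst
          · exact hx'c.norm.intervalIntegrable _ _
          · exact ((continuous_const.mul (hx'c.norm.pow 2)).add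
              continuous_const).intervalIntegrable _ _
          · intro r _
            have h2 : η * ‖x' r‖ ^ 2 + 1 / η - ‖x' r‖
                = ((η * ‖x' r‖ - 1 / 2) ^ 2 + 3 / 4) / η := by field_simp; ring
            have h3 : 0 ≤ ((η * ‖x' r‖ - 1 / 2) ^ 2 + 3 / 4) / η := by positivity
            linarith
      _ = η * (∫ r in s..t, ‖x' r‖ ^ 2) + (t - s) / η := by
          rw [intervalIntegral.integral_add, intervalIntegral.integral_const_mul,
            intervalIntegral.integral_const]
          · simp [div_eq_mul_inv]
          · exact (continuous_const.mul (hx'c.norm.pow 2)).intervalIntegrable _ _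
          · exact continuous_const.intervalIntegrable _ _
      _ ≤ η * (∫ r in (0:ℝ)..1, ‖x' r‖ ^ 2) + (t - s) / η := by
          gcongr
          apply intervalIntegral.integral_mono_interval hs hst ht
          · exact Filter.Eventually.of_forall fun r => by positivity
          · exact (hx'c.norm.pow 2).intervalIntegrable _ _
      _ ≤ _ := by
          rw [mul_comm B₂]; gcongr
  have hBge : B₂ ≤ B := by rw [hB]; linarith [sq_nonneg D]
  have hB₁B : B₁ ≤ B := by rw [hB]; linarith [sq_nonneg D]
  have hX1' : ∑ k, ‖x k‖ ^ 2 ≤ B ^ 2 := hX1.trans (hB₁B.trans (le_self_pow₀ hB1 two_ne_zero))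
  refine ⟨fun k => ?_, hX1', fun t ht => ?_, fun η hη s t hs hst ht => ?_⟩
  · have h1 : ‖x k‖ ^ 2 ≤ B ^ 2 :=
      (Finset.single_le_sum (f := fun k => ‖x k‖ ^ 2) (fun i _ => by positivity)
        (Finset.mem_univ k)).trans hX1'
    exact le_of_sq_le_sq h1 (by linarith)
  · have h1 : ∀ s ∈ Icc (0:ℝ) 1, ‖trig (Subtype.val : S → ℤ) x t‖ ^ 2
        ≤ 2 * ‖trig (Subtype.val : S → ℤ) x s‖ ^ 2 + 2 * D ^ 2 := by
      intro s hs
      have h2 : ‖trig (Subtype.val : S → ℤ) x t - trig (Subtype.val : S → ℤ) x s‖ ≤ D := by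
        rcases le_total s t with hst | hst
        · refine (hosc 1 one_pos s t hs.1 hst ht.2).trans ?_
          rw [hD]; linarith [hs.1, ht.2]
        · rw [norm_sub_rev]
          refine (hosc 1 one_pos t s ht.1 hst hs.2).trans ?_
          rw [hD]; linarith [ht.1, hs.2]
      have h3 := norm_add_sq_le_two (trig (Subtype.val : S → ℤ) x s)
        (trig (Subtype.val : S → ℤ) x t - trig (Subtype.val : S → ℤ) x s)
      rw [add_sub_cancel] at h3
      have h4 : ‖trig (Subtype.val : S → ℤ) x t - trig (Subtype.val : S → ℤ) x s‖ ^ 2 ≤ D ^ 2 := by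
        gcongr
      linarith
    have h2 := intervalIntegral.integral_mono_on (a := 0) (b := 1) (μ := volume)
      (f := fun _ => ‖trig (Subtype.val : S → ℤ) x t‖ ^ 2)
      (g := fun s => 2 * ‖trig (Subtype.val : S → ℤ) x s‖ ^ 2 + 2 * D ^ 2) zero_le_one
      (continuous_const.intervalIntegrable _ _)
      (((continuous_const.mul (hx0.norm.pow 2)).add continuous_const).intervalIntegrable _ _) h1
    have h7 : Continuous fun s => 2 * ‖trig (Subtype.val : S → ℤ) x s‖ ^ 2 :=
      continuous_const.mul (hx0.norm.pow 2)
    rw [intervalIntegral.integral_add (h7.intervalIntegrable _ _)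
      (continuous_const.intervalIntegrable _ _), intervalIntegral.integral_const_mul,
      integral_norm_sq_trig _ Subtype.val_injective] at h2
    simp only [intervalIntegral.integral_const, sub_zero, one_smul] at h2
    refine le_of_sq_le_sq (?_ : _ ≤ B ^ 2) (by linarith)
    have h5 : B ≤ B ^ 2 := le_self_pow₀ hB1 two_ne_zero
    have h6 : 2 * B₁ + 2 * D ^ 2 ≤ B := by rw [hB]; linarith
    linarith
  · refine (hosc η hη s t hs hst ht).trans ?_
    gcongr

end GalerkinBounds

section FourierUniqueness

theorem fourier_one_coe (k : ℤ) (t : ℝ) : fourier k (t : AddCircle (1:ℝ)) = ez k t := by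
  rw [fourier_coe_apply, ez]; congr 1; push_cast; ring

/-- A continuous closed path all of whose nonconstant Fourier modes vanish is constant. -/
theorem eq_of_fcoeff_eq_zero_complex {v : ℝ → ℂ} (hv : Continuous v) (h01 : v 0 = v 1)
    (hc : ∀ k : ℤ, k ≠ 0 → fcoeff v k = 0) {t : ℝ} (ht : t ∈ Icc (0:ℝ) 1) : v t = v 0 := by
  have hT : Fact (0 < (1:ℝ)) := ⟨one_pos⟩
  have hcont : Continuous (AddCircle.liftIco (1:ℝ) 0 v) :=
    AddCircle.liftIco_continuous (by rw [zero_add]; exact h01) hv.continuousOn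
  set F : C(AddCircle (1:ℝ), ℂ) := ⟨AddCircle.liftIco (1:ℝ) 0 v, hcont⟩ with hF
  have hFv : ∀ s ∈ Ico (0:ℝ) 1, F (s : AddCircle (1:ℝ)) = v s := fun s hs =>
    AddCircle.liftIco_coe_apply (by rwa [zero_add])
  have hcoef : ∀ k : ℤ, k ≠ 0 → fourierCoeff F k = 0 := by
    intro k hk
    rw [fourierCoeff_eq_intervalIntegral _ _ 0, ← hc k hk, fcoeff]
    simp only [div_one, one_smul, zero_add]
    refine intervalIntegral.integral_congr_Ioo_of_le zero_le_one fun x hx => ?_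
    rw [fourier_one_coe, hFv x (Ioo_subset_Ico_self hx)]
  have hsum : Summable (fourierCoeff F) :=
    summable_of_ne_finset_zero (s := {0}) fun k hk => hcoef k (by simpa using hk)
  have hconst : ∀ s : AddCircle (1:ℝ), F s = fourierCoeff F 0 := by
    intro s
    refine (has_pointwise_sum_fourier_series_of_summable hsum s).unique ?_
    have h := hasSum_single (f := fun i => fourierCoeff F i • fourier i s) 0 fun k hk => by
      rw [hcoef k hk, zero_smul]
    simpa using h
  have key : ∀ s ∈ Ico (0:ℝ) 1, v s = v 0 := fun s hs => by
    rw [← hFv s hs, ← hFv 0 ⟨le_rfl, one_pos⟩, hconst, hconst]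
  rcases ht.2.lt_or_eq with h | h
  · exact key t ⟨ht.1, h⟩
  · rw [h, h01]

variable {G : Type*} [NormedAddCommGroup G] [InnerProductSpace ℂ G]

theorem eq_of_fcoeff_eq_zero [CompleteSpace G] {v : ℝ → G} (hv : Continuous v) (h01 : v 0 = v 1)
    (hc : ∀ k : ℤ, k ≠ 0 → fcoeff v k = 0) {t : ℝ} (ht : t ∈ Icc (0:ℝ) 1) : v t = v 0 := by
  refine ext_inner_left ℂ fun w => ?_
  refine eq_of_fcoeff_eq_zero_complex (v := fun t => inner ℂ w (v t))
    (Continuous.inner continuous_const hv) (by simp only [h01]) (fun k hk => ?_) ht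
  have c : Continuous fun t => ez (-k) t • v t := (continuous_ez _).smul hv
  have h2 := (innerSL ℂ w).intervalIntegral_comp_comm (a := 0) (b := 1) (μ := volume)
    (c.intervalIntegrable 0 1)
  have h3 := hc k hk
  rw [fcoeff] at h3 ⊢
  simpa only [h3, map_zero, innerSL_apply_apply, inner_smul_right, smul_eq_mul] using h2

/-- Integration by parts for the Fourier coefficients of a `C¹` path vanishing at the end points. -/
theorem fcoeff_deriv [CompleteSpace G] {v v' : ℝ → G} (hv : ∀ t, HasDerivAt v (v' t) t)
    (hv' : Continuous v') (k : ℤ) :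
    fcoeff v' k = v 1 - v 0 + (2 * Real.pi * Complex.I * k : ℂ) • fcoeff v k := by
  have hvc : Continuous v := continuous_iff_continuousAt.2 fun t => (hv t).continuousAt
  have hd : ∀ t, HasDerivAt (fun t => ez (-k) t • v t)
      (ez (-k) t • v' t - (2 * Real.pi * Complex.I * k : ℂ) • (ez (-k) t • v t)) t := by
    intro t
    refine ((hasDerivAt_ez (-k) t).smul (hv t)).congr_deriv ?_
    rw [smul_smul, sub_eq_add_neg, ← neg_smul]; push_cast
    congr 2; ring
  have c1 : Continuous fun t => ez (-k) t • v' t := (continuous_ez _).smul hv'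
  have c2 : Continuous fun t => (2 * Real.pi * Complex.I * k : ℂ) • (ez (-k) t • v t) :=
    continuous_const.smul ((continuous_ez _).smul hvc)
  have h := intervalIntegral.integral_eq_sub_of_hasDerivAt (a := 0) (b := 1)
    (fun t _ => hd t) ((c1.sub c2).intervalIntegrable _ _)
  rw [intervalIntegral.integral_sub (c1.intervalIntegrable _ _) (c2.intervalIntegrable _ _),
    intervalIntegral.integral_smul] at h
  have h3 : ez (-k) 1 = 1 := by exact_mod_cast ez_int (-k) 1
  have h4 : ez (-k) 0 = 1 := by exact_mod_cast ez_int (-k) 0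
  rw [h3, h4, one_smul, one_smul] at h
  rw [fcoeff, fcoeff, ← h]; abel

/-- A continuous closed path solves `x' = i w` as soon as its Fourier coefficients do. -/
theorem eq_add_integral_of_fcoeff [CompleteSpace G] {x w : ℝ → G}
    (hx : Continuous x) (hw : Continuous w)
    (h01 : x 0 = x 1) (hc : ∀ k : ℤ, (2 * Real.pi * k : ℂ) • fcoeff x k = fcoeff w k)
    {t : ℝ} (ht : t ∈ Icc (0:ℝ) 1) :
    x t = x 0 + Complex.I • ∫ s in (0:ℝ)..t, w s := by
  set y : ℝ → G := fun t => Complex.I • ∫ s in (0:ℝ)..t, w s with hy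
  have hyd : ∀ t, HasDerivAt y (Complex.I • w t) t := fun t =>
    (intervalIntegral.integral_hasDerivAt_right (hw.intervalIntegrable _ _)
      (hw.stronglyMeasurableAtFilter _ _) hw.continuousAt).const_smul Complex.I
  have hyc : Continuous y := continuous_iff_continuousAt.2 fun t => (hyd t).continuousAt
  have hy0 : y 0 = 0 := by simp [hy]
  have hy1 : y 1 = 0 := by
    have h := hc 0
    simp only [Int.cast_zero, mul_zero, zero_smul, fcoeff, neg_zero, ez_zero, one_smul] at h
    simp [hy, ← h]
  have h := eq_of_fcoeff_eq_zero (v := fun t => x t - y t) (hx.sub hyc)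
    (by simp only [hy0, hy1, h01]) (fun k hk => ?_) ht
  · simp only [hy0, sub_zero] at h
    rw [← h]; simp only [hy]; abel
  · have h1 := fcoeff_deriv hyd (continuous_const.smul hw) k
    rw [hy0, hy1, sub_zero, zero_add] at h1
    have h2 : fcoeff (fun t => Complex.I • w t) k = Complex.I • fcoeff w k := by
      simp only [fcoeff, smul_comm _ Complex.I, intervalIntegral.integral_smul]
    have h3 : (2 * Real.pi * Complex.I * k : ℂ) ≠ 0 := by simp [Real.pi_ne_zero, hk]
    have h4 : fcoeff (fun t => x t - y t) k = fcoeff x k - fcoeff y k := by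
      simp only [fcoeff, smul_sub]
      have c1 : Continuous fun t => ez (-k) t • x t := (continuous_ez _).smul hx
      have c2 : Continuous fun t => ez (-k) t • y t := (continuous_ez _).smul hyc
      exact intervalIntegral.integral_sub (c1.intervalIntegrable _ _) (c2.intervalIntegrable _ _)
    rw [h4, sub_eq_zero]
    refine smul_right_injective G h3 ?_
    simp only []
    rw [← h1, h2, ← hc k, smul_smul]; congr 1; ring

end FourierUniqueness

section GalerkinLimit

variable {G : Type*} [NormedAddCommGroup G]

theorem exists_subseq_tendsto_path [ProperSpace G] {c : ℕ → ℝ → G} (hc : ∀ n, Continuous (c n))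
    {B : ℝ} (hcB : ∀ n, ∀ t ∈ Icc (0:ℝ) 1, ‖c n t‖ ≤ B)
    (hcm : ∀ n, ∀ η > 0, ∀ s t, 0 ≤ s → s ≤ t → t ≤ 1 → ‖c n t - c n s‖ ≤ B * η + (t - s) / η) :
    ∃ (f : ℝ → G) (φ : ℕ → ℕ), Continuous f ∧ StrictMono φ ∧
      ∀ t ∈ Icc (0:ℝ) 1, Tendsto (fun n => c (φ n) t) atTop (𝓝 (f t)) := by
  set F : ℕ → BoundedContinuousFunction (Icc (0:ℝ) 1) G := fun n =>
    BoundedContinuousFunction.mkOfCompact ⟨fun t => c n t, (hc n).comp continuous_subtype_val⟩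
    with hF
  have hmod : ∀ n, ∀ η > 0, ∀ s t : Icc (0:ℝ) 1,
      dist (c n s) (c n t) ≤ B * η + dist s t / η := by
    intro n η hη s t
    rcases le_total (s:ℝ) t with h | h
    · rw [dist_comm, dist_eq_norm, dist_comm s t, Subtype.dist_eq, Real.dist_eq,
        abs_of_nonneg (sub_nonneg.2 h)]
      exact hcm n η hη s t s.2.1 h t.2.2
    · rw [dist_eq_norm, Subtype.dist_eq, Real.dist_eq, abs_of_nonneg (sub_nonneg.2 h)]
      exact hcm n η hη t s t.2.1 h s.2.2
  have hcomp := BoundedContinuousFunction.arzela_ascoli (closedBall (0:G) B)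
    (isCompact_closedBall _ _) (range F) (by
      rintro _ t ⟨n, rfl⟩
      rw [mem_closedBall_zero_iff]; exact hcB n t t.2) (by
      refine Metric.equicontinuous_of_continuity_modulus
        (fun r => B * Real.sqrt r + r / Real.sqrt r) ?_ _ ?_
      · have h : (fun r : ℝ => B * Real.sqrt r + r / Real.sqrt r)
            = fun r => B * Real.sqrt r + Real.sqrt r := by
          ext r; rw [Real.div_sqrt]
        rw [h]
        have : Continuous fun r : ℝ => B * Real.sqrt r + Real.sqrt r := by fun_prop
        simpa using this.tendsto 0
      · rintro s t ⟨_, n, rfl⟩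
        rcases eq_or_ne s t with h | h
        · subst h; simp
        · exact hmod n _ (Real.sqrt_pos.2 (dist_pos.2 h)) s t)
  obtain ⟨f, -, φ, hφ, hlim⟩ := hcomp.tendsto_subseq (x := F)
    fun n => subset_closure (mem_range_self n)
  refine ⟨IccExtend zero_le_one f, φ, f.continuous.Icc_extend', hφ, fun t ht => ?_⟩
  rw [IccExtend_of_mem zero_le_one _ ht]
  exact ((continuous_eval_const (F := BoundedContinuousFunction (Icc (0:ℝ) 1) G)
    (⟨t, ht⟩ : Icc (0:ℝ) 1)).tendsto f).comp hlim

theorem tendsto_integral_comp_path [ProperSpace G] {G' : Type*} [NormedAddCommGroup G']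
    [NormedSpace ℝ G'] {c : ℕ → ℝ → G} (hc : ∀ n, Continuous (c n)) {B : ℝ}
    (hcB : ∀ n, ∀ t ∈ Icc (0:ℝ) 1, ‖c n t‖ ≤ B) {f : ℝ → G}
    (hlim : ∀ t ∈ Icc (0:ℝ) 1, Tendsto (fun n => c n t) atTop (𝓝 (f t)))
    {Φ : ℝ × G → G'} (hΦ : Continuous Φ) :
    Tendsto (fun n => ∫ t in (0:ℝ)..1, Φ (t, c n t)) atTop (𝓝 (∫ t in (0:ℝ)..1, Φ (t, f t))) := by
  obtain ⟨K, hK⟩ := ((isCompact_Icc (a := (0:ℝ)) (b := 1)).prod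
    (isCompact_closedBall (0:G) B)).exists_bound_of_continuousOn hΦ.continuousOn
  refine intervalIntegral.tendsto_integral_filter_of_dominated_convergence (fun _ => K) ?_ ?_ ?_ ?_
  · refine Eventually.of_forall fun n => ?_
    have : Continuous fun t => Φ (t, c n t) := hΦ.comp (continuous_id.prodMk (hc n))
    exact this.aestronglyMeasurable
  · refine Eventually.of_forall fun n => Eventually.of_forall fun t ht => ?_
    rw [uIoc_of_le zero_le_one] at ht
    have ht' := Ioc_subset_Icc_self ht
    exact hK _ ⟨ht', by rw [mem_closedBall_zero_iff]; exact hcB n t ht'⟩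
  · exact intervalIntegrable_const
  · refine Eventually.of_forall fun t ht => ?_
    rw [uIoc_of_le zero_le_one] at ht
    exact (hΦ.tendsto _).comp
      (tendsto_const_nhds.prodMk_nhds (hlim t (Ioc_subset_Icc_self ht)))

variable [InnerProductSpace ℂ G]

/-- The critical value expressed through the gradient at an approximately critical point. -/
theorem galAction_le [FiniteDimensional ℂ G] (e : G) (ν κ b : ℝ) {h : G → ℝ} {gh : G → G}
    (hgc : Continuous gh) {S : Finset ℤ} {x : S → G} {δ B : ℝ} (hδ : 0 < δ)
    (hg : ∑ k, ‖galGrad e ν κ gh x k‖ ^ 2 ≤ δ ^ 2) (hx : ∑ k, ‖x k‖ ^ 2 ≤ B ^ 2) :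
    galAction e ν κ b h x ≤ δ * (1 + B ^ 2) / 4
      + (1 / 2 * (∫ t in (0:ℝ)..1, ⟪gh (trig (Subtype.val : S → ℤ) x t),
          trig (Subtype.val : S → ℤ) x t⟫) - b
        - ∫ t in (0:ℝ)..1, h (trig (Subtype.val : S → ℤ) x t)) := by
  have hcomp : CompleteSpace G := FiniteDimensional.complete ℂ G
  have hcont := continuous_trig (Subtype.val : S → ℤ) x
  have h1 := integral_real_inner_trig (Subtype.val : S → ℤ)
    (fun t => gh (trig (Subtype.val : S → ℤ) x t)) (hgc.comp hcont) x
  have h2 : ∀ k : S, Real.pi * (k : ℤ) * ‖x k‖ ^ 2 - κ * diagForm e ν (x k)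
      = 1 / 2 * ⟪galGrad e ν κ gh x k, x k⟫
        + 1 / 2 * ⟪fcoeff (fun t => gh (trig (Subtype.val : S → ℤ) x t)) k, x k⟫ := by
    intro k
    rw [galGrad, inner_sub_left, inner_sub_left, real_inner_smul_left, real_inner_smul_left,
      real_inner_self_eq_norm_sq, diagForm_eq]
    ring
  have h3 : ∑ k, ⟪galGrad e ν κ gh x k, x k⟫ ≤ δ * (1 + B ^ 2) / 2 := by
    calc ∑ k, ⟪galGrad e ν κ gh x k, x k⟫
        ≤ ∑ k, (1 / (2 * δ) * ‖galGrad e ν κ gh x k‖ ^ 2 + δ / 2 * ‖x k‖ ^ 2) := by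
          refine Finset.sum_le_sum fun k _ => (real_inner_le_norm _ _).trans ?_
          set a := ‖galGrad e ν κ gh x k‖
          set c := ‖x k‖
          have : 1 / (2 * δ) * a ^ 2 + δ / 2 * c ^ 2 - a * c = (a - δ * c) ^ 2 / (2 * δ) := by
            field_simp; ring
          have : 0 ≤ (a - δ * c) ^ 2 / (2 * δ) := by positivity
          linarith
      _ = 1 / (2 * δ) * ∑ k, ‖galGrad e ν κ gh x k‖ ^ 2 + δ / 2 * ∑ k, ‖x k‖ ^ 2 := by
          rw [Finset.sum_add_distrib, Finset.mul_sum, Finset.mul_sum]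
      _ ≤ 1 / (2 * δ) * δ ^ 2 + δ / 2 * B ^ 2 := by gcongr
      _ = _ := by field_simp
  rw [galAction, Finset.sum_congr rfl fun k _ => h2 k, Finset.sum_add_distrib, ← Finset.mul_sum,
    ← Finset.mul_sum, h1]
  linarith

/-- Existence of a closed orbit of positive action for a Hamiltonian that is a bounded perturbation
of a nonresonant quadratic form and vanishes to fourth order at the origin. -/
theorem exists_closed_orbit [FiniteDimensional ℂ G] {e : G} (he : ‖e‖ = 1) {ν κ : ℝ} (hν : 0 < ν)
    (hν1 : ν < 1 / 2) (hκ : Real.pi < κ) (hκ2 : κ < 2 * Real.pi) (b : ℝ) {h : G → ℝ} {gh : G → G}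
    (hh : ∀ z, HasFDerivAt h (innerSL ℝ (gh z)) z) (hgu : UniformContinuous gh)
    {M : ℝ} (hM : ∀ z, ‖gh z‖ ≤ M) {Mh : ℝ} (hMh : ∀ z, |h z| ≤ Mh)
    (hpos : ∀ z, 0 ≤ κ * diagForm e ν z + b + h z)
    {C₄ : ℝ} (hC₄ : 0 < C₄) (hH4 : ∀ z, κ * diagForm e ν z + b + h z ≤ C₄ * ‖z‖ ^ 4) :
    ∃ x : ℝ → G, Continuous x ∧ x 0 = x 1 ∧
      (∀ t ∈ Icc (0:ℝ) 1,
        HasDerivAt x (Complex.I • ((2 * κ) • diagOp e ν (x t) + gh (x t))) t) ∧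
      0 < 1 / 2 * (∫ t in (0:ℝ)..1, ⟪gh (x t), x t⟫) - b - ∫ t in (0:ℝ)..1, h (x t) := by
  have hcomp : CompleteSpace G := FiniteDimensional.complete ℂ G
  have hprop : ProperSpace G := FiniteDimensional.proper ℂ G
  have hgc := hgu.continuous
  have hhc : Continuous h := continuous_iff_continuousAt.2 fun z => (hh z).continuousAt
  obtain ⟨B, hB, hbd⟩ := exists_galerkin_bounds he hν hν1 hκ hκ2 hgc hM
  set S : ℕ → Finset ℤ := fun N => Finset.Icc (-(N + 1 : ℤ)) (N + 1) with hS
  set δ : ℕ → ℝ := fun N => 1 / ((N : ℝ) + 1) with hδd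
  have hδ : ∀ N, 0 < δ N := fun N => Nat.one_div_pos_of_nat
  have hδ1 : ∀ N, δ N ≤ 1 := fun N => by
    rw [hδd]; simp only []; rw [div_le_one (by positivity)]
    linarith [(Nat.cast_nonneg N : (0:ℝ) ≤ N)]
  have hδ0 : Tendsto δ atTop (𝓝 0) := tendsto_one_div_add_atTop_nhds_zero_nat
  choose X hX1 hX2 using fun N => exists_galGrad_le he hν (by linarith) hκ b hh hgu hMh hpos hC₄ hH4
    (S N) (by simp only [hS, Finset.mem_Icc]; constructor <;>
      linarith [(Nat.cast_nonneg N : (0:ℤ) ≤ N)])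
    (δ N) (hδ N)
  have hX3 := fun N => hbd (S N) (X N) ((hX1 N).trans (pow_le_one₀ (hδ N).le (hδ1 N)))
  set c : ℕ → ℝ → G := fun N => trig (Subtype.val : S N → ℤ) (X N) with hc
  have hcc : ∀ N, Continuous (c N) := fun N => continuous_trig _ _
  obtain ⟨f, φ, hf, hφ, hlim⟩ := exists_subseq_tendsto_path hcc (fun N => (hX3 N).2.2.1)
    (fun N => (hX3 N).2.2.2)
  have hφt := hφ.tendsto_atTop
  have hlimint : ∀ {Φ : ℝ × G → G}
      (_ : Continuous Φ), Tendsto (fun n => ∫ t in (0:ℝ)..1, Φ (t, c (φ n) t)) atTop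
        (𝓝 (∫ t in (0:ℝ)..1, Φ (t, f t))) := fun hΦ =>
    tendsto_integral_comp_path (fun n => hcc (φ n)) (fun n => (hX3 (φ n)).2.2.1) hlim hΦ
  have hlimint' : ∀ {Φ : ℝ × G → ℝ}
      (_ : Continuous Φ), Tendsto (fun n => ∫ t in (0:ℝ)..1, Φ (t, c (φ n) t)) atTop
        (𝓝 (∫ t in (0:ℝ)..1, Φ (t, f t))) := fun hΦ =>
    tendsto_integral_comp_path (fun n => hcc (φ n)) (fun n => (hX3 (φ n)).2.2.1) hlim hΦ
  have hf01 : f 0 = f 1 := by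
    refine tendsto_nhds_unique (hlim 0 ⟨le_rfl, zero_le_one⟩) ?_
    refine (hlim 1 ⟨zero_le_one, le_rfl⟩).congr fun n => ?_
    simp only [hc, trig]
    refine Finset.sum_congr rfl fun i _ => ?_
    have h3 : ez i 1 = 1 := by exact_mod_cast ez_int i 1
    have h4 : ez i 0 = 1 := by exact_mod_cast ez_int i 0
    rw [h3, h4]
  set w : ℝ → G := fun t => (2 * κ) • diagOp e ν (f t) + gh (f t) with hw
  have hQc : Continuous (diagOp e ν) := (diagOp e ν).continuous
  have hwc : Continuous w := ((hQc.comp hf).const_smul _).add (hgc.comp hf)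
  have hcoef : ∀ k : ℤ, (2 * Real.pi * k : ℂ) • fcoeff f k = fcoeff w k := by
    intro k
    have hl1 : Tendsto (fun n => fcoeff (c (φ n)) k) atTop (𝓝 (fcoeff f k)) :=
      hlimint (Φ := fun p => ez (-k) p.1 • p.2)
        (((continuous_ez _).comp continuous_fst).smul continuous_snd)
    have hl2 : Tendsto (fun n => fcoeff (fun t => gh (c (φ n) t)) k) atTop
        (𝓝 (fcoeff (fun t => gh (f t)) k)) :=
      hlimint (Φ := fun p => ez (-k) p.1 • gh p.2)
        (((continuous_ez _).comp continuous_fst).smul (hgc.comp continuous_snd))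
    have hl3 : Tendsto (fun n => (2 * Real.pi * k) • fcoeff (c (φ n)) k
        - (2 * κ) • diagOp e ν (fcoeff (c (φ n)) k) - fcoeff (fun t => gh (c (φ n) t)) k) atTop
        (𝓝 ((2 * Real.pi * k) • fcoeff f k - (2 * κ) • diagOp e ν (fcoeff f k)
          - fcoeff (fun t => gh (f t)) k)) :=
      ((hl1.const_smul _).sub (((hQc.tendsto _).comp hl1).const_smul _)).sub hl2
    have hl4 : Tendsto (fun n => (2 * Real.pi * k) • fcoeff (c (φ n)) k
        - (2 * κ) • diagOp e ν (fcoeff (c (φ n)) k) - fcoeff (fun t => gh (c (φ n) t)) k) atTop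
        (𝓝 0) := by
      refine squeeze_zero_norm' ?_ (hδ0.comp hφt)
      filter_upwards [hφt.eventually_ge_atTop k.natAbs] with n hn
      have hk : k ∈ S (φ n) := by simp only [hS, Finset.mem_Icc]; omega
      have e1 : fcoeff (c (φ n)) k = X (φ n) ⟨k, hk⟩ :=
        fcoeff_trig (Subtype.val : S (φ n) → ℤ) Subtype.val_injective (X (φ n)) ⟨k, hk⟩
      have e2 := Finset.single_le_sum
        (f := fun k => ‖galGrad e ν κ gh (X (φ n)) k‖ ^ 2) (fun _ _ => sq_nonneg _)
        (Finset.mem_univ (⟨k, hk⟩ : S (φ n)))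
      have e3 := abs_le_of_sq_le_sq (e2.trans (hX1 (φ n))) (hδ _).le
      rw [abs_of_nonneg (norm_nonneg _)] at e3
      rw [e1]; exact e3
    have heq := tendsto_nhds_unique hl3 hl4
    have hfw : fcoeff w k = (2 * κ) • diagOp e ν (fcoeff f k) + fcoeff (fun t => gh (f t)) k := by
      have c1 : Continuous fun t => ez (-k) t • f t := (continuous_ez _).smul hf
      have c2 : Continuous fun t => (2 * κ) • diagOp e ν (ez (-k) t • f t) :=
        (hQc.comp c1).const_smul _
      have c3 : Continuous fun t => ez (-k) t • gh (f t) := (continuous_ez _).smul (hgc.comp hf)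
      have e1 := (diagOp e ν).intervalIntegral_comp_comm (a := 0) (b := 1) (μ := volume)
        (c1.intervalIntegrable 0 1)
      rw [fcoeff, fcoeff, fcoeff, ← e1, ← intervalIntegral.integral_smul,
        ← intervalIntegral.integral_add (c2.intervalIntegrable _ _) (c3.intervalIntegrable _ _)]
      refine intervalIntegral.integral_congr fun t _ => ?_
      simp only [hw, smul_add, map_smul]
      rw [smul_comm]
    rw [hfw, ← sub_eq_zero, ← heq, ← sub_sub]
    congr 2
    rw [← Complex.coe_smul]; push_cast; rfl
  set x : ℝ → G := fun t => f 0 + Complex.I • ∫ s in (0:ℝ)..t, w (projIcc 0 1 zero_le_one s) with hx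
  have hwp : Continuous fun s : ℝ => w (projIcc 0 1 zero_le_one s) :=
    hwc.comp (continuous_subtype_val.comp continuous_projIcc)
  have hxd : ∀ t, HasDerivAt x (Complex.I • w (projIcc 0 1 zero_le_one t)) t := by
    intro t
    have h1 : HasDerivAt (fun t => ∫ s in (0:ℝ)..t, w (projIcc 0 1 zero_le_one s))
        (w (projIcc 0 1 zero_le_one t)) t :=
      intervalIntegral.integral_hasDerivAt_right (hwp.intervalIntegrable _ _)
        (hwp.stronglyMeasurableAtFilter _ _) hwp.continuousAt
    exact HasDerivAt.const_add (f 0) (h1.const_smul Complex.I)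
  have hxf : ∀ t ∈ Icc (0:ℝ) 1, x t = f t := by
    intro t ht
    have h1 : ∫ s in (0:ℝ)..t, w (projIcc 0 1 zero_le_one s) = ∫ s in (0:ℝ)..t, w s := by
      refine intervalIntegral.integral_congr fun s hs => ?_
      rw [uIcc_of_le ht.1] at hs
      simp only [projIcc_of_mem zero_le_one (⟨hs.1, hs.2.trans ht.2⟩ : s ∈ Icc (0:ℝ) 1)]
    rw [eq_add_integral_of_fcoeff hf hwc hf01 hcoef ht, hx, ← h1]
  have hu : ∀ t ∈ uIcc (0:ℝ) 1, x t = f t := by rwa [uIcc_of_le zero_le_one]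
  refine ⟨x, continuous_iff_continuousAt.2 fun t => (hxd t).continuousAt, ?_, fun t ht => ?_, ?_⟩
  · rw [hxf 0 ⟨le_rfl, zero_le_one⟩, hxf 1 ⟨zero_le_one, le_rfl⟩, hf01]
  · have := hxd t
    rw [projIcc_of_mem zero_le_one ht] at this
    rw [hxf t ht]; exact this
  · have r1 : ∫ t in (0:ℝ)..1, ⟪gh (x t), x t⟫ = ∫ t in (0:ℝ)..1, ⟪gh (f t), f t⟫ :=
      intervalIntegral.integral_congr fun t ht => by simp only [hu t ht]
    have r2 : ∫ t in (0:ℝ)..1, h (x t) = ∫ t in (0:ℝ)..1, h (f t) :=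
      intervalIntegral.integral_congr fun t ht => by simp only [hu t ht]
    rw [r1, r2]
    have l1 := hlimint' (Φ := fun p : ℝ × G => ⟪gh p.2, p.2⟫)
      ((hgc.comp continuous_snd).inner continuous_snd)
    have l2 := hlimint' (Φ := fun p : ℝ × G => h p.2) (hhc.comp continuous_snd)
    have l3 := (((hδ0.comp hφt).mul_const (1 + B ^ 2)).div_const 4).add
      (((l1.const_mul (1 / 2)).sub_const b).sub l2)
    have hpos' : 0 < Real.pi ^ 2 / (8 * C₄) := by positivity
    simp only [zero_mul, zero_div, zero_add] at l3
    exact hpos'.trans_le (ge_of_tendsto' l3 fun n =>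
      (hX2 (φ n)).trans (galAction_le e ν κ b hgc (hδ _) (hX1 (φ n)) (hX3 (φ n)).2.1))

end GalerkinLimit

section Profiles

theorem hasDerivAt_sq_max_zero (s : ℝ) :
    HasDerivAt (fun s : ℝ => (max 0 s) ^ 2) (2 * max 0 s) s := by
  rcases lt_trichotomy s 0 with h | h | h
  · have : (fun s : ℝ => (max 0 s) ^ 2) =ᶠ[𝓝 s] fun _ => 0 := by
      filter_upwards [gt_mem_nhds h] with t ht
      rw [max_eq_left (le_of_lt ht)]; norm_num
    rw [max_eq_left h.le, mul_zero]
    exact (hasDerivAt_const s (0:ℝ)).congr_of_eventuallyEq this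
  · subst h
    rw [max_self, mul_zero]
    refine HasDerivAt.congr_deriv (f' := 0) ?_ rfl
    rw [hasDerivAt_iff_isLittleO_nhds_zero]
    have h1 : (fun h : ℝ => h ^ 2) =o[𝓝 0] fun h => h := by
      simpa using Asymptotics.isLittleO_pow_id (𝕜 := ℝ) one_lt_two
    refine Asymptotics.IsBigO.trans_isLittleO (Asymptotics.IsBigO.of_bound 1 ?_) h1
    refine Eventually.of_forall fun t => ?_
    simp only [zero_add, max_self, smul_zero, sub_zero, one_mul, norm_pow, Real.norm_eq_abs, sq_abs]
    rw [zero_pow two_ne_zero, sub_zero, abs_of_nonneg (sq_nonneg (max 0 t))]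
    rcases le_total 0 t with h | h
    · rw [max_eq_right h]
    · rw [max_eq_left h, zero_pow two_ne_zero]; positivity
  · have : (fun s : ℝ => (max 0 s) ^ 2) =ᶠ[𝓝 s] fun s => s ^ 2 := by
      filter_upwards [lt_mem_nhds h] with t ht
      rw [max_eq_right (le_of_lt ht)]
    rw [max_eq_right h.le]
    refine HasDerivAt.congr_of_eventuallyEq ?_ this
    simpa using hasDerivAt_pow 2 s

theorem hasDerivAt_sq_max_sub (c s : ℝ) :
    HasDerivAt (fun s : ℝ => (max 0 (s - c)) ^ 2) (2 * max 0 (s - c)) s := by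
  have h := (hasDerivAt_sq_max_zero (s - c)).comp_sub_const s c
  exact h

/-- A slowly increasing step: slope below `π`, but total height above `π`. -/
theorem exists_inner_profile {a : ℝ} (ha : 1 < a) :
    ∃ (f f' : ℝ → ℝ) (m η : ℝ), (∀ s, HasDerivAt f (f' s) s) ∧ Continuous f' ∧
      (∀ s, 0 ≤ f' s) ∧ (∀ s, f' s < Real.pi) ∧ (∀ s, a ≤ s → f' s = 0 ∧ f s = m) ∧
      0 < η ∧ (∀ s, s ≤ η → f s = 0) ∧ (∀ s, 0 ≤ f s) ∧ (∀ s, f s ≤ m) ∧ Real.pi < m := by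
  have hπ := Real.pi_pos
  obtain ⟨η, hη, hη1, hηa2, hηa⟩ :
      ∃ η > 0, η < 1 ∧ 3 * η ≤ a ∧ 1 < (1 - η) * (a - 2 * η) := by
    obtain ⟨b, hb⟩ : ∃ b, b = 1 / a := ⟨_, rfl⟩
    have h2 : a * b = 1 := by rw [hb]; field_simp
    have h4 : 0 < b := by rw [hb]; positivity
    have h5 : b < 1 := by rw [hb, div_lt_one (by linarith)]; exact ha
    refine ⟨(1 - b) / 4, by linarith, by linarith, by linarith, ?_⟩
    nlinarith
  set k : ℝ := Real.pi * (1 - η) / (2 * η) with hk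
  have hkη : 2 * k * η = Real.pi * (1 - η) := by rw [hk]; field_simp
  have hk0 : 0 < k := by rw [hk]; apply div_pos; apply mul_pos hπ; linarith; linarith
  set f : ℝ → ℝ := fun s => k * ((max 0 (s - η)) ^ 2 - (max 0 (s - 2 * η)) ^ 2
    - (max 0 (s - (a - η))) ^ 2 + (max 0 (s - a)) ^ 2) with hf
  set f' : ℝ → ℝ := fun s => k * (2 * max 0 (s - η) - 2 * max 0 (s - 2 * η)
    - 2 * max 0 (s - (a - η)) + 2 * max 0 (s - a)) with hf'
  have hd : ∀ s, HasDerivAt f (f' s) s := fun s =>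
    ((((hasDerivAt_sq_max_sub η s).sub (hasDerivAt_sq_max_sub (2 * η) s)).sub
      (hasDerivAt_sq_max_sub (a - η) s)).add (hasDerivAt_sq_max_sub a s)).const_mul k
  have hnn : ∀ s, 0 ≤ f' s := by
    intro s
    refine mul_nonneg hk0.le ?_
    simp only [max_def]; split_ifs <;> linarith
  have hlo : ∀ s, s ≤ η → f s = 0 := by
    intro s hs
    simp only [hf]
    rw [max_eq_left (by linarith), max_eq_left (by linarith), max_eq_left (by linarith),
      max_eq_left (by linarith)]; ring
  have hhi : ∀ s, a ≤ s → f s = Real.pi * (1 - η) * (a - 2 * η) := by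
    intro s hs
    simp only [hf]
    rw [max_eq_right (by linarith), max_eq_right (by linarith), max_eq_right (by linarith),
      max_eq_right (by linarith), ← hkη]; ring
  have hmono : Monotone f := monotone_of_hasDerivAt_nonneg hd hnn
  refine ⟨f, f', Real.pi * (1 - η) * (a - 2 * η), η, hd, by fun_prop, hnn, fun s => ?_,
    fun s hs => ⟨?_, hhi s hs⟩, hη, hlo, fun s => ?_, fun s => ?_, ?_⟩
  · have : f' s ≤ 2 * k * η := by
      have h : 2 * max 0 (s - η) - 2 * max 0 (s - 2 * η)
          - 2 * max 0 (s - (a - η)) + 2 * max 0 (s - a) ≤ 2 * η := by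
        simp only [max_def]; split_ifs <;> linarith
      calc f' s ≤ k * (2 * η) := mul_le_mul_of_nonneg_left h hk0.le
        _ = _ := by ring
    rw [hkη] at this
    nlinarith
  · simp only [hf']
    rw [max_eq_right (by linarith), max_eq_right (by linarith), max_eq_right (by linarith),
      max_eq_right (by linarith)]; ring
  · rcases le_total s η with h | h
    · rw [hlo s h]
    · rw [← hlo η le_rfl]; exact hmono h
  · rcases le_total a s with h | h
    · rw [hhi s h]
    · rw [← hhi a le_rfl]; exact hmono h
  · rw [mul_assoc]
    nlinarith

/-- A profile constant up to `1` and linear at infinity, with nonnegative Legendre defect. -/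
theorem exists_outer_profile {κ m : ℝ} (hκ : 0 < κ) (hm : κ < m) :
    ∃ (f f' : ℝ → ℝ) (σ : ℝ), (∀ s, HasDerivAt f (f' s) s) ∧ Continuous f' ∧
      (∀ s, s ≤ 1 → f s = m ∧ f' s = 0) ∧ (∀ s, σ ≤ s → f s = κ * s ∧ f' s = κ) ∧
      (∀ s, m ≤ f s) ∧ (∀ s, 0 ≤ s → f' s * s ≤ f s) := by
  set η : ℝ := 2 * (m - κ) / κ with hη
  have hη0 : 0 < η := by rw [hη]; apply div_pos <;> linarith
  have hκη : κ * η = 2 * (m - κ) := by rw [hη]; field_simp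
  set k : ℝ := κ / (2 * η) with hk
  have hk0 : 0 < k := by positivity
  have hkη : 2 * k * η = κ := by rw [hk]; field_simp
  have hkη2 : k * η ^ 2 = m - κ := by
    have : 2 * (k * η ^ 2) = κ * η := by rw [← hkη]; ring
    linarith
  set f : ℝ → ℝ := fun s => m + k * ((max 0 (s - 1)) ^ 2 - (max 0 (s - (1 + η))) ^ 2) with hf
  set f' : ℝ → ℝ := fun s => k * (2 * max 0 (s - 1) - 2 * max 0 (s - (1 + η))) with hf'
  have hd : ∀ s, HasDerivAt f (f' s) s := fun s =>
    (((hasDerivAt_sq_max_sub 1 s).sub (hasDerivAt_sq_max_sub (1 + η) s)).const_mul k).const_add m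
  have hlo : ∀ s, s ≤ 1 → f s = m ∧ f' s = 0 := by
    intro s hs
    simp only [hf, hf']
    rw [max_eq_left (by linarith), max_eq_left (by linarith)]; constructor <;> ring
  have hhi : ∀ s, 1 + η ≤ s → f s = κ * s ∧ f' s = κ := by
    intro s hs
    simp only [hf, hf']
    rw [max_eq_right (by linarith), max_eq_right (by linarith)]
    constructor
    · have : m + k * ((s - 1) ^ 2 - (s - (1 + η)) ^ 2)
          = m + (2 * k * η) * (s - 1) - k * η ^ 2 := by ring
      rw [this, hkη, hkη2]; ring
    · rw [← hkη]; ring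
  have hnn : ∀ s, 0 ≤ f' s := by
    intro s
    refine mul_nonneg hk0.le ?_
    simp only [max_def]; split_ifs <;> linarith
  have hmono : Monotone f := monotone_of_hasDerivAt_nonneg hd hnn
  refine ⟨f, f', 1 + η, hd, by fun_prop, hlo, hhi, fun s => ?_, fun s hs => ?_⟩
  · rcases le_total s 1 with h | h
    · rw [(hlo s h).1]
    · rw [← (hlo 1 le_rfl).1]; exact hmono h
  · rcases le_total s 1 with h | h
    · rw [(hlo s h).1, (hlo s h).2]; linarith
    · rcases le_total (1 + η) s with h' | h'
      · rw [(hhi s h').1, (hhi s h').2]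
      · simp only [hf, hf']
        rw [max_eq_right (by linarith), max_eq_left (by linarith)]
        have h1 : k * (s ^ 2 - 1) ≤ m := by
          have : k * (s ^ 2 - 1) ≤ k * ((1 + η) ^ 2 - 1) := by gcongr
          have h2 : k * ((1 + η) ^ 2 - 1) = 2 * k * η + k * η ^ 2 := by ring
          rw [h2, hkη, hkη2] at this; linarith
        nlinarith

end Profiles

section SymplecticMaps

variable {G : Type*} [NormedAddCommGroup G] [InnerProductSpace ℂ G]

/-- The symplectic form of a complex inner product space. -/
def sform (u v : G) : ℝ := (inner ℂ v u).im

theorem sform_eq_inner (u v : G) : sform u v = ⟪-(Complex.I • u), v⟫ := by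
  have h := congrArg Complex.im (inner_conj_symm v u)
  rw [Complex.conj_im] at h
  rw [sform, real_inner_eq_re, inner_neg_left, inner_smul_left, ← h]
  simp

theorem sform_swap (u v : G) : sform u v = -sform v u := by
  rw [sform, sform, ← inner_conj_symm v u, Complex.conj_im]

theorem sform_self (u : G) : sform u u = 0 := by
  have := sform_swap u u; linarith

theorem sform_add_right (u v w : G) : sform u (v + w) = sform u v + sform u w := by
  simp only [sform_eq_inner, inner_add_right]

theorem sform_smul_right (c : ℝ) (u v : G) : sform u (c • v) = c * sform u v := by
  simp only [sform_eq_inner, real_inner_smul_right]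

theorem sform_add_left (u v w : G) : sform (u + v) w = sform u w + sform v w := by
  rw [sform_swap, sform_add_right, sform_swap w u, sform_swap w v]; ring

theorem sform_smul_left (c : ℝ) (u v : G) : sform (c • u) v = c * sform u v := by
  rw [sform_swap, sform_smul_right, sform_swap v u]; ring

theorem sform_I_smul_left (u v : G) : sform (Complex.I • u) v = ⟪u, v⟫ := by
  rw [sform_eq_inner, smul_smul, Complex.I_mul_I, neg_one_smul, neg_neg]

theorem sform_I_smul_right (u v : G) : sform u (Complex.I • v) = -⟪u, v⟫ := by
  rw [sform_swap, sform_I_smul_left, real_inner_comm]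

theorem sform_nondegenerate {u : G} (h : ∀ v, sform u v = 0) : u = 0 := by
  have := h (Complex.I • u)
  rw [sform_I_smul_right, neg_eq_zero, inner_self_eq_zero] at this
  exact this

theorem injective_of_sform {A : G →L[ℝ] G} (hA : ∀ u v, sform (A u) (A v) = sform u v) :
    Function.Injective A := by
  refine (injective_iff_map_eq_zero A).2 fun u hu => sform_nondegenerate fun v => ?_
  rw [← hA, hu, sform_swap, sform_eq_inner, inner_zero_right, neg_zero]

/-- An injective linear endomorphism in finite dimension, as an equivalence. -/
theorem exists_equiv_of_injective [FiniteDimensional ℂ G] {A : G →L[ℝ] G}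
    (hA : Function.Injective A) : ∃ L : G ≃L[ℝ] G, (L : G →L[ℝ] G) = A := by
  have hfd : FiniteDimensional ℝ G := FiniteDimensional.complexToReal G
  exact ⟨(LinearEquiv.ofInjectiveEndo (A : G →ₗ[ℝ] G) hA).toContinuousLinearEquiv, by ext; rfl⟩

/-- `ψ` is an injective `C¹` symplectic map on the ball of radius `ρ`. -/
structure SymplEmbOn (ψ : G → G) (ρ : ℝ) : Prop where
  contDiffOn : ContDiffOn ℝ 1 ψ (ball 0 ρ)
  injOn : InjOn ψ (ball 0 ρ)
  sympl : ∀ z ∈ ball (0:G) ρ, ∀ u v, sform (fderiv ℝ ψ z u) (fderiv ℝ ψ z v) = sform u v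

namespace SymplEmbOn

variable {ψ : G → G} {ρ : ℝ}

theorem exists_hasStrictFDerivAt [FiniteDimensional ℂ G] (h : SymplEmbOn ψ ρ) {y : G}
    (hy : y ∈ ball (0:G) ρ) :
    ∃ L : G ≃L[ℝ] G, (L : G →L[ℝ] G) = fderiv ℝ ψ y ∧ HasStrictFDerivAt ψ (L : G →L[ℝ] G) y := by
  obtain ⟨L, hL⟩ := exists_equiv_of_injective (injective_of_sform (h.sympl y hy))
  refine ⟨L, hL, ?_⟩
  rw [hL]
  exact (h.contDiffOn.contDiffAt (isOpen_ball.mem_nhds hy)).hasStrictFDerivAt one_ne_zero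

theorem map_nhds [FiniteDimensional ℂ G] (h : SymplEmbOn ψ ρ) {y : G} (hy : y ∈ ball (0:G) ρ) :
    map ψ (𝓝 y) = 𝓝 (ψ y) := by
  have hcomp : CompleteSpace G := FiniteDimensional.complete ℂ G
  obtain ⟨L, -, hL⟩ := h.exists_hasStrictFDerivAt hy
  exact hL.map_nhds_eq_of_equiv

theorem image_mem_nhds [FiniteDimensional ℂ G] (h : SymplEmbOn ψ ρ) {y : G}
    (hy : y ∈ ball (0:G) ρ) : ψ '' ball 0 ρ ∈ 𝓝 (ψ y) := by
  rw [← h.map_nhds hy]; exact image_mem_map (isOpen_ball.mem_nhds hy)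

variable (ψ ρ) in
/-- The inverse of `ψ` on the image of the ball. -/
def inv (z : G) : G := Function.invFunOn ψ (ball 0 ρ) z

theorem inv_apply (h : SymplEmbOn ψ ρ) {y : G} (hy : y ∈ ball (0:G) ρ) : inv ψ ρ (ψ y) = y :=
  h.injOn.leftInvOn_invFunOn hy

theorem inv_tendsto [FiniteDimensional ℂ G] (h : SymplEmbOn ψ ρ) {y : G} (hy : y ∈ ball (0:G) ρ) :
    Tendsto (inv ψ ρ) (𝓝 (ψ y)) (𝓝 y) := by
  rw [← h.map_nhds hy, tendsto_map'_iff]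
  refine tendsto_id.congr' ?_
  filter_upwards [isOpen_ball.mem_nhds hy] with x hx
  exact (h.inv_apply hx).symm

theorem eventually_right_inv [FiniteDimensional ℂ G] (h : SymplEmbOn ψ ρ) {y : G}
    (hy : y ∈ ball (0:G) ρ) : ∀ᶠ z in 𝓝 (ψ y), ψ (inv ψ ρ z) = z := by
  filter_upwards [h.image_mem_nhds hy]
  rintro _ ⟨x, hx, rfl⟩
  rw [h.inv_apply hx]

theorem hasFDerivAt_inv [FiniteDimensional ℂ G] (h : SymplEmbOn ψ ρ) {y : G}
    (hy : y ∈ ball (0:G) ρ) {L : G ≃L[ℝ] G} (hL : (L : G →L[ℝ] G) = fderiv ℝ ψ y) :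
    HasFDerivAt (inv ψ ρ) (L.symm : G →L[ℝ] G) (ψ y) := by
  obtain ⟨L', hL', hd⟩ := h.exists_hasStrictFDerivAt hy
  refine HasFDerivAt.of_local_left_inverse (f := ψ) ?_ ?_ (h.eventually_right_inv hy)
  · rw [ContinuousAt, h.inv_apply hy]; exact h.inv_tendsto hy
  · rw [h.inv_apply hy, hL, ← hL']; exact hd.hasFDerivAt

variable (ψ ρ) in
/-- The function `z ↦ g (‖ψ⁻¹ z‖²)`, extended by zero outside of the image. -/
def radial (g : ℝ → ℝ) : G → ℝ := by
  classical exact fun z => if z ∈ ψ '' ball 0 ρ then g (‖inv ψ ρ z‖ ^ 2) else 0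

variable (ψ ρ) in
/-- The gradient of `radial ψ ρ g`, where `g'` is the derivative of `g`. -/
def radialGrad (g' : ℝ → ℝ) : G → G := by
  classical exact fun z => if z ∈ ψ '' ball 0 ρ then
    -(Complex.I • fderiv ℝ ψ (inv ψ ρ z) ((2 * g' (‖inv ψ ρ z‖ ^ 2)) • Complex.I • inv ψ ρ z))
    else 0

theorem radial_apply (h : SymplEmbOn ψ ρ) (g : ℝ → ℝ) {y : G} (hy : y ∈ ball (0:G) ρ) :
    radial ψ ρ g (ψ y) = g (‖y‖ ^ 2) := by
  simp only [radial, if_pos (mem_image_of_mem ψ hy), h.inv_apply hy]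

theorem radialGrad_apply (h : SymplEmbOn ψ ρ) (g' : ℝ → ℝ) {y : G} (hy : y ∈ ball (0:G) ρ) :
    radialGrad ψ ρ g' (ψ y)
      = -(Complex.I • fderiv ℝ ψ y ((2 * g' (‖y‖ ^ 2)) • Complex.I • y)) := by
  simp only [radialGrad, if_pos (mem_image_of_mem ψ hy), h.inv_apply hy]

theorem radial_of_notMem (g : ℝ → ℝ) {z : G} (hz : z ∉ ψ '' ball 0 ρ) : radial ψ ρ g z = 0 := by
  simp only [radial, if_neg hz]

theorem radialGrad_of_notMem (g' : ℝ → ℝ) {z : G} (hz : z ∉ ψ '' ball 0 ρ) :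
    radialGrad ψ ρ g' z = 0 := by
  simp only [radialGrad, if_neg hz]

theorem radial_eq_zero (h : SymplEmbOn ψ ρ) {g : ℝ → ℝ} {r : ℝ} (hr : 0 ≤ r)
    (hg : ∀ s, r ^ 2 ≤ s → g s = 0) {z : G} (hz : z ∉ ψ '' ball 0 r) : radial ψ ρ g z = 0 := by
  by_cases hz' : z ∈ ψ '' ball 0 ρ
  · obtain ⟨y, hy, rfl⟩ := hz'
    rw [h.radial_apply g hy]
    refine hg _ ?_
    have : r ≤ ‖y‖ := by
      by_contra hcon
      exact hz (mem_image_of_mem ψ (mem_ball_zero_iff.2 (not_le.1 hcon)))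
    gcongr
  · exact radial_of_notMem g hz'

theorem radialGrad_eq_zero (h : SymplEmbOn ψ ρ) {g' : ℝ → ℝ} {r : ℝ} (hr : 0 ≤ r)
    (hg : ∀ s, r ^ 2 ≤ s → g' s = 0) {z : G} (hz : z ∉ ψ '' ball 0 r) :
    radialGrad ψ ρ g' z = 0 := by
  by_cases hz' : z ∈ ψ '' ball 0 ρ
  · obtain ⟨y, hy, rfl⟩ := hz'
    rw [h.radialGrad_apply g' hy, hg, mul_zero, zero_smul, map_zero, smul_zero, neg_zero]
    have : r ≤ ‖y‖ := by
      by_contra hcon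
      exact hz (mem_image_of_mem ψ (mem_ball_zero_iff.2 (not_le.1 hcon)))
    gcongr
  · exact radialGrad_of_notMem g' hz'

theorem isCompact_image [FiniteDimensional ℂ G] (h : SymplEmbOn ψ ρ) {r : ℝ} (hr : r < ρ) :
    IsCompact (ψ '' closedBall 0 r) := by
  have hprop : ProperSpace G := FiniteDimensional.proper ℂ G
  exact (isCompact_closedBall 0 r).image_of_continuousOn
    (h.contDiffOn.continuousOn.mono (closedBall_subset_ball hr))

theorem eventually_notMem_image [FiniteDimensional ℂ G] (h : SymplEmbOn ψ ρ) {r : ℝ} (hr : r < ρ)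
    {z : G} (hz : z ∉ ψ '' ball 0 ρ) : ∀ᶠ w in 𝓝 z, w ∉ ψ '' ball 0 r := by
  have h1 : z ∉ ψ '' closedBall 0 r := fun hz' => hz (image_mono (closedBall_subset_ball hr) hz')
  filter_upwards [(h.isCompact_image hr).isClosed.isOpen_compl.mem_nhds h1] with w hw hw'
  exact hw (image_mono ball_subset_closedBall hw')

theorem continuous_radialGrad [FiniteDimensional ℂ G] (h : SymplEmbOn ψ ρ) {g' : ℝ → ℝ}
    (hg' : Continuous g') {r : ℝ} (hr : 0 ≤ r) (hrρ : r < ρ) (hg : ∀ s, r ^ 2 ≤ s → g' s = 0) :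
    Continuous (radialGrad ψ ρ g') := by
  refine continuous_iff_continuousAt.2 fun z => ?_
  by_cases hz : z ∈ ψ '' ball 0 ρ
  · obtain ⟨y, hy, rfl⟩ := hz
    have h1 : ContinuousAt (fderiv ℝ ψ) y :=
      (h.contDiffOn.continuousOn_fderiv_of_isOpen isOpen_ball le_rfl).continuousAt
        (isOpen_ball.mem_nhds hy)
    have h2 : ContinuousAt (fun y : G => (2 * g' (‖y‖ ^ 2)) • Complex.I • y) y := by fun_prop
    have h3 : ContinuousAt (fun y : G => -(Complex.I • fderiv ℝ ψ y
        ((2 * g' (‖y‖ ^ 2)) • Complex.I • y))) y := ((h1.clm_apply h2).const_smul _).neg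
    have h4 : Tendsto (fun z => -(Complex.I • fderiv ℝ ψ (inv ψ ρ z)
        ((2 * g' (‖inv ψ ρ z‖ ^ 2)) • Complex.I • inv ψ ρ z))) (𝓝 (ψ y))
        (𝓝 (radialGrad ψ ρ g' (ψ y))) := by
      rw [h.radialGrad_apply g' hy]; exact h3.tendsto.comp (h.inv_tendsto hy)
    refine h4.congr' ?_
    filter_upwards [h.image_mem_nhds hy] with z hz
    simp only [radialGrad, if_pos hz]
  · refine (continuousAt_const (y := (0:G))).congr ?_
    filter_upwards [h.eventually_notMem_image hrρ hz] with w hw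
    rw [h.radialGrad_eq_zero hr hg hw]

theorem hasFDerivAt_radial [FiniteDimensional ℂ G] (h : SymplEmbOn ψ ρ) {g g' : ℝ → ℝ}
    (hg : ∀ s, HasDerivAt g (g' s) s) {r : ℝ} (hr : 0 ≤ r) (hrρ : r < ρ)
    (hg0 : ∀ s, r ^ 2 ≤ s → g s = 0) (z : G) :
    HasFDerivAt (radial ψ ρ g) (innerSL ℝ (radialGrad ψ ρ g' z)) z := by
  by_cases hz : z ∈ ψ '' ball 0 ρ
  · obtain ⟨y, hy, rfl⟩ := hz
    obtain ⟨L, hL, -⟩ := h.exists_hasStrictFDerivAt hy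
    have h1 := h.hasFDerivAt_inv hy hL
    have h2 := h1.norm_sq
    have h3 := (hg (‖inv ψ ρ (ψ y)‖ ^ 2)).comp_hasFDerivAt (ψ y) h2
    have h4 : HasFDerivAt (fun z => g (‖inv ψ ρ z‖ ^ 2))
        (innerSL ℝ (radialGrad ψ ρ g' (ψ y))) (ψ y) := by
      refine h3.congr_fderiv ?_
      ext w
      obtain ⟨u, rfl⟩ := L.surjective w
      rw [h.radialGrad_apply g' hy, h.inv_apply hy]
      have h5 : ⟪-(Complex.I • fderiv ℝ ψ y ((2 * g' (‖y‖ ^ 2)) • Complex.I • y)), L u⟫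
          = (2 * g' (‖y‖ ^ 2)) * ⟪y, u⟫ := by
        have : L u = fderiv ℝ ψ y u := by rw [← hL]; rfl
        rw [← sform_eq_inner, this, h.sympl y hy, sform_smul_left, sform_I_smul_left]
      rw [innerSL_apply_apply, h5]
      simp
      ring
    refine h4.congr_of_eventuallyEq ?_
    filter_upwards [h.image_mem_nhds hy] with z hz
    simp only [radial, if_pos hz]
  · rw [radialGrad_of_notMem g' hz, map_zero]
    refine (hasFDerivAt_const (0:ℝ) z).congr_of_eventuallyEq ?_
    filter_upwards [h.eventually_notMem_image hrρ hz] with w hw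
    exact h.radial_eq_zero hr hg0 hw

end SymplEmbOn
end SymplecticMaps

section RadialFlow

variable {G : Type*} [NormedAddCommGroup G] [InnerProductSpace ℂ G]

theorem const_of_hasDerivAt_zero {V : Type*} [NormedAddCommGroup V] [NormedSpace ℝ V] {v : ℝ → V}
    (hv : ∀ t ∈ Icc (0:ℝ) 1, HasDerivAt v 0 t) {t : ℝ} (ht : t ∈ Icc (0:ℝ) 1) : v t = v 0 :=
  constant_of_has_deriv_right_zero (fun t ht => (hv t ht).continuousAt.continuousWithinAt)
    (fun t ht => (hv t (Ico_subset_Icc_self ht)).hasDerivWithinAt) t ht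

namespace SymplEmbOn

variable {ψ : G → G} {ρ : ℝ}

/-- A curve that follows a radial Hamiltonian flow inside the image of the ball of radius `r`
stays on the image of a sphere. -/
theorem exists_norm_eq_of_flow [FiniteDimensional ℂ G] (h : SymplEmbOn ψ ρ) {r : ℝ} (hr : 0 ≤ r)
    (hrρ : r < ρ) {k : ℝ → ℝ} {x x' : ℝ → G} (hx : ∀ t ∈ Icc (0:ℝ) 1, HasDerivAt x (x' t) t)
    (hx' : ∀ t ∈ Icc (0:ℝ) 1, ∀ y ∈ ball (0:G) r, x t = ψ y →
      x' t = fderiv ℝ ψ y ((2 * k (‖y‖ ^ 2)) • Complex.I • y))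
    {t₀ : ℝ} (ht₀ : t₀ ∈ Icc (0:ℝ) 1) {y₀ : G} (hy₀ : y₀ ∈ ball (0:G) r) (hxy : x t₀ = ψ y₀) :
    ∀ t ∈ Icc (0:ℝ) 1, ∃ y ∈ ball (0:G) r, ‖y‖ = ‖y₀‖ ∧ x t = ψ y := by
  have hsub : ball (0:G) r ⊆ ball 0 ρ := ball_subset_ball hrρ.le
  set g : ℝ → ℝ := fun s => (max 0 (r ^ 2 - s)) ^ 2 with hg
  set g' : ℝ → ℝ := fun s => 2 * max 0 (r ^ 2 - s) * (-1) with hg'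
  have hgd : ∀ s, HasDerivAt g (g' s) s := fun s =>
    (hasDerivAt_sq_max_zero (r ^ 2 - s)).comp s ((hasDerivAt_id s).const_sub (r ^ 2))
  have hg0 : ∀ s, r ^ 2 ≤ s → g s = 0 := fun s hs => by
    simp only [hg, max_eq_left (sub_nonpos.2 hs)]; norm_num
  have hg0' : ∀ s, r ^ 2 ≤ s → g' s = 0 := fun s hs => by
    simp only [hg', max_eq_left (sub_nonpos.2 hs)]; norm_num
  have hd : ∀ t ∈ Icc (0:ℝ) 1, HasDerivAt (fun t => radial ψ ρ g (x t)) 0 t := by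
    intro t ht
    refine ((h.hasFDerivAt_radial hgd hr hrρ hg0 (x t)).comp_hasDerivAt t (hx t ht)).congr_deriv ?_
    rw [innerSL_apply_apply]
    by_cases hz : x t ∈ ψ '' ball 0 r
    · obtain ⟨y, hy, hyx⟩ := hz
      rw [hx' t ht y hy hyx.symm, ← hyx, h.radialGrad_apply g' (hsub hy), ← sform_eq_inner,
        h.sympl y (hsub hy), sform_smul_left, sform_smul_right, sform_self]
      ring
    · rw [h.radialGrad_eq_zero hr hg0' hz, inner_zero_left]
  have hconst : ∀ t ∈ Icc (0:ℝ) 1, radial ψ ρ g (x t) = g (‖y₀‖ ^ 2) := by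
    intro t ht
    rw [const_of_hasDerivAt_zero hd ht, ← const_of_hasDerivAt_zero hd ht₀, hxy,
      h.radial_apply g (hsub hy₀)]
  have hlt : ∀ y ∈ ball (0:G) r, 0 < r ^ 2 - ‖y‖ ^ 2 := by
    intro y hy
    rw [mem_ball_zero_iff] at hy
    nlinarith [norm_nonneg y]
  have hgpos : 0 < g (‖y₀‖ ^ 2) := by
    simp only [hg, max_eq_right (hlt y₀ hy₀).le]; exact pow_pos (hlt y₀ hy₀) 2
  intro t ht
  by_cases hz : x t ∈ ψ '' ball 0 r
  · obtain ⟨y, hy, hyx⟩ := hz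
    refine ⟨y, hy, ?_, hyx.symm⟩
    have h1 := hconst t ht
    rw [← hyx, h.radial_apply g (hsub hy)] at h1
    simp only [hg, max_eq_right (hlt y₀ hy₀).le, max_eq_right (hlt y hy).le] at h1
    have h2 := (pow_left_inj₀ (hlt y hy).le (hlt y₀ hy₀).le two_ne_zero).1 h1
    exact (pow_left_inj₀ (norm_nonneg _) (norm_nonneg _) two_ne_zero).1 (by linarith)
  · have h1 := hconst t ht
    rw [h.radial_eq_zero hr hg0 hz] at h1
    linarith

/-- A closed curve of period one following a slow radial Hamiltonian flow is constant. -/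
theorem exists_stationary_of_flow [FiniteDimensional ℂ G] (h : SymplEmbOn ψ ρ) {r : ℝ} (hr : 0 ≤ r)
    (hrρ : r < ρ) {k : ℝ → ℝ} (hk0 : ∀ s, 0 ≤ k s) (hk : ∀ s, k s < Real.pi)
    {x x' : ℝ → G} (hx : ∀ t ∈ Icc (0:ℝ) 1, HasDerivAt x (x' t) t) (hx01 : x 0 = x 1)
    (hx' : ∀ t ∈ Icc (0:ℝ) 1, ∀ y ∈ ball (0:G) r, x t = ψ y →
      x' t = fderiv ℝ ψ y ((2 * k (‖y‖ ^ 2)) • Complex.I • y))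
    {t₀ : ℝ} (ht₀ : t₀ ∈ Icc (0:ℝ) 1) {y₀ : G} (hy₀ : y₀ ∈ ball (0:G) r) (hxy : x t₀ = ψ y₀) :
    ∀ t ∈ Icc (0:ℝ) 1, ∃ y ∈ ball (0:G) r, x t = ψ y ∧ (2 * k (‖y‖ ^ 2)) • Complex.I • y = 0 := by
  have hsub : ball (0:G) r ⊆ ball 0 ρ := ball_subset_ball hrρ.le
  have hex := h.exists_norm_eq_of_flow hr hrρ hx hx' ht₀ hy₀ hxy
  set θ : ℝ := 2 * k (‖y₀‖ ^ 2) with hθ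
  set y : ℝ → G := fun t => inv ψ ρ (x t) with hy
  have hyp : ∀ t ∈ Icc (0:ℝ) 1, y t ∈ ball (0:G) r ∧ ‖y t‖ = ‖y₀‖ ∧ x t = ψ (y t) := by
    intro t ht
    obtain ⟨w, hw, hwn, hxw⟩ := hex t ht
    have : y t = w := by simp only [hy, hxw, h.inv_apply (hsub hw)]
    rw [this]; exact ⟨hw, hwn, hxw⟩
  have hyd : ∀ t ∈ Icc (0:ℝ) 1, HasDerivAt y (θ • Complex.I • y t) t := by
    intro t ht
    obtain ⟨h1, h2, h3⟩ := hyp t ht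
    obtain ⟨L, hL, -⟩ := h.exists_hasStrictFDerivAt (hsub h1)
    have h4 := h.hasFDerivAt_inv (hsub h1) hL
    rw [← h3] at h4
    refine (h4.comp_hasDerivAt t (hx t ht)).congr_deriv ?_
    rw [hx' t ht _ h1 h3, h2, ← hL]
    exact L.symm_apply_apply _
  have hvd : ∀ t ∈ Icc (0:ℝ) 1,
      HasDerivAt (fun t : ℝ => Complex.exp (-(θ * Complex.I) * t) • y t) 0 t := by
    intro t ht
    have h1 : HasDerivAt (fun t : ℝ => Complex.exp (-(θ * Complex.I) * t))
        (Complex.exp (-(θ * Complex.I) * t) * (-(θ * Complex.I))) t := by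
      have := ((Complex.ofRealCLM.hasDerivAt (x := t)).const_mul (-(θ * Complex.I) : ℂ)).cexp
      simpa using this
    refine (h1.smul (hyd t ht)).congr_deriv ?_
    rw [← Complex.coe_smul θ, smul_smul, smul_smul, ← add_smul]
    have : Complex.exp (-(θ * Complex.I) * t) * θ * Complex.I
        + Complex.exp (-(θ * Complex.I) * t) * (-(θ * Complex.I)) = 0 := by ring
    rw [this, zero_smul]
  have h1 := const_of_hasDerivAt_zero hvd (right_mem_Icc.2 zero_le_one)
  have hy01 : y 1 = y 0 := by simp only [hy, hx01]
  have hor : θ = 0 ∨ y₀ = 0 := by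
    simp only [hy01, Complex.ofReal_one, Complex.ofReal_zero, mul_one, mul_zero, Complex.exp_zero]
      at h1
    rw [← sub_eq_zero, ← sub_smul, smul_eq_zero] at h1
    rcases h1 with h1 | h1
    · left
      rw [sub_eq_zero, Complex.exp_eq_one_iff] at h1
      obtain ⟨n, hn⟩ := h1
      have h2 : -θ = n * (2 * Real.pi) := by
        have := congrArg Complex.im hn
        simpa using this
      have h3 := hk0 (‖y₀‖ ^ 2)
      have h4 := hk (‖y₀‖ ^ 2)
      have hπ := Real.pi_pos
      have h5 : (-1:ℝ) < n := by
        by_contra hcon; push Not at hcon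
        have : (n:ℝ) * (2 * Real.pi) ≤ (-1) * (2 * Real.pi) := by gcongr
        linarith
      have h6 : (n:ℝ) ≤ 0 := by
        by_contra hcon; push Not at hcon
        have : 0 < (n:ℝ) * (2 * Real.pi) := by positivity
        linarith
      have h7 : n = 0 := by
        have h5' : (-1:ℤ) < n := by exact_mod_cast h5
        have h6' : n ≤ 0 := by exact_mod_cast h6
        omega
      rw [h7] at h2; simpa using h2
    · right
      rw [← norm_eq_zero, ← (hyp 0 (left_mem_Icc.2 zero_le_one)).2.1, h1, norm_zero]
  intro t ht
  obtain ⟨h2, h3, h4⟩ := hyp t ht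
  refine ⟨y t, h2, h4, ?_⟩
  rw [h3]
  rcases hor with h5 | h5
  · rw [← hθ, h5, zero_smul]
  · have : y t = 0 := by rw [← norm_eq_zero, h3, h5, norm_zero]
    rw [this, smul_zero, smul_zero]

end SymplEmbOn
end RadialFlow

section Squeezing

variable {G : Type*} [NormedAddCommGroup G] [InnerProductSpace ℂ G]

theorem hasFDerivAt_diagForm [FiniteDimensional ℂ G] (e : G) (ν : ℝ) (z : G) :
    HasFDerivAt (diagForm e ν) (innerSL ℝ ((2:ℝ) • diagOp e ν z)) z := by
  have h1 : HasFDerivAt (fun z => diagOp e ν z) ((diagOp e ν).restrictScalars ℝ) z :=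
    ((diagOp e ν).restrictScalars ℝ).hasFDerivAt
  have h2 := h1.inner ℝ (hasFDerivAt_id z)
  have h3 : diagForm e ν = fun z => ⟪diagOp e ν z, id z⟫ := by
    ext z; exact diagForm_eq e ν z
  rw [h3]
  refine h2.congr_fderiv ?_
  ext w
  have h4 := real_inner_diagOp_comm e ν w z
  simp only [innerSL_apply_apply, real_inner_smul_left, ContinuousLinearMap.comp_apply,
    ContinuousLinearMap.prod_apply, fderivInnerCLM_apply, ContinuousLinearMap.coe_restrictScalars',
    ContinuousLinearMap.coe_id', id]
  rw [h4]; ring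

theorem exists_diagForm_lt_one {e : G} {D : Set G} (hD : IsCompact D)
    (hcyl : ∀ z ∈ D, ‖inner ℂ e z‖ < 1) :
    ∃ ν > 0, ν < 1 / 2 ∧ ∀ z ∈ D, diagForm e ν z < 1 := by
  rcases D.eq_empty_or_nonempty with rfl | hne
  · exact ⟨1 / 4, by norm_num, by norm_num, fun z hz => hz.elim⟩
  have hc : Continuous fun z : G => ‖inner ℂ e z‖ := by fun_prop
  obtain ⟨z₁, hz₁, hmax⟩ := hD.exists_isMaxOn hne hc.continuousOn
  obtain ⟨z₂, hz₂, hmax₂⟩ := hD.exists_isMaxOn hne continuous_norm.continuousOn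
  set c := ‖inner ℂ e z₁‖ with hcdef
  set K := ‖z₂‖ with hK
  have hc1 : c ^ 2 < 1 := by
    have := hcyl z₁ hz₁
    exact pow_lt_one₀ (norm_nonneg _) this two_ne_zero
  have hν0 : 0 < (1 - c ^ 2) / (2 * (K ^ 2 + 1)) := by
    apply div_pos; linarith; positivity
  refine ⟨(1 - c ^ 2) / (4 * (K ^ 2 + 1)), ?_, ?_, fun z hz => ?_⟩
  · apply div_pos; linarith; positivity
  · rw [div_lt_iff₀ (by positivity)]
    nlinarith [sq_nonneg c, sq_nonneg K]
  · set ν := (1 - c ^ 2) / (4 * (K ^ 2 + 1)) with hν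
    have hνpos : 0 < ν := by apply div_pos; linarith; positivity
    have hνe : ν * (4 * (K ^ 2 + 1)) = 1 - c ^ 2 := by rw [hν]; field_simp
    have h1 : ‖z‖ ^ 2 ≤ K ^ 2 := by gcongr; exact hmax₂ hz
    have h2 : ‖inner ℂ e z‖ ^ 2 ≤ c ^ 2 := by gcongr; exact hmax hz
    have h3 : ν * ‖z‖ ^ 2 ≤ ν * K ^ 2 := by gcongr
    have h4 : (1 - ν) * ‖inner ℂ e z‖ ^ 2 ≤ ‖inner ℂ e z‖ ^ 2 := by
      nlinarith [sq_nonneg ‖inner ℂ e z‖]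
    rw [diagForm]
    nlinarith

/-- A symplectic embedding of a ball of radius larger than one does not fit into a symplectic
cylinder of radius one. -/
theorem SymplEmbOn.not_mapsTo_cylinder [FiniteDimensional ℂ G] {e : G} (he : ‖e‖ = 1) {ψ : G → G}
    {ρ : ℝ} (hρ : 1 < ρ) (h : SymplEmbOn ψ ρ) (hψ0 : ψ 0 = 0)
    (hcyl : ∀ z ∈ ball (0:G) ρ, ‖inner ℂ e (ψ z)‖ < 1) : False := by
  have hprop : ProperSpace G := FiniteDimensional.proper ℂ G
  have hπ := Real.pi_pos
  obtain ⟨r, hr1, hrρ⟩ := exists_between hρ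
  have hr0 : 0 ≤ r := by linarith
  have hsub : ball (0:G) r ⊆ ball 0 ρ := ball_subset_ball hrρ.le
  obtain ⟨f₀, f₀', m, η, hf₀d, hf₀c, hf₀nn, hf₀π, hf₀hi, hη, hf₀lo, hf₀0, hf₀m, hm⟩ :=
    exists_inner_profile (a := r ^ 2) (by nlinarith)
  obtain ⟨κ, hκ, hκm⟩ := exists_between (lt_min hm (by linarith : Real.pi < 2 * Real.pi))
  have hκ0 : 0 < κ := hπ.trans hκ
  obtain ⟨f, f', σ, hfd, hfc, hflo, hfhi, hfm, hff⟩ :=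
    exists_outer_profile hκ0 (hκm.trans_le (min_le_left _ _))
  have hDc := h.isCompact_image hrρ
  obtain ⟨ν, hν, hν1, hνD⟩ := exists_diagForm_lt_one (e := e) hDc (by
    rintro _ ⟨y, hy, rfl⟩; exact hcyl y (closedBall_subset_ball hrρ hy))
  have hq0 : ∀ z, 0 ≤ diagForm e ν z := fun z =>
    (by positivity : 0 ≤ ν * ‖z‖ ^ 2).trans (le_diagForm (by linarith) z)
  have hqD : ∀ y ∈ ball (0:G) r, diagForm e ν (ψ y) < 1 := fun y hy =>
    hνD _ (mem_image_of_mem ψ (ball_subset_closedBall hy))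
  -- the perturbation and its gradient
  set P := radial ψ ρ (fun s => f₀ s - m) with hP
  set gP := radialGrad ψ ρ f₀' with hgP
  have hP0 : ∀ s, r ^ 2 ≤ s → f₀ s - m = 0 := fun s hs => by rw [(hf₀hi s hs).2, sub_self]
  have hgP0 : ∀ s, r ^ 2 ≤ s → f₀' s = 0 := fun s hs => (hf₀hi s hs).1
  have hPd : ∀ z, HasFDerivAt P (innerSL ℝ (gP z)) z :=
    h.hasFDerivAt_radial (fun s => (hf₀d s).sub_const m) hr0 hrρ hP0
  have hgPc : Continuous gP := h.continuous_radialGrad hf₀c hr0 hrρ hgP0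
  have hPm : ∀ z, -m ≤ P z := by
    intro z
    by_cases hz : z ∈ ψ '' ball 0 ρ
    · obtain ⟨y, hy, rfl⟩ := hz
      rw [hP, h.radial_apply _ hy]; linarith [hf₀0 (‖y‖ ^ 2)]
    · rw [hP, radial_of_notMem _ hz]; linarith
  set k : G → ℝ := fun z => f (diagForm e ν z) - κ * diagForm e ν z + P z with hk
  set gk : G → G := fun z => (2 * (f' (diagForm e ν z) - κ)) • diagOp e ν z + gP z with hgk
  have hkd : ∀ z, HasFDerivAt k (innerSL ℝ (gk z)) z := by
    intro z
    have h1 := hasFDerivAt_diagForm e ν z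
    have h2 := (((hfd _).comp_hasFDerivAt z h1).sub (h1.const_mul κ)).add (hPd z)
    refine h2.congr_fderiv ?_
    ext w
    simp only [hgk, innerSL_apply_apply, inner_add_left, real_inner_smul_left,
      add_apply, sub_apply, smul_apply,
      smul_eq_mul]
    ring
  have hqc := continuous_diagForm e ν
  have hQc : Continuous (diagOp e ν) := (diagOp e ν).continuous
  have hkc : Continuous k := continuous_iff_continuousAt.2 fun z => (hkd z).continuousAt
  have c0 : Continuous fun z => 2 * (f' (diagForm e ν z) - κ) :=
    continuous_const.mul ((hfc.comp hqc).sub continuous_const)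
  have hgkc : Continuous gk := (c0.smul hQc).add hgPc
  set R : ℝ := |σ| / ν + 1 with hR
  have hRσ : ∀ z, z ∉ closedBall (0:G) R → σ ≤ diagForm e ν z := by
    intro z hz
    rw [mem_closedBall_zero_iff, not_le] at hz
    have h1 := le_diagForm (e := e) (by linarith : ν ≤ 1) z
    have h2 : 1 ≤ R := by rw [hR]; linarith [(by positivity : 0 ≤ |σ| / ν)]
    have h3 : |σ| ≤ ν * R := by
      rw [hR, mul_add, mul_div_cancel₀ _ hν.ne']; linarith
    have h4 : R ≤ ‖z‖ ^ 2 := by nlinarith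
    have h5 : ν * R ≤ ν * ‖z‖ ^ 2 := by gcongr
    linarith [le_abs_self σ]
  set K : Set G := closedBall 0 R ∪ ψ '' closedBall 0 r with hK
  have hKc : IsCompact K := (isCompact_closedBall _ _).union hDc
  have hnotin : ∀ z, z ∉ K → z ∉ ψ '' ball 0 r := fun z hz hz' =>
    hz (Or.inr (image_mono ball_subset_closedBall hz'))
  have hks : HasCompactSupport k := HasCompactSupport.intro hKc fun z hz => by
    have h1 := (hfhi _ (hRσ z fun hz' => hz (Or.inl hz'))).1
    simp only [hk, h1, hP, h.radial_eq_zero hr0 hP0 (hnotin z hz)]; ring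
  have hgks : HasCompactSupport gk := HasCompactSupport.intro hKc fun z hz => by
    have h1 := (hfhi _ (hRσ z fun hz' => hz (Or.inl hz'))).2
    simp only [hgk, h1, hgP, h.radialGrad_eq_zero hr0 hgP0 (hnotin z hz)]; simp
  obtain ⟨Mk, hMk⟩ := hkc.bounded_above_of_compact_support hks
  obtain ⟨M, hM⟩ := hgkc.bounded_above_of_compact_support hgks
  have hpos : ∀ z, 0 ≤ κ * diagForm e ν z + 0 + k z := fun z => by
    simp only [hk]; linarith [hfm (diagForm e ν z), hPm z]
  -- quartic bound
  obtain ⟨d, hd, hdz⟩ : ∃ d > 0, ∀ z, ‖z‖ < d → κ * diagForm e ν z + 0 + k z = 0 := by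
    have h0 : (0:G) ∈ ball (0:G) ρ := mem_ball_self (by linarith)
    have hη' : 0 < min (Real.sqrt η) r := lt_min (Real.sqrt_pos.2 hη) (by linarith)
    have h1 : ψ '' (ball 0 (min (Real.sqrt η) r)) ∈ 𝓝 (ψ 0) := by
      rw [← h.map_nhds h0]
      exact image_mem_map (ball_mem_nhds _ hη')
    obtain ⟨d, hd, hdz⟩ := Metric.mem_nhds_iff.1 h1
    rw [hψ0] at hdz
    refine ⟨d, hd, fun z hz => ?_⟩
    obtain ⟨y, hy, rfl⟩ := hdz (mem_ball_zero_iff.2 hz)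
    have hyr : y ∈ ball (0:G) r := ball_subset_ball (min_le_right _ _) hy
    have h2 := (hflo _ (hqD y hyr).le).1
    have h3 : ‖y‖ ^ 2 ≤ η := by
      rw [← Real.sq_sqrt hη.le]
      have := (mem_ball_zero_iff.1 hy).le.trans (min_le_left _ _)
      gcongr
    simp only [hk, h2, hP, h.radial_apply _ (hsub hyr), hf₀lo _ h3]; ring
  have hMk0 : 0 ≤ Mk := (norm_nonneg _).trans (hMk 0)
  have hH4 : ∀ z, κ * diagForm e ν z + 0 + k z ≤ (κ / d ^ 2 + Mk / d ^ 4) * ‖z‖ ^ 4 := by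
    intro z
    rcases lt_or_ge ‖z‖ d with hz | hz
    · rw [hdz z hz]; positivity
    · have h1 : diagForm e ν z ≤ ‖z‖ ^ 2 := diagForm_le he (by linarith) z
      have h2 : k z ≤ Mk := (le_abs_self _).trans (hMk z)
      have h3 : κ * ‖z‖ ^ 2 ≤ κ / d ^ 2 * ‖z‖ ^ 4 := by
        have : κ / d ^ 2 * ‖z‖ ^ 4 = κ * ‖z‖ ^ 2 * (‖z‖ / d) ^ 2 := by field_simp
        rw [this]
        have h4 : 1 ≤ (‖z‖ / d) ^ 2 := one_le_pow₀ ((one_le_div hd).2 hz)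
        exact le_mul_of_one_le_right (by positivity) h4
      have h5 : Mk ≤ Mk / d ^ 4 * ‖z‖ ^ 4 := by
        have : Mk / d ^ 4 * ‖z‖ ^ 4 = Mk * (‖z‖ / d) ^ 4 := by field_simp
        rw [this]
        exact le_mul_of_one_le_right hMk0 (one_le_pow₀ ((one_le_div hd).2 hz))
      have h6 : κ * diagForm e ν z ≤ κ * ‖z‖ ^ 2 := by gcongr
      linarith
  obtain ⟨x, hxc, hx01, hxd, hact⟩ := exists_closed_orbit he hν hν1 hκ
    (hκm.trans_le (min_le_right _ _)) 0 hkd (hgks.uniformContinuous_of_continuous hgkc) hM hMk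
    hpos (C₄ := κ / d ^ 2 + Mk / d ^ 4) (by positivity) hH4
  have c1 : Continuous fun t => 1 / 2 * ⟪gk (x t), x t⟫ :=
    ((hgkc.comp hxc).inner hxc).const_mul _ |> fun h => h
  have c2 : Continuous fun t => k (x t) := hkc.comp hxc
  rw [sub_zero, ← intervalIntegral.integral_const_mul, ← intervalIntegral.integral_sub
    (c1.intervalIntegrable _ _) (c2.intervalIntegrable _ _)] at hact
  have hint : ∀ z, 1 / 2 * ⟪gk z, z⟫ - k z
      = f' (diagForm e ν z) * diagForm e ν z - f (diagForm e ν z)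
        + (1 / 2 * ⟪gP z, z⟫ - P z) := by
    intro z
    simp only [hgk, hk, inner_add_left, real_inner_smul_left, ← diagForm_eq]; ring
  refine hact.not_ge ?_
  rw [← neg_nonneg, ← intervalIntegral.integral_neg]
  refine intervalIntegral.integral_nonneg zero_le_one fun t ht => ?_
  rw [neg_nonneg, hint]
  by_cases hex : ∃ t₀ ∈ Icc (0:ℝ) 1, x t₀ ∈ ψ '' ball 0 r
  · obtain ⟨t₀, ht₀, y₀, hy₀, hxy⟩ := hex
    obtain ⟨y, hy, hxt, hst⟩ := h.exists_stationary_of_flow hr0 hrρ hf₀nn hf₀π hxd hx01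
      (fun t ht y hy hxy => by
        have h1 := (hflo _ (hqD y hy).le).2
        have h2 : (2 * κ) • diagOp e ν (x t) + gk (x t) = gP (x t) := by
          simp only [hgk, hxy, h1]; module
        rw [h2, hxy, hgP, h.radialGrad_apply _ (hsub hy), smul_neg, smul_smul, Complex.I_mul_I,
          neg_one_smul, neg_neg]) ht₀ hy₀ hxy.symm t ht
    have h1 := hflo _ (hqD y hy).le
    rw [hxt, hgP, h.radialGrad_apply _ (hsub hy), hst, map_zero, smul_zero, neg_zero,
      inner_zero_left, h1.1, h1.2, hP, h.radial_apply _ (hsub hy)]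
    linarith [hf₀0 (‖y‖ ^ 2)]
  · have hz : x t ∉ ψ '' ball 0 r := fun hz => hex ⟨t, ht, hz⟩
    rw [hP, hgP, h.radial_eq_zero hr0 hP0 hz, h.radialGrad_eq_zero hr0 hgP0 hz, inner_zero_left]
    linarith [hff _ (hq0 (x t))]

end Squeezing

section NearIdentity

variable {F : Type*} [NormedAddCommGroup F] [NormedSpace ℝ F] [FiniteDimensional ℝ F]

/-- A local homeomorphism of a ball which is uniformly close to the identity is injective on the
concentric ball of half the radius. -/
theorem IsLocalHomeomorphOn.injOn_of_norm_sub_le {χ : F → F} {r : ℝ}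
    (h : IsLocalHomeomorphOn χ (ball 0 r)) (hχ : ∀ z ∈ ball (0:F) r, ‖χ z - z‖ ≤ r / 8) :
    InjOn χ (ball 0 (r / 2)) := by
  intro p₀ hp₀ p₁ hp₁ hp
  have hr : 0 < r := by have := (pos_of_mem_ball hp₀); linarith
  have hps : ProperSpace F := FiniteDimensional.proper ℝ F
  set X : Set F := ball 0 (3 * r / 4) with hX
  set Y : Set F := ball 0 r ∩ χ ⁻¹' X with hY
  have hYo : IsOpen Y := h.continuousOn.isOpen_inter_preimage isOpen_ball isOpen_ball
  have hsub : ball (0:F) (r / 2) ⊆ Y := fun z hz => by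
    have hz' := mem_ball_zero_iff.1 hz
    have hzr : z ∈ ball (0:F) r := mem_ball_zero_iff.2 (by linarith)
    refine ⟨hzr, mem_ball_zero_iff.2 ?_⟩
    have h1 := norm_le_norm_add_norm_sub' (χ z) z
    linarith [hχ z hzr]
  let f : Y → X := fun z => ⟨χ z, z.2.2⟩
  have hfc : Continuous f :=
    (h.continuousOn.comp_continuous continuous_subtype_val fun z : Y => z.2.1).subtype_mk _
  have hfl : IsLocalHomeomorph f := by
    refine IsLocalHomeomorph.of_comp (g := Subtype.val) ?_
      (isOpen_ball.isOpenEmbedding_subtypeVal).isLocalHomeomorph hfc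
    rw [isLocalHomeomorph_iff_isLocalHomeomorphOn_univ]
    exact h.comp (hYo.isOpenEmbedding_subtypeVal).isLocalHomeomorph.isLocalHomeomorphOn
      fun z _ => z.2.1
  have hpr : IsProperMap f := by
    refine isProperMap_iff_isCompact_preimage.2 ⟨hfc, fun {K} hK => ?_⟩
    rw [Subtype.isCompact_iff]
    have hK' := Subtype.isCompact_iff.1 hK
    have hcb : closedBall (0:F) (7 * r / 8) ⊆ ball 0 r := closedBall_subset_ball (by linarith)
    have heq : (Subtype.val '' (f ⁻¹' K) : Set F)
        = closedBall 0 (7 * r / 8) ∩ χ ⁻¹' (Subtype.val '' K) := by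
      ext z
      constructor
      · rintro ⟨y, hy, rfl⟩
        refine ⟨mem_closedBall_zero_iff.2 ?_, ⟨f y, hy, rfl⟩⟩
        have h1 := norm_le_norm_add_norm_sub (χ y) (y : F)
        have h2 := mem_ball_zero_iff.1 y.2.2
        linarith [hχ _ y.2.1]
      · rintro ⟨hz, k, hk, hkz⟩
        have hzY : z ∈ Y := ⟨hcb hz, by rw [mem_preimage, ← hkz]; exact k.2⟩
        refine ⟨⟨z, hzY⟩, ?_, rfl⟩
        have : f ⟨z, hzY⟩ = k := Subtype.ext hkz.symm
        rw [mem_preimage, this]; exact hk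
    rw [heq]
    exact (isCompact_closedBall _ _).of_isClosed_subset
      ((h.continuousOn.mono hcb).preimage_isClosed_of_isClosed isClosed_closedBall hK'.isClosed)
      inter_subset_left
  have hcov : IsCoveringMap f := by
    rw [isCoveringMap_iff_isCoveringMapOn_univ]
    refine hpr.isClosedMap.isCoveringMapOn_of_isLocalHomeomorphOn (fun x _ => ?_)
      hfl.isLocalHomeomorphOn
    refine (hpr.isCompact_preimage isCompact_singleton).finite ?_
    have hss : (f '' (f ⁻¹' {x})).Subsingleton :=
      subsingleton_singleton.anti (image_preimage_subset _ _)
    have := hss.coe_sort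
    exact ⟨(hfl.isLocalHomeomorphOn (s := f ⁻¹' {x})).discreteTopology_of_image⟩
  have hctr : ContractibleSpace X := contractibleSpace_ball (by linarith)
  have hlpc : LocallyPathConnectedSpace X := isOpen_ball.locallyPathConnectedSpace
  obtain ⟨s, ⟨hs0, hs⟩, -⟩ := hcov.existsUnique_continuousMap_lifts (ContinuousMap.id X)
    (f ⟨p₀, hsub hp₀⟩) ⟨p₀, hsub hp₀⟩ rfl
  let j : ball (0:F) (r / 2) → Y := fun z => ⟨z, hsub z.2⟩
  have hj : Continuous j := continuous_subtype_val.subtype_mk _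
  have hpc : PreconnectedSpace (ball (0:F) (r / 2)) :=
    isPreconnected_iff_preconnectedSpace.1 (convex_ball _ _).isPreconnected
  have hsj := hcov.eq_of_comp_eq (s.continuous.comp (hfc.comp hj)) hj (by
    ext z; exact congrArg Subtype.val (congrFun hs (f (j z)))) ⟨p₀, hp₀⟩ hs0
  have h1 := congrFun hsj ⟨p₁, hp₁⟩
  have h2 : f (j ⟨p₁, hp₁⟩) = f ⟨p₀, hsub hp₀⟩ := Subtype.ext hp.symm
  simp only [Function.comp_apply] at h1
  rw [h2, hs0] at h1
  exact congrArg Subtype.val h1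

theorem isLocalHomeomorphOn_of_contDiffOn {χ : F → F} {s : Set F} (hs : IsOpen s)
    (hχ : ContDiffOn ℝ 1 χ s) (hinj : ∀ z ∈ s, Function.Injective (fderiv ℝ χ z)) :
    IsLocalHomeomorphOn χ s := by
  have hcs : CompleteSpace F := FiniteDimensional.complete ℝ F
  refine IsLocalHomeomorphOn.mk _ _ fun z hz => ?_
  obtain ⟨L, hL⟩ : ∃ L : F ≃L[ℝ] F, (L : F →L[ℝ] F) = fderiv ℝ χ z :=
    ⟨(LinearEquiv.ofInjectiveEndo (fderiv ℝ χ z : F →ₗ[ℝ] F) (hinj z hz)).toContinuousLinearEquiv,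
      by ext; rfl⟩
  have h1 := (hχ.contDiffAt (hs.mem_nhds hz)).hasStrictFDerivAt one_ne_zero
  rw [← hL] at h1
  exact ⟨h1.toOpenPartialHomeomorph χ, h1.mem_toOpenPartialHomeomorph_source, fun _ _ => rfl⟩

end NearIdentity

section LinearSymplectic

variable {G : Type*} [NormedAddCommGroup G] [InnerProductSpace ℂ G]

/-- Linear maps preserving the symplectic form. -/
def IsSymplLinear (S : G →L[ℝ] G) : Prop := ∀ u v, sform (S u) (S v) = sform u v

theorem IsSymplLinear.comp {S T : G →L[ℝ] G} (hS : IsSymplLinear S) (hT : IsSymplLinear T) :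
    IsSymplLinear (S ∘L T) := fun u v => by
  rw [ContinuousLinearMap.comp_apply, ContinuousLinearMap.comp_apply, hS, hT]

theorem sform_sub_right (u v w : G) : sform u (v - w) = sform u v - sform u w := by
  simp only [sform_eq_inner, inner_sub_right]

/-- Symplectic transvections. -/
theorem exists_transvection (c : ℝ) (u : G) :
    ∃ S : G →L[ℝ] G, IsSymplLinear S ∧ ∀ x, S x = x + (c * sform x u) • u := by
  refine ⟨ContinuousLinearMap.id ℝ G
    + ((c • innerSL ℝ (Complex.I • u)).smulRight u), fun x y => ?_, fun x => ?_⟩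
  · have h : ∀ x : G, (ContinuousLinearMap.id ℝ G
      + ((c • innerSL ℝ (Complex.I • u)).smulRight u)) x = x + (c * sform x u) • u := fun x => by
      have h2 : ⟪Complex.I • u, x⟫ = sform x u := by
        rw [sform_swap, sform_eq_inner, inner_neg_left, neg_neg]
      simp [h2]
    rw [h, h]
    simp only [sform_add_left, sform_add_right, sform_smul_left, sform_smul_right, sform_self]
    rw [sform_swap u y]; ring
  · have h2 : ⟪Complex.I • u, x⟫ = sform x u := by
      rw [sform_swap, sform_eq_inner, inner_neg_left, neg_neg]
    simp [h2]

theorem exists_symplLinear_map_eq_of_sform_ne_zero {x y : G} (h : sform x y ≠ 0) :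
    ∃ S : G →L[ℝ] G, IsSymplLinear S ∧ S x = y ∧
      ∀ e, sform e x = sform e y → S e = e := by
  obtain ⟨S, hS, hSx⟩ := exists_transvection (sform x y)⁻¹ (y - x)
  refine ⟨S, hS, ?_, fun e he => ?_⟩
  · rw [hSx, sform_sub_right, sform_self, sub_zero, inv_mul_cancel₀ h, one_smul,
      add_sub_cancel]
  · rw [hSx, sform_sub_right, he, sub_self, mul_zero, zero_smul, add_zero]

theorem exists_symplLinear_map_eq {x y : G} (hx : x ≠ 0) (hy : y ≠ 0) :
    ∃ S : G →L[ℝ] G, IsSymplLinear S ∧ S x = y := by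
  obtain ⟨w, hw1, hw2⟩ : ∃ w, sform x w ≠ 0 ∧ sform w y ≠ 0 := by
    obtain ⟨w₁, h₁⟩ : ∃ w, sform x w ≠ 0 := by
      by_contra! h; exact hx (sform_nondegenerate h)
    obtain ⟨w₂, h₂⟩ : ∃ w, sform w y ≠ 0 := by
      by_contra! h
      exact hy (sform_nondegenerate fun v => by rw [sform_swap, h v, neg_zero])
    by_cases h3 : sform w₁ y = 0
    · by_cases h4 : sform x w₂ = 0
      · exact ⟨w₁ + w₂, by rwa [sform_add_right, h4, add_zero],
          by rwa [sform_add_left, h3, zero_add]⟩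
      · exact ⟨w₂, h4, h₂⟩
    · exact ⟨w₁, h₁, h3⟩
  obtain ⟨S, hS, hS1, -⟩ := exists_symplLinear_map_eq_of_sform_ne_zero hw1
  obtain ⟨T, hT, hT1, -⟩ := exists_symplLinear_map_eq_of_sform_ne_zero hw2
  exact ⟨T ∘L S, hT.comp hS, by rw [ContinuousLinearMap.comp_apply, hS1, hT1]⟩

theorem exists_symplLinear_fix {e q q' : G} (hq : sform e q = 1) (hq' : sform e q' = 1) :
    ∃ S : G →L[ℝ] G, IsSymplLinear S ∧ S e = e ∧ S q = q' := by
  by_cases h : sform q q' = 0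
  · have h1 : sform q (q + e) ≠ 0 := by
      rw [sform_add_right, sform_self, sform_swap, hq]; norm_num
    have h2 : sform (q + e) q' ≠ 0 := by rw [sform_add_left, h, hq']; norm_num
    have h3 : sform e (q + e) = 1 := by rw [sform_add_right, sform_self, hq, add_zero]
    obtain ⟨S, hS, hS1, hS2⟩ := exists_symplLinear_map_eq_of_sform_ne_zero h1
    obtain ⟨T, hT, hT1, hT2⟩ := exists_symplLinear_map_eq_of_sform_ne_zero h2
    refine ⟨T ∘L S, hT.comp hS, ?_, by rw [ContinuousLinearMap.comp_apply, hS1, hT1]⟩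
    rw [ContinuousLinearMap.comp_apply, hS2 e (hq.trans h3.symm), hT2 e (h3.trans hq'.symm)]
  · obtain ⟨S, hS, hS1, hS2⟩ := exists_symplLinear_map_eq_of_sform_ne_zero h
    exact ⟨S, hS, hS2 e (hq.trans hq'.symm), hS1⟩

/-- The linear symplectic group acts transitively on symplectic pairs. -/
theorem exists_symplLinear_pair {e e' p q : G} (he : sform e e' = 1) (hp : sform p q = 1) :
    ∃ S : G →L[ℝ] G, IsSymplLinear S ∧ S e = p ∧ S e' = q := by
  have h0 : ∀ v : G, sform 0 v = 0 := fun v => by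
    have := sform_smul_left 0 v v; rwa [zero_smul, zero_mul] at this
  have he0 : e ≠ 0 := by rintro rfl; rw [h0] at he; exact zero_ne_one he
  have hp0 : p ≠ 0 := by rintro rfl; rw [h0] at hp; exact zero_ne_one hp
  obtain ⟨S, hS, hS1⟩ := exists_symplLinear_map_eq he0 hp0
  obtain ⟨T, hT, hT1, hT2⟩ := exists_symplLinear_fix (e := p) (q := S e') (q' := q)
    (by rw [← hS1, hS, he]) hp
  exact ⟨T ∘L S, hT.comp hS, by rw [ContinuousLinearMap.comp_apply, hS1, hT1],
    by rw [ContinuousLinearMap.comp_apply, hT2]⟩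

variable [FiniteDimensional ℂ G]

theorem IsSymplLinear.exists_inverse {S : G →L[ℝ] G} (hS : IsSymplLinear S) :
    ∃ T : G →L[ℝ] G, IsSymplLinear T ∧ (∀ x, T (S x) = x) ∧ ∀ x, S (T x) = x := by
  obtain ⟨L, hL⟩ := exists_equiv_of_injective (injective_of_sform hS)
  have hL' : ∀ x, S x = L x := fun x => by rw [← hL]; rfl
  refine ⟨L.symm, fun u v => ?_, fun x => ?_, fun x => ?_⟩
  · rw [← hS, hL', hL']; simp
  · rw [hL']; simp
  · rw [hL']; simp

/-- The adjoint of a linear map with respect to the symplectic form. -/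
theorem exists_sform_adjoint (A : G →L[ℝ] G) :
    ∃ A' : G →L[ℝ] G, ∀ p z, sform p (A z) = sform (A' p) z := by
  have hc : CompleteSpace G := FiniteDimensional.complete ℂ G
  let J : G →L[ℝ] G := ((Complex.I • ContinuousLinearMap.id ℂ G : G →L[ℂ] G)).restrictScalars ℝ
  refine ⟨-(J ∘L A.adjoint ∘L J), fun p z => ?_⟩
  have hJ : ∀ x, J x = Complex.I • x := fun x => rfl
  rw [sform_eq_inner, sform_eq_inner, neg_apply,
    ContinuousLinearMap.comp_apply, ContinuousLinearMap.comp_apply, hJ, hJ, smul_neg, smul_smul,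
    Complex.I_mul_I, neg_one_smul, neg_neg, inner_neg_left, inner_neg_left,
    ContinuousLinearMap.adjoint_inner_left]

theorem isSymplLinear_of_sform_adjoint {A A' : G →L[ℝ] G}
    (h : ∀ p z, sform p (A z) = sform (A' p) z) (hA' : IsSymplLinear A') : IsSymplLinear A := by
  obtain ⟨T, -, hT1, hT2⟩ := hA'.exists_inverse
  have h1 : ∀ q, A (A' q) = q := fun q => by
    rw [← sub_eq_zero]
    refine sform_nondegenerate fun v => ?_
    rw [sform_swap, sform_sub_right, h, hA', sub_self, neg_zero]
  have h2 : ∀ q, A' (A q) = q := fun q => by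
    have := congrArg A' (h1 (T q))
    rw [hT2] at this
    exact this
  intro u v
  rw [h, h2]

end LinearSymplectic

section SymplecticLimits

variable {G : Type*} [NormedAddCommGroup G] [InnerProductSpace ℂ G]

/-- A map which is a symplectic `C¹` map of the ball of radius `r` fixing the origin. -/
structure IsSymplOn (ψ : G → G) (r : ℝ) : Prop where
  contDiffOn : ContDiffOn ℝ 1 ψ (ball 0 r)
  sympl : ∀ z ∈ ball (0:G) r, ∀ u v, sform (fderiv ℝ ψ z u) (fderiv ℝ ψ z v) = sform u v
  map_zero : ψ 0 = 0

theorem IsSymplOn.of_hasFDerivAt {ψ : G → G} {r : ℝ} {D : G → G →L[ℝ] G}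
    (hψ : ContDiffOn ℝ 1 ψ (ball 0 r)) (hD : ∀ z ∈ ball (0:G) r, HasFDerivAt ψ (D z) z)
    (hs : ∀ z ∈ ball (0:G) r, IsSymplLinear (D z)) (h0 : ψ 0 = 0) : IsSymplOn ψ r :=
  ⟨hψ, fun z hz u v => by rw [(hD z hz).fderiv]; exact hs z hz u v, h0⟩

theorem IsSymplOn.hasFDerivAt {ψ : G → G} {r : ℝ} (h : IsSymplOn ψ r) {z : G}
    (hz : z ∈ ball (0:G) r) : HasFDerivAt ψ (fderiv ℝ ψ z) z :=
  ((h.contDiffOn.contDiffAt (isOpen_ball.mem_nhds hz)).differentiableAt one_ne_zero).hasFDerivAt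

theorem IsSymplOn.isSymplLinear {ψ : G → G} {r : ℝ} (h : IsSymplOn ψ r) {z : G}
    (hz : z ∈ ball (0:G) r) : IsSymplLinear (fderiv ℝ ψ z) := h.sympl z hz

/-- Linear maps which are, on some ball, uniform limits of symplectic maps. -/
def IsSymplLimit (B : G →L[ℝ] G) : Prop :=
  ∃ r > 0, ∀ ε > 0, ∃ ψ : G → G, IsSymplOn ψ r ∧ ∀ z ∈ ball (0:G) r, ‖ψ z - B z‖ ≤ ε

theorem IsSymplLimit.comp {S B T : G →L[ℝ] G} (hB : IsSymplLimit B) (hS : IsSymplLinear S)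
    (hT : IsSymplLinear T) : IsSymplLimit (S ∘L B ∘L T) := by
  obtain ⟨r, hr, h⟩ := hB
  have hT0 : 0 < ‖T‖ + 1 := by positivity
  have hS0 : 0 < ‖S‖ + 1 := by positivity
  refine ⟨r / (‖T‖ + 1), by positivity, fun ε hε => ?_⟩
  obtain ⟨ψ, hψ, hψB⟩ := h (ε / (‖S‖ + 1)) (by positivity)
  have hm : MapsTo T (ball (0:G) (r / (‖T‖ + 1))) (ball 0 r) := fun z hz => by
    rw [mem_ball_zero_iff, lt_div_iff₀ hT0] at hz
    rw [mem_ball_zero_iff]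
    nlinarith [T.le_opNorm z, norm_nonneg z]
  refine ⟨fun z => S (ψ (T z)), IsSymplOn.of_hasFDerivAt
    (D := fun z => S ∘L fderiv ℝ ψ (T z) ∘L T) ?_ (fun z hz => ?_) (fun z hz => ?_) ?_,
    fun z hz => ?_⟩
  · exact S.contDiff.comp_contDiffOn (hψ.contDiffOn.comp T.contDiff.contDiffOn hm)
  · exact S.hasFDerivAt.comp z ((hψ.hasFDerivAt (hm hz)).comp z T.hasFDerivAt)
  · exact hS.comp ((hψ.isSymplLinear (hm hz)).comp hT)
  · simp [hψ.map_zero]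
  · have h1 := hψB _ (hm hz)
    rw [le_div_iff₀ hS0] at h1
    have h2 := S.le_opNorm (ψ (T z) - B (T z))
    rw [ContinuousLinearMap.comp_apply, ContinuousLinearMap.comp_apply, ← map_sub]
    nlinarith [norm_nonneg (ψ (T z) - B (T z))]

theorem IsSymplLimit.exists_symplEmbOn [FiniteDimensional ℂ G] {B : G →L[ℝ] G}
    (hB : IsSymplLimit B) (hBi : Function.Injective B) :
    ∃ r > 0, ∀ ε > 0, ∃ ψ : G → G, SymplEmbOn ψ r ∧ ψ 0 = 0 ∧
      ∀ z ∈ ball (0:G) r, ‖ψ z - B z‖ ≤ ε := by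
  have hfd : FiniteDimensional ℝ G := FiniteDimensional.complexToReal G
  obtain ⟨r, hr, h⟩ := hB
  obtain ⟨L, hL⟩ := exists_equiv_of_injective hBi
  have hL' : ∀ x, B x = L x := fun x => by rw [← hL]; rfl
  set M := ‖(L.symm : G →L[ℝ] G)‖ + 1 with hM
  have hM0 : 0 < M := by positivity
  have hsub : ball (0:G) (r / 2) ⊆ ball 0 r := ball_subset_ball (by linarith)
  refine ⟨r / 2, by positivity, fun ε hε => ?_⟩
  obtain ⟨ψ, hψ, hψB⟩ := h (min ε (r / 8 / M)) (by positivity)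
  refine ⟨ψ, ⟨hψ.contDiffOn.mono hsub, ?_, fun z hz => hψ.sympl z (hsub hz)⟩, hψ.map_zero,
    fun z hz => (hψB z (hsub hz)).trans (min_le_left _ _)⟩
  have h1 : IsLocalHomeomorphOn (fun z => L.symm (ψ z)) (ball 0 r) := by
    refine isLocalHomeomorphOn_of_contDiffOn isOpen_ball
      (L.symm.contDiff.comp_contDiffOn hψ.contDiffOn) fun z hz => ?_
    have h2 : HasFDerivAt (fun z => L.symm (ψ z)) ((L.symm : G →L[ℝ] G) ∘L fderiv ℝ ψ z) z :=
      (L.symm : G →L[ℝ] G).hasFDerivAt.comp z (hψ.hasFDerivAt hz)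
    rw [h2.fderiv]
    exact L.symm.injective.comp (injective_of_sform (hψ.sympl z hz))
  have h3 := h1.injOn_of_norm_sub_le fun z hz => by
    have h4 := (hψB z hz).trans (min_le_right _ _)
    rw [le_div_iff₀ hM0] at h4
    have h5 := (L.symm : G →L[ℝ] G).le_opNorm (ψ z - B z)
    have h6 : (L.symm : G →L[ℝ] G) (ψ z - B z) = L.symm (ψ z) - z := by
      rw [hL', ContinuousLinearEquiv.coe_coe, map_sub, L.symm_apply_apply]
    rw [h6] at h5
    nlinarith [norm_nonneg (ψ z - B z)]
  exact fun x hx y hy hxy => h3 hx hy (congrArg L.symm hxy)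

/-- A limit of symplectic maps cannot squeeze a ball into a thinner symplectic cylinder. -/
theorem IsSymplLimit.not_squeezing [FiniteDimensional ℂ G] {B : G →L[ℝ] G}
    (hB : IsSymplLimit B) (hBi : Function.Injective B) {e : G} (he : ‖e‖ = 1) {μ : ℝ}
    (hμ0 : 0 < μ) (hμ1 : μ < 1) (hBe : ∀ z, ‖inner ℂ e (B z)‖ ≤ μ * ‖z‖) : False := by
  obtain ⟨r, hr, h⟩ := hB.exists_symplEmbOn hBi
  set ρ := 2 / (1 + μ) with hρ
  have hρ1 : 1 < ρ := by rw [hρ, lt_div_iff₀ (by linarith)]; linarith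
  have hρ0 : 0 < ρ := by linarith
  have hμρ : μ * ρ < 1 := by
    rw [hρ, mul_div_assoc', div_lt_one (by linarith)]; linarith
  set c := r / ρ with hc
  have hc0 : 0 < c := by positivity
  have hcρ : c * ρ = r := by rw [hc]; field_simp
  obtain ⟨ψ, hψ, hψ0, hψB⟩ := h (c * (1 - μ * ρ)) (mul_pos hc0 (by linarith))
  have hm : MapsTo (fun z : G => c • z) (ball 0 ρ) (ball 0 r) := fun z hz => by
    rw [mem_ball_zero_iff] at hz ⊢
    rw [norm_smul, Real.norm_of_nonneg hc0.le, ← hcρ]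
    exact mul_lt_mul_of_pos_left hz hc0
  have hd : ∀ z ∈ ball (0:G) ρ, HasFDerivAt (fun z => c⁻¹ • ψ (c • z)) (fderiv ℝ ψ (c • z)) z := by
    intro z hz
    have h1 : HasFDerivAt ψ (fderiv ℝ ψ (c • z)) (c • z) :=
      ((hψ.contDiffOn.contDiffAt (isOpen_ball.mem_nhds (hm hz))).differentiableAt
        one_ne_zero).hasFDerivAt
    have h2 : HasFDerivAt (fun z : G => c • z) (c • ContinuousLinearMap.id ℝ G) z :=
      (hasFDerivAt_id z).const_smul c
    refine ((h1.comp z h2).const_smul c⁻¹).congr_fderiv ?_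
    ext w
    simp [smul_smul, inv_mul_cancel₀ hc0.ne']
  have hemb : SymplEmbOn (fun z => c⁻¹ • ψ (c • z)) ρ := by
    refine ⟨?_, fun x hx y hy hxy => ?_, fun z hz u v => ?_⟩
    · exact (hψ.contDiffOn.comp (contDiff_id.const_smul c).contDiffOn hm).const_smul c⁻¹
    · have h1 := smul_right_injective G (inv_ne_zero hc0.ne') hxy
      exact smul_right_injective G hc0.ne' (hψ.injOn (hm hx) (hm hy) h1)
    · rw [(hd z hz).fderiv]; exact hψ.sympl _ (hm hz) u v
  refine hemb.not_mapsTo_cylinder he hρ1 (by simp [hψ0]) fun z hz => ?_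
  have hz' := mem_ball_zero_iff.1 hz
  have h1 : c⁻¹ • ψ (c • z) = B z + c⁻¹ • (ψ (c • z) - B (c • z)) := by
    rw [map_smul, smul_sub, smul_smul, inv_mul_cancel₀ hc0.ne', one_smul]; abel
  have h2 : ‖c⁻¹ • (ψ (c • z) - B (c • z))‖ ≤ 1 - μ * ρ := by
    rw [norm_smul, norm_inv, Real.norm_of_nonneg hc0.le, inv_mul_le_iff₀ hc0]
    exact hψB _ (hm hz)
  have h3 := norm_inner_le_norm (𝕜 := ℂ) e (c⁻¹ • (ψ (c • z) - B (c • z)))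
  have h4 := norm_add_le (inner ℂ e (B z)) (inner ℂ e (c⁻¹ • (ψ (c • z) - B (c • z))))
  rw [h1, inner_add_right]
  have h5 := hBe z
  rw [he, one_mul] at h3
  have h6 : μ * ‖z‖ < μ * ρ := mul_lt_mul_of_pos_left hz' hμ0
  linarith

end SymplecticLimits

section Stabilization

/-- An orthogonal splitting of `H` as the sum of `G` and the complex line spanned by `e`. -/
structure LineSplitting (G H : Type*) [NormedAddCommGroup G] [InnerProductSpace ℂ G]
    [NormedAddCommGroup H] [InnerProductSpace ℂ H] where
  incl : G →L[ℂ] H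
  proj : H →L[ℂ] G
  vec : H
  proj_incl : ∀ x, proj (incl x) = x
  proj_vec : proj vec = 0
  inner_incl : ∀ x y, inner ℂ (incl x) (incl y) = (inner ℂ x y : ℂ)
  inner_vec_incl : ∀ x, inner ℂ vec (incl x) = (0 : ℂ)
  norm_vec : ‖vec‖ = 1
  decomp : ∀ z, incl (proj z) + (inner ℂ vec z : ℂ) • vec = z

theorem exists_lineSplitting.{u} {G : Type u} [NormedAddCommGroup G] [InnerProductSpace ℂ G]
    [FiniteDimensional ℂ G] :
    ∃ (H : Type u) (_ : NormedAddCommGroup H) (_ : InnerProductSpace ℂ H),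
      FiniteDimensional ℂ H ∧ Nonempty (LineSplitting G H) := by
  refine ⟨WithLp 2 (G × ℂ), inferInstance, inferInstance, inferInstance, ⟨?_⟩⟩
  exact
    { incl := ((WithLp.prodContinuousLinearEquiv 2 ℂ G ℂ).symm : _ →L[ℂ] _) ∘L
        ContinuousLinearMap.inl ℂ G ℂ
      proj := ContinuousLinearMap.fst ℂ G ℂ ∘L
        (WithLp.prodContinuousLinearEquiv 2 ℂ G ℂ : _ →L[ℂ] _)
      vec := WithLp.toLp 2 (0, 1)
      proj_incl := fun x => by simp
      proj_vec := by simp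
      inner_incl := fun x y => by simp [WithLp.prod_inner_apply]
      inner_vec_incl := fun x => by simp [WithLp.prod_inner_apply]
      norm_vec := by simp
      decomp := fun z => by
        apply WithLp.ofLp_injective
        ext <;> simp [WithLp.prod_inner_apply] }

variable {G H : Type*} [NormedAddCommGroup G] [InnerProductSpace ℂ G]
  [NormedAddCommGroup H] [InnerProductSpace ℂ H]

namespace LineSplitting

theorem inner_incl_vec (D : LineSplitting G H) (x : G) : inner ℂ (D.incl x) D.vec = (0 : ℂ) := by
  rw [← inner_conj_symm, D.inner_vec_incl, map_zero]

theorem inner_vec_vec (D : LineSplitting G H) : inner ℂ D.vec D.vec = (1 : ℂ) := by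
  rw [inner_self_eq_norm_sq_to_K, D.norm_vec]; simp

/-- Embedding of `G × ℂ`. -/
def pair (D : LineSplitting G H) (x : G) (c : ℂ) : H := D.incl x + c • D.vec

theorem sform_pair (D : LineSplitting G H) (x y : G) (c d : ℂ) :
    sform (D.pair x c) (D.pair y d) = sform x y + (starRingEnd ℂ d * c).im := by
  simp only [sform, pair, inner_add_left, inner_add_right, inner_smul_left, inner_smul_right,
    D.inner_incl, D.inner_incl_vec, D.inner_vec_incl, D.inner_vec_vec]
  simp
  ring

/-- The real linear coordinate along the complex line. -/
def linePart (D : LineSplitting G H) : H →L[ℝ] H :=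
  ((innerSL ℂ D.vec).smulRight D.vec).restrictScalars ℝ

theorem linePart_apply (D : LineSplitting G H) (z : H) :
    D.linePart z = (inner ℂ D.vec z : ℂ) • D.vec := rfl

/-- The product of a linear map with the identity of the complex line. -/
def stab (D : LineSplitting G H) (A : G →L[ℝ] G) : H →L[ℝ] H :=
  D.incl.restrictScalars ℝ ∘L A ∘L D.proj.restrictScalars ℝ + D.linePart

theorem stab_apply (D : LineSplitting G H) (A : G →L[ℝ] G) (z : H) :
    D.stab A z = D.pair (A (D.proj z)) (inner ℂ D.vec z) := rfl

theorem pair_proj (D : LineSplitting G H) (z : H) : D.pair (D.proj z) (inner ℂ D.vec z) = z :=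
  D.decomp z

theorem sform_eq (D : LineSplitting G H) (z w : H) : sform z w = sform (D.proj z) (D.proj w)
    + (starRingEnd ℂ (inner ℂ D.vec w) * inner ℂ D.vec z).im := by
  conv_lhs => rw [← D.pair_proj z, ← D.pair_proj w]
  rw [D.sform_pair]

theorem norm_incl (D : LineSplitting G H) (x : G) : ‖D.incl x‖ = ‖x‖ := by
  rw [@norm_eq_sqrt_re_inner ℂ, D.inner_incl, ← @norm_eq_sqrt_re_inner ℂ]

theorem norm_proj_le (D : LineSplitting G H) (z : H) : ‖D.proj z‖ ≤ ‖z‖ := by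
  have h1 : ‖z‖ ^ 2 = ‖D.proj z‖ ^ 2 + ‖(inner ℂ D.vec z : ℂ)‖ ^ 2 := by
    conv_lhs => rw [← D.decomp z]
    have h2 := norm_add_sq_eq_norm_sq_add_norm_sq_of_inner_eq_zero (𝕜 := ℂ) (D.incl (D.proj z))
      ((inner ℂ D.vec z : ℂ) • D.vec) (by rw [inner_smul_right, D.inner_incl_vec, mul_zero])
    rw [norm_smul, D.norm_vec, D.norm_incl, mul_one] at h2
    rw [sq, sq, sq, h2]
  nlinarith [norm_nonneg z, norm_nonneg (D.proj z), sq_nonneg ‖(inner ℂ D.vec z : ℂ)‖]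

theorem isSymplLinear_stab (D : LineSplitting G H) {A : G →L[ℝ] G} (hA : IsSymplLinear A) :
    IsSymplLinear (D.stab A) := fun u v => by
  rw [D.stab_apply, D.stab_apply, D.sform_pair, hA, ← D.sform_eq]

theorem stab_injective (D : LineSplitting G H) {A : G →L[ℝ] G} (hA : Function.Injective A) :
    Function.Injective (D.stab A) := by
  intro z w h
  have hp : ∀ x c, D.proj (D.pair x c) = x := fun x c => by
    simp [pair, D.proj_incl, D.proj_vec]
  have hv : ∀ x c, inner ℂ D.vec (D.pair x c) = c := fun x c => by
    rw [pair, inner_add_right, inner_smul_right, D.inner_vec_incl, D.inner_vec_vec,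
      zero_add, mul_one]
  rw [D.stab_apply, D.stab_apply] at h
  have h1 := congrArg D.proj h
  have h2 := congrArg (inner ℂ D.vec) h
  rw [hp, hp] at h1
  rw [hv, hv] at h2
  rw [← D.pair_proj z, ← D.pair_proj w, hA h1, h2]

theorem isSymplLimit_stab (D : LineSplitting G H) {A : G →L[ℝ] G} (hA : IsSymplLimit A) :
    IsSymplLimit (D.stab A) := by
  obtain ⟨r, hr, h⟩ := hA
  refine ⟨r, hr, fun ε hε => ?_⟩
  obtain ⟨ψ, hψ, hψA⟩ := h ε hε
  have hm : MapsTo D.proj (ball (0:H) r) (ball 0 r) := fun z hz => by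
    rw [mem_ball_zero_iff] at hz ⊢; exact (D.norm_proj_le z).trans_lt hz
  have hpd : ContDiff ℝ 1 D.proj := (D.proj.restrictScalars ℝ).contDiff
  have hid : ContDiff ℝ 1 D.incl := (D.incl.restrictScalars ℝ).contDiff
  refine ⟨fun z => D.incl (ψ (D.proj z)) + D.linePart z, IsSymplOn.of_hasFDerivAt
    (D := fun z => D.stab (fderiv ℝ ψ (D.proj z))) ?_ (fun z hz => ?_)
    (fun z hz => D.isSymplLinear_stab (hψ.isSymplLinear (hm hz))) ?_, fun z hz => ?_⟩
  · exact (hid.comp_contDiffOn (hψ.contDiffOn.comp hpd.contDiffOn hm)).add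
      D.linePart.contDiff.contDiffOn
  · exact ((D.incl.restrictScalars ℝ).hasFDerivAt.comp z ((hψ.hasFDerivAt (hm hz)).comp z
      (D.proj.restrictScalars ℝ).hasFDerivAt)).add D.linePart.hasFDerivAt
  · simp [hψ.map_zero]
  · have h1 : D.incl (ψ (D.proj z)) + D.linePart z - D.stab A z
        = D.incl (ψ (D.proj z) - A (D.proj z)) := by
      rw [D.stab_apply, D.linePart_apply, pair, map_sub]; abel
    rw [h1, D.norm_incl]
    exact hψA _ (hm hz)

end LineSplitting

theorem norm_sq_inner_eq_sform (e z : G) :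
    ‖inner ℂ e z‖ ^ 2 = sform e z ^ 2 + sform (-(Complex.I • e)) z ^ 2 := by
  have h1 : sform (-(Complex.I • e)) z = -(inner ℂ e z : ℂ).re := by
    rw [← neg_one_smul ℝ, sform_smul_left, sform_I_smul_left, real_inner_eq_re]; ring
  rw [h1, sform_swap, sform, Complex.sq_norm, Complex.normSq_apply]; ring

variable [FiniteDimensional ℂ G]

theorem IsSymplLimit.sform_adjoint_le {A A' : G →L[ℝ] G} (hA : IsSymplLimit A)
    (hAi : Function.Injective A) (h : ∀ p z, sform p (A z) = sform (A' p) z) (p q : G) :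
    sform p q ≤ sform (A' p) (A' q) := by
  by_contra! hlt
  obtain ⟨H, _, _, hH, ⟨D⟩⟩ := exists_lineSplitting (G := G)
  set s : ℝ := 1 - sform (A' p) (A' q) with hs
  set ℓ : ℝ := sform p q + s with hℓ
  have hℓ1 : 1 < ℓ := by rw [hℓ, hs]; linarith
  have hℓ0 : 0 < ℓ := by linarith
  set m := Real.sqrt ℓ with hm
  have hm1 : 1 < m := by rw [hm]; exact Real.lt_sqrt_of_sq_lt (by linarith)
  have hm2 : m * m = ℓ := Real.mul_self_sqrt hℓ0.le
  have hm0 : 0 < m := by linarith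
  have hadj : ∀ x c z, sform (D.pair x c) (D.stab A z) = sform (D.pair (A' x) c) z := by
    intro x c z
    conv_rhs => rw [← D.pair_proj z]
    rw [D.stab_apply, D.sform_pair, D.sform_pair, h]
  have he1 : sform D.vec (-(Complex.I • D.vec)) = 1 := by
    rw [← neg_one_smul ℝ, sform_smul_right, sform_I_smul_right, real_inner_self_eq_norm_sq,
      D.norm_vec]; norm_num
  have hpq : ∀ x y, sform (D.pair x (Complex.I * s)) (D.pair y 1) = sform x y + s := by
    intro x y; rw [D.sform_pair]; simp
  obtain ⟨S, hS, hSe, hSe'⟩ := exists_symplLinear_pair he1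
    (p := m⁻¹ • D.pair p (Complex.I * s)) (q := m⁻¹ • D.pair q 1) (by
      rw [sform_smul_left, sform_smul_right, hpq, ← hℓ, ← hm2]; field_simp)
  obtain ⟨T, hT, hTe, hTe'⟩ := exists_symplLinear_pair he1
    (p := D.pair (A' p) (Complex.I * s)) (q := D.pair (A' q) 1) (by rw [hpq, hs]; ring)
  obtain ⟨S', hS', hSS', hS'S⟩ := hS.exists_inverse
  refine ((D.isSymplLimit_stab hA).comp hS' hT).not_squeezing
    ((injective_of_sform hS').comp ((D.stab_injective hAi).comp (injective_of_sform hT)))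
    D.norm_vec (inv_pos.2 hm0) (inv_lt_one_of_one_lt₀ hm1) fun z => ?_
  have h1 : sform D.vec (S' (D.stab A (T z))) = m⁻¹ * sform D.vec z := by
    rw [← hS, hS'S, hSe, sform_smul_left, hadj, ← hTe, hT]
  have h2 : sform (-(Complex.I • D.vec)) (S' (D.stab A (T z)))
      = m⁻¹ * sform (-(Complex.I • D.vec)) z := by
    rw [← hS, hS'S, hSe', sform_smul_left, hadj, ← hTe', hT]
  have h3 : ‖inner ℂ D.vec (S' (D.stab A (T z)))‖ ^ 2 = (m⁻¹ * ‖inner ℂ D.vec z‖) ^ 2 := by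
    rw [norm_sq_inner_eq_sform, h1, h2, mul_pow m⁻¹ ‖_‖, norm_sq_inner_eq_sform]; ring
  have h4 := (sq_eq_sq₀ (norm_nonneg _) (by positivity)).1 h3
  have h5 := norm_inner_le_norm (𝕜 := ℂ) D.vec z
  rw [D.norm_vec, one_mul] at h5
  rw [ContinuousLinearMap.comp_apply, ContinuousLinearMap.comp_apply, h4]
  gcongr

/-- Invertible linear limits of symplectic maps are symplectic. -/
theorem IsSymplLimit.isSymplLinear {A : G →L[ℝ] G} (hA : IsSymplLimit A)
    (hAi : Function.Injective A) : IsSymplLinear A := by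
  obtain ⟨A', h⟩ := exists_sform_adjoint A
  refine isSymplLinear_of_sform_adjoint h fun p q => le_antisymm ?_ (hA.sform_adjoint_le hAi h p q)
  have := hA.sform_adjoint_le hAi h q p
  rw [sform_swap q p, sform_swap (A' q)] at this
  linarith

end Stabilization

section Rigidity

/-- Symplectic `C⁰`-rigidity, pointwise version. -/
theorem isSymplLinear_fderiv_of_limit {G : Type*} [NormedAddCommGroup G] [InnerProductSpace ℂ G]
    [FiniteDimensional ℂ G] {F : ℕ → G → G} {f : G → G} {R : ℝ}
    (hF : ∀ k, ContDiffOn ℝ 1 (F k) (ball 0 R))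
    (hs : ∀ k, ∀ z ∈ ball (0:G) R, IsSymplLinear (fderiv ℝ (F k) z))
    (hlim : ∀ ε > 0, ∃ k, ∀ z ∈ ball (0:G) R, ‖F k z - f z‖ ≤ ε)
    {y : G} (hy : y ∈ ball (0:G) R) (hf : DifferentiableAt ℝ f y)
    (hinj : Function.Injective (fderiv ℝ f y)) : IsSymplLinear (fderiv ℝ f y) := by
  refine IsSymplLimit.isSymplLinear ⟨1, one_pos, fun ε hε => ?_⟩ hinj
  set B := fderiv ℝ f y with hB
  have h1 := hasFDerivAt_iff_isLittleO_nhds_zero.1 hf.hasFDerivAt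
  have h2 := h1.def (c := ε / 3) (by positivity)
  have h3 : ∀ᶠ z in 𝓝 (0:G), y + z ∈ ball (0:G) R :=
    (continuous_const.add continuous_id).continuousAt.eventually_mem
      (isOpen_ball.mem_nhds (by simpa using hy))
  obtain ⟨η, hη, hηz⟩ := Metric.eventually_nhds_iff_ball.1 (h2.and h3)
  obtain ⟨k, hk⟩ := hlim (ε / 3 * η) (by positivity)
  have hm : ∀ z ∈ ball (0:G) 1, η • z ∈ ball (0:G) η := fun z hz => by
    rw [mem_ball_zero_iff] at hz ⊢
    rw [norm_smul, Real.norm_of_nonneg hη.le]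
    nlinarith
  have hmaps : MapsTo (fun z : G => y + η • z) (ball 0 1) (ball 0 R) := fun z hz =>
    (hηz _ (hm z hz)).2
  have hid : ContDiff ℝ 1 fun z : G => y + η • z := contDiff_const.add (contDiff_id.const_smul η)
  refine ⟨fun z => η⁻¹ • (F k (y + η • z) - F k y), IsSymplOn.of_hasFDerivAt
    (D := fun z => fderiv ℝ (F k) (y + η • z)) ?_ (fun z hz => ?_)
    (fun z hz => hs k _ (hmaps hz)) ?_, fun z hz => ?_⟩
  · exact (((hF k).comp hid.contDiffOn hmaps).sub contDiffOn_const).const_smul η⁻¹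
  · have d1 : HasFDerivAt (F k) (fderiv ℝ (F k) (y + η • z)) (y + η • z) :=
      (((hF k).contDiffAt (isOpen_ball.mem_nhds (hmaps hz))).differentiableAt
        one_ne_zero).hasFDerivAt
    have d2 : HasFDerivAt (fun z : G => y + η • z) (η • ContinuousLinearMap.id ℝ G) z :=
      ((hasFDerivAt_id z).const_smul η).const_add y
    refine (((d1.comp z d2).sub_const _).const_smul η⁻¹).congr_fderiv ?_
    ext w
    simp [smul_smul, inv_mul_cancel₀ hη.ne']
  · simp
  · obtain ⟨e1, e2⟩ := hηz _ (hm z hz)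
    have e3 := hk _ e2
    have e4 := hk y hy
    have e5 : η⁻¹ • (F k (y + η • z) - F k y) - B z = η⁻¹ • ((F k (y + η • z) - f (y + η • z))
        - (F k y - f y) + (f (y + η • z) - f y - B (η • z))) := by
      have : B z = η⁻¹ • B (η • z) := by
        rw [map_smul, smul_smul, inv_mul_cancel₀ hη.ne', one_smul]
      rw [this, ← smul_sub]; congr 1; abel
    have e6 : ‖η • z‖ ≤ η := (mem_ball_zero_iff.1 (hm z hz)).le
    have e7 : ε / 3 * ‖η • z‖ ≤ ε / 3 * η := by gcongr
    rw [e5, norm_smul, norm_inv, Real.norm_of_nonneg hη.le, inv_mul_le_iff₀ hη]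
    refine (norm_add_le _ _).trans ?_
    have e8 := norm_sub_le (F k (y + η • z) - f (y + η • z)) (F k y - f y)
    linarith

end Rigidity

/-- The phase space `ℝⁿ × ℝⁿ` is isometric and symplectomorphic to a complex inner product
space. -/
theorem exists_complex_model (n : ℕ) :
    ∃ (G : Type) (_ : NormedAddCommGroup G) (_ : InnerProductSpace ℂ G),
      FiniteDimensional ℂ G ∧ ∃ Φ : Esp n →ₗ[ℝ] G, Function.Surjective Φ ∧
        (∀ p, ‖Φ p‖ = eucNorm p) ∧ ∀ u v, sform (Φ u) (Φ v) = symplForm u v := by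
  refine ⟨EuclideanSpace ℂ (Fin n), inferInstance, inferInstance, inferInstance,
    { toFun := fun p => WithLp.toLp 2 fun j => ⟨p.1 j, p.2 j⟩
      map_add' := fun p q => by
        apply WithLp.ofLp_injective
        ext j; apply Complex.ext <;> rfl
      map_smul' := fun c p => by
        change _ = (c : ℂ) •
          (WithLp.toLp 2 fun j => (⟨p.1 j, p.2 j⟩ : ℂ) : EuclideanSpace ℂ (Fin n))
        apply WithLp.ofLp_injective
        ext j; apply Complex.ext <;> simp }, fun z => ?_, fun p => ?_, fun u v => ?_⟩
  · exact ⟨(WithLp.toLp 2 fun j => (z j).re, WithLp.toLp 2 fun j => (z j).im), rfl⟩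
  · change ‖(WithLp.toLp 2 fun j => (⟨p.1 j, p.2 j⟩ : ℂ) : EuclideanSpace ℂ (Fin n))‖ = _
    rw [eucNorm, EuclideanSpace.norm_eq, EuclideanSpace.norm_sq_eq, EuclideanSpace.norm_sq_eq,
      ← Finset.sum_add_distrib]
    refine congrArg Real.sqrt (Finset.sum_congr rfl fun j _ => ?_)
    rw [Complex.sq_norm, Complex.normSq_apply, Real.norm_eq_abs, Real.norm_eq_abs, sq_abs, sq_abs]
    simp only; ring
  · change (inner ℂ (WithLp.toLp 2 fun j => (⟨v.1 j, v.2 j⟩ : ℂ) : EuclideanSpace ℂ (Fin n))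
      (WithLp.toLp 2 fun j => (⟨u.1 j, u.2 j⟩ : ℂ))).im = _
    rw [symplForm, PiLp.inner_apply, PiLp.inner_apply, PiLp.inner_apply, Complex.im_sum,
      ← Finset.sum_sub_distrib]
    refine Finset.sum_congr rfl fun j _ => ?_
    simp
    ring

/-- Gromov–Eliashberg C⁰-rigidity.  If `φ k` are symplectic maps of class `C¹`
on the open ball `B_R ⊆ ℝⁿ × ℝⁿ` converging uniformly on `B_R` to a `C¹` map `φ∞` whose
differential is everywhere a linear isomorphism, then `φ∞` is symplectic on `B_R`. -/
theorem stmt_0 (n : ℕ) (hn : 1 ≤ n) (R : ℝ) (hR : 0 < R)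
    (φ : ℕ → Esp n → Esp n) (φinf : Esp n → Esp n)
    (hC1 : ∀ k, ContDiffOn ℝ 1 (φ k) (eucBall n R))
    (hC1inf : ContDiffOn ℝ 1 φinf (eucBall n R))
    (hsymp : ∀ k, ∀ x ∈ eucBall n R, ∀ u v : Esp n,
      symplForm (fderiv ℝ (φ k) x u) (fderiv ℝ (φ k) x v) = symplForm u v)
    (hconv : ∀ ε > (0:ℝ), ∃ N : ℕ, ∀ k ≥ N, ∀ x ∈ eucBall n R,
      eucNorm (φ k x - φinf x) ≤ ε)
    (hiso : ∀ x ∈ eucBall n R, Function.Bijective (fderiv ℝ φinf x)) :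
    ∀ x ∈ eucBall n R, ∀ u v : Esp n,
      symplForm (fderiv ℝ φinf x u) (fderiv ℝ φinf x v) = symplForm u v := by
  obtain ⟨G, _, _, hfd, Φ₀, hsurj, hnorm, hform⟩ := exists_complex_model n
  have hfdr : FiniteDimensional ℝ G := FiniteDimensional.complexToReal G
  have hker : Function.Injective Φ₀ := by
    refine (injective_iff_map_eq_zero Φ₀).2 fun p hp => ?_
    have h1 : eucNorm p = 0 := by rw [← hnorm, hp, norm_zero]
    rw [eucNorm, Real.sqrt_eq_zero (by positivity)] at h1
    have h2 : ‖p.1‖ = 0 := by nlinarith [sq_nonneg ‖p.1‖, sq_nonneg ‖p.2‖]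
    have h3 : ‖p.2‖ = 0 := by nlinarith [sq_nonneg ‖p.1‖, sq_nonneg ‖p.2‖]
    exact Prod.ext (norm_eq_zero.1 h2) (norm_eq_zero.1 h3)
  let Φ : Esp n ≃L[ℝ] G := (LinearEquiv.ofBijective Φ₀ ⟨hker, hsurj⟩).toContinuousLinearEquiv
  have hΦn : ∀ p, ‖Φ p‖ = eucNorm p := hnorm
  have hΦs : ∀ u v, sform (Φ u) (Φ v) = symplForm u v := hform
  have hmaps : MapsTo Φ.symm (ball (0:G) R) (eucBall n R) := fun z hz => by
    rw [mem_ball_zero_iff, ← Φ.apply_symm_apply z, hΦn] at hz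
    exact hz
  have hopen : IsOpen (eucBall n R) := by
    have : eucBall n R = Φ ⁻¹' ball 0 R := by
      ext p; rw [mem_preimage, mem_ball_zero_iff, hΦn]; rfl
    rw [this]; exact isOpen_ball.preimage Φ.continuous
  have hconj : ∀ {g : Esp n → Esp n}, ContDiffOn ℝ 1 g (eucBall n R) → ∀ z ∈ ball (0:G) R,
      HasFDerivAt (fun z => Φ (g (Φ.symm z)))
        ((Φ : Esp n →L[ℝ] G) ∘L fderiv ℝ g (Φ.symm z) ∘L (Φ.symm : G →L[ℝ] Esp n)) z := by
    intro g hg z hz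
    have h1 : HasFDerivAt g (fderiv ℝ g (Φ.symm z)) (Φ.symm z) :=
      ((hg.contDiffAt (hopen.mem_nhds (hmaps hz))).differentiableAt one_ne_zero).hasFDerivAt
    exact Φ.hasFDerivAt.comp z (h1.comp z Φ.symm.hasFDerivAt)
  intro x hx u v
  have hy : Φ x ∈ ball (0:G) R := by rw [mem_ball_zero_iff, hΦn]; exact hx
  have hd := hconj hC1inf _ hy
  have key := isSymplLinear_fderiv_of_limit (F := fun k z => Φ (φ k (Φ.symm z)))
    (f := fun z => Φ (φinf (Φ.symm z))) (R := R)
    (fun k => Φ.contDiff.comp_contDiffOn ((hC1 k).comp Φ.symm.contDiff.contDiffOn hmaps))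
    (fun k z hz u v => by
      rw [(hconj (hC1 k) z hz).fderiv]
      simp only [ContinuousLinearMap.comp_apply, ContinuousLinearEquiv.coe_coe]
      rw [hΦs, hsymp k _ (hmaps hz), ← hΦs, Φ.apply_symm_apply, Φ.apply_symm_apply])
    (fun ε hε => by
      obtain ⟨N, hN⟩ := hconv ε hε
      refine ⟨N, fun z hz => ?_⟩
      rw [← map_sub, hΦn]
      exact hN N le_rfl _ (hmaps hz))
    hy hd.differentiableAt (by
      rw [hd.fderiv, Φ.symm_apply_apply]
      exact Φ.injective.comp ((hiso x hx).1.comp Φ.symm.injective))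
  have h1 := key (Φ u) (Φ v)
  rw [hd.fderiv, Φ.symm_apply_apply] at h1
  simpa only [ContinuousLinearMap.comp_apply, ContinuousLinearEquiv.coe_coe,
    Φ.symm_apply_apply, hΦs] using h1
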